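/- Let m ≥ 1, s ≥ 2, and t ∈ {1,…,s} be integers and r = ms + t. For every ϑ > 0 there exists ε₀ > 0 such that for every ε ∈ (0, ε₀] there exists C > 0 such that the following holds. Let G be an (m+1)-partite graph with vertex classes V₁ ∪ … ∪ V_{m+1} = V, where |V_i| = s|V|/r for i ∈ [m] and |V_{m+1}| = t|V|/r, and suppose each pair (V_i, V_j) with i ≠ j is (ε, d, ϑ)-super-regular in G for some d ≥ ϑ. Let n = |V| be divisible by r and p = C·n^{−2/s}·(log n)^{2/(s(s−1))}. Then with high probability (as n → ∞) the graph G ∪ G_{n,p} contains a K_r-factor. -/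

import Mathlib

open Finset
open scoped Classical

/-- The degree of a vertex (number of neighbours). -/
noncomputable def degR {V : Type*} (G : SimpleGraph V) (v : V) : ℕ :=
  Nat.card (G.neighborSet v)

/-- The number of edges of a graph on `Fin n`. -/
noncomputable def edgeCount {n : ℕ} (H : SimpleGraph (Fin n)) : ℕ := Nat.card H.edgeSet

/-- The probability that the binomial random graph `G_{n,p}` satisfies the property `P`. -/
noncomputable def Pr (n : ℕ) (p : ℝ) (P : SimpleGraph (Fin n) → Prop) : ℝ :=
  ∑ H : SimpleGraph (Fin n),
    if P H then p ^ edgeCount H * (1 - p) ^ (n.choose 2 - edgeCount H) else 0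

/-- `G` has a `K_r`-factor: a partition of the vertex set into `r`-cliques. -/
def HasCliqueFactor {n : ℕ} (G : SimpleGraph (Fin n)) (r : ℕ) : Prop :=
  ∃ P : Finpartition (Finset.univ : Finset (Fin n)), ∀ c ∈ P.parts, G.IsNClique r c

/-- The threshold function `p_s(n)`: `log n / n` if `s = 2` and `n^{-φ(s)}` with
`φ(s) = 2s/((s-1)(s+2))` if `s ≥ 3`. -/
noncomputable def pThr (s n : ℕ) : ℝ :=
  if s = 2 then Real.log n / n
  else (n : ℝ) ^ (-(2 * (s : ℝ)) / (((s : ℝ) - 1) * ((s : ℝ) + 2)))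

/-- The number of edges of `G` within the vertex set `S`. -/
noncomputable def edgesIn {V : Type*} (G : SimpleGraph V) (S : Set V) : ℕ :=
  Nat.card {e : Sym2 V // e ∈ G.edgeSet ∧ ∀ v ∈ e, v ∈ S}

/-- The number of ordered adjacent pairs between `S` and `T`. -/
noncomputable def edgesBtw {V : Type*} (G : SimpleGraph V) (S T : Set V) : ℕ :=
  Nat.card {p : V × V // p.1 ∈ S ∧ p.2 ∈ T ∧ G.Adj p.1 p.2}

/-- The edge density of the pair `(S, T)` in `G`. -/
noncomputable def density {V : Type*} (G : SimpleGraph V) (S T : Set V) : ℝ :=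
  (edgesBtw G S T : ℝ) / ((S.ncard : ℝ) * (T.ncard : ℝ))

/-- The pair `(S, T)` is `(ε, d)`-regular in `G`. -/
def IsRegularPair {V : Type*} (G : SimpleGraph V) (S T : Set V) (ε d : ℝ) : Prop :=
  ∀ X ⊆ S, ∀ Y ⊆ T, ε * S.ncard ≤ (X.ncard : ℝ) → ε * T.ncard ≤ (Y.ncard : ℝ) →
    |density G X Y - d| < ε

/-- The pair `(S, T)` is `(ε, d, ϑ)`-super-regular in `G`. -/
def IsSuperRegularPair {V : Type*} (G : SimpleGraph V) (S T : Set V) (ε d ϑ : ℝ) : Prop :=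
  IsRegularPair G S T ε d ∧
  (∀ v ∈ S, ϑ * T.ncard ≤ ((T ∩ G.neighborSet v).ncard : ℝ)) ∧
  (∀ v ∈ T, ϑ * S.ncard ≤ ((S ∩ G.neighborSet v).ncard : ℝ))

namespace KF
set_option linter.unusedSectionVars false
set_option linter.unusedSimpArgs false
section PartA
variable {X : Type*} [Fintype X] [DecidableEq X]

/-- product weight -/
noncomputable def pw (π : X → ℝ) (W : Finset X) : ℝ := (∏ x ∈ W, π x) * ∏ x ∈ Wᶜ, (1 - π x)

/-- expectation over a random subset -/
noncomputable def Ex (π : X → ℝ) (φ : Finset X → ℝ) : ℝ := ∑ W : Finset X, pw π W * φ W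

/-- expectation over a random subset of `s` -/
noncomputable def Es (π : X → ℝ) (s : Finset X) (φ : Finset X → ℝ) : ℝ :=
  ∑ W ∈ s.powerset, ((∏ x ∈ W, π x) * ∏ x ∈ s \ W, (1 - π x)) * φ W

lemma Ex_eq_Es (π : X → ℝ) (φ : Finset X → ℝ) : Ex π φ = Es π univ φ := by
  unfold Ex Es pw
  rw [Finset.powerset_univ]
  rfl

lemma Es_insert (π : X → ℝ) {s : Finset X} {a : X} (ha : a ∉ s) (φ : Finset X → ℝ) :
    Es π (insert a s) φ = (1 - π a) * Es π s φ + π a * Es π s (fun W => φ (insert a W)) := by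
  unfold Es
  rw [Finset.sum_powerset_insert ha, Finset.mul_sum, Finset.mul_sum]
  congr 1
  · apply Finset.sum_congr rfl
    intro W hW
    have hW' := Finset.mem_powerset.1 hW
    have haW : a ∉ W := fun h => ha (hW' h)
    have : insert a s \ W = insert a (s \ W) := by
      rw [Finset.insert_sdiff_of_notMem _ haW]
    rw [this, Finset.prod_insert (by simp [ha])]
    ring
  · apply Finset.sum_congr rfl
    intro W hW
    have hW' := Finset.mem_powerset.1 hW
    have haW : a ∉ W := fun h => ha (hW' h)
    have : insert a s \ insert a W = s \ W := by
      ext x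
      simp only [Finset.mem_sdiff, Finset.mem_insert]
      constructor
      · rintro ⟨h1 | h1, h2⟩
        · exact absurd (Or.inl h1) h2
        · exact ⟨h1, fun h => h2 (Or.inr h)⟩
      · rintro ⟨h1, h2⟩
        refine ⟨Or.inr h1, ?_⟩
        rintro (h | h)
        · exact ha (h ▸ h1)
        · exact h2 h
    rw [this, Finset.prod_insert haW]
    ring

lemma Es_lin (π : X → ℝ) (s : Finset X) (a b : ℝ) (φ ψ : Finset X → ℝ) :
    Es π s (fun W => a * φ W + b * ψ W) = a * Es π s φ + b * Es π s ψ := by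
  unfold Es
  rw [Finset.mul_sum, Finset.mul_sum, ← Finset.sum_add_distrib]
  apply Finset.sum_congr rfl
  intros; ring

lemma Es_union (π₁ π₂ : X → ℝ) (s : Finset X) : ∀ φ : Finset X → ℝ,
    Es π₁ s (fun W => Es π₂ s (fun W' => φ (W ∪ W'))) =
      Es (fun x => π₁ x + π₂ x - π₁ x * π₂ x) s φ := by
  induction s using Finset.induction_on with
  | empty => intro φ; simp [Es]
  | insert a s ha ih =>
    intro φ
    rw [Es_insert _ ha, Es_insert _ ha]
    simp only [Es_insert π₂ ha]
    rw [Es_lin, Es_lin]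
    have e1 : ∀ W W' : Finset X, W ∪ insert a W' = insert a (W ∪ W') := by intros; ext; simp
    have e2 : ∀ W W' : Finset X, insert a W ∪ W' = insert a (W ∪ W') := by
      intros; ext; simp
    simp only [e1, e2, Finset.insert_idem]
    rw [ih φ, ih (fun W => φ (insert a W))]
    ring

lemma Ex_union (π₁ π₂ : X → ℝ) (φ : Finset X → ℝ) :
    Ex π₁ (fun W => Ex π₂ (fun W' => φ (W ∪ W'))) =
      Ex (fun x => π₁ x + π₂ x - π₁ x * π₂ x) φ := by
  simp only [Ex_eq_Es]
  exact Es_union π₁ π₂ univ φ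

lemma pw_nonneg {π : X → ℝ} (h0 : ∀ x, 0 ≤ π x) (h1 : ∀ x, π x ≤ 1) (W : Finset X) :
    0 ≤ pw π W :=
  mul_nonneg (Finset.prod_nonneg fun x _ => h0 x)
    (Finset.prod_nonneg fun x _ => sub_nonneg.2 (h1 x))

lemma sum_pw (π : X → ℝ) : ∑ W : Finset X, pw π W = 1 := by
  have := Finset.prod_add π (fun x => 1 - π x) univ
  simp only [add_sub_cancel, Finset.prod_const_one, Finset.powerset_univ] at this
  rw [this]
  rfl

lemma Ex_const (π : X → ℝ) (c : ℝ) : Ex π (fun _ => c) = c := by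
  unfold Ex
  rw [← Finset.sum_mul, sum_pw, one_mul]

lemma Ex_mono {π : X → ℝ} (h0 : ∀ x, 0 ≤ π x) (h1 : ∀ x, π x ≤ 1) {φ ψ : Finset X → ℝ}
    (h : ∀ W, φ W ≤ ψ W) : Ex π φ ≤ Ex π ψ :=
  Finset.sum_le_sum fun W _ => mul_le_mul_of_nonneg_left (h W) (pw_nonneg h0 h1 W)

lemma Ex_nonneg {π : X → ℝ} (h0 : ∀ x, 0 ≤ π x) (h1 : ∀ x, π x ≤ 1) {φ : Finset X → ℝ}
    (h : ∀ W, 0 ≤ φ W) : 0 ≤ Ex π φ :=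
  Finset.sum_nonneg fun W _ => mul_nonneg (pw_nonneg h0 h1 W) (h W)

lemma Ex_add (π : X → ℝ) (φ ψ : Finset X → ℝ) :
    Ex π (fun W => φ W + ψ W) = Ex π φ + Ex π ψ := by
  unfold Ex
  rw [← Finset.sum_add_distrib]
  apply Finset.sum_congr rfl
  intros; ring

lemma Ex_mul (π : X → ℝ) (c : ℝ) (φ : Finset X → ℝ) :
    Ex π (fun W => c * φ W) = c * Ex π φ := by
  unfold Ex
  rw [Finset.mul_sum]
  apply Finset.sum_congr rfl
  intros; ring

lemma Ex_comm {Y : Type*} [Fintype Y] [DecidableEq Y] (π : X → ℝ) (ρ : Y → ℝ)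
    (φ : Finset X → Finset Y → ℝ) :
    Ex π (fun W => Ex ρ (fun Z => φ W Z)) = Ex ρ (fun Z => Ex π (fun W => φ W Z)) := by
  unfold Ex
  simp only [Finset.mul_sum]
  rw [Finset.sum_comm]
  apply Finset.sum_congr rfl; intro a _
  apply Finset.sum_congr rfl; intro b _
  ring

/-- only sets inside the support matter -/
lemma Ex_congr_supp (π : X → ℝ) {φ ψ : Finset X → ℝ}
    (h : ∀ W : Finset X, (∀ x ∈ W, π x ≠ 0) → φ W = ψ W) : Ex π φ = Ex π ψ := by
  unfold Ex
  apply Finset.sum_congr rfl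
  intro W _
  by_cases hW : ∀ x ∈ W, π x ≠ 0
  · rw [h W hW]
  · push Not at hW
    obtain ⟨x, hx, h0⟩ := hW
    have : pw π W = 0 := by
      unfold pw
      rw [Finset.prod_eq_zero hx h0, zero_mul]
    simp [this]

lemma Ex_anti {π π' : X → ℝ} (h0 : ∀ x, 0 ≤ π x) (hle : ∀ x, π x ≤ π' x) (h1 : ∀ x, π' x ≤ 1)
    {φ : Finset X → ℝ} (hφ : ∀ W W', W ⊆ W' → φ W' ≤ φ W) : Ex π' φ ≤ Ex π φ := by
  let ρ : X → ℝ := fun x => if π x = 1 then 0 else (π' x - π x) / (1 - π x)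
  have hρ : ∀ x, π x + ρ x - π x * ρ x = π' x := by
    intro x
    by_cases hx : π x = 1
    · simp only [ρ, hx, if_true]
      have := hle x; have := h1 x
      linarith
    · simp only [ρ, hx, if_false]
      have : (1 - π x) ≠ 0 := fun h => hx (by linarith)
      field_simp
      ring
  have hρ0 : ∀ x, 0 ≤ ρ x := by
    intro x
    by_cases hx : π x = 1
    · simp [ρ, hx]
    · simp only [ρ, hx, if_false]
      exact div_nonneg (by linarith [hle x]) (by linarith [hle x, h1 x])
  have hρ1 : ∀ x, ρ x ≤ 1 := by
    intro x
    by_cases hx : π x = 1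
    · simp [ρ, hx]
    · simp only [ρ, hx, if_false]
      have : 0 < 1 - π x := lt_of_le_of_ne (by linarith [hle x, h1 x]) (fun h => hx (by linarith))
      rw [div_le_one this]
      linarith [h1 x]
  have key := Ex_union π ρ φ
  simp only [hρ] at key
  rw [← key]
  apply Ex_mono h0 (fun x => (hle x).trans (h1 x))
  intro W
  calc Ex ρ (fun W' => φ (W ∪ W')) ≤ Ex ρ (fun _ => φ W) :=
        Ex_mono hρ0 hρ1 fun W' => hφ _ _ Finset.subset_union_left
    _ = φ W := Ex_const _ _

lemma pw_sdiff {π : X → ℝ} (h0 : ∀ x, 0 < π x) (h1 : ∀ x, π x ≤ 1) {Z T : Finset X} (hT : T ⊆ Z) :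
    pw π (Z \ T) ≤ pw π Z * ∏ x ∈ T, (π x)⁻¹ := by
  unfold pw
  have e1 : ∏ x ∈ Z, π x = (∏ x ∈ Z \ T, π x) * ∏ x ∈ T, π x := (Finset.prod_sdiff hT).symm
  have e2 : ∏ x ∈ (Z \ T)ᶜ, (1 - π x) = (∏ x ∈ Zᶜ, (1 - π x)) * ∏ x ∈ T, (1 - π x) := by
    rw [← Finset.prod_union]
    · congr 1
      ext x; simp only [Finset.mem_compl, Finset.mem_sdiff, Finset.mem_union]; tauto
    · rw [Finset.disjoint_left]; intro x hx hx'
      exact (Finset.mem_compl.1 hx) (hT hx')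
  have e3 : (∏ x ∈ T, π x) * ∏ x ∈ T, (π x)⁻¹ = 1 := by
    rw [← Finset.prod_mul_distrib]
    exact Finset.prod_eq_one fun x _ => mul_inv_cancel₀ (h0 x).ne'
  have e4 : ∏ x ∈ T, (1 - π x) ≤ 1 :=
    Finset.prod_le_one (fun x _ => sub_nonneg.2 (h1 x)) (fun x _ => by linarith [h0 x])
  rw [e2, e1]
  have n1 : 0 ≤ ∏ x ∈ Z \ T, π x := Finset.prod_nonneg fun x _ => (h0 x).le
  have n2 : 0 ≤ ∏ x ∈ Zᶜ, (1 - π x) := Finset.prod_nonneg fun x _ => sub_nonneg.2 (h1 x)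
  calc (∏ x ∈ Z \ T, π x) * ((∏ x ∈ Zᶜ, (1 - π x)) * ∏ x ∈ T, (1 - π x))
      ≤ (∏ x ∈ Z \ T, π x) * ((∏ x ∈ Zᶜ, (1 - π x)) * 1) := by gcongr
    _ = (∏ x ∈ Z \ T, π x) * (∏ x ∈ Zᶜ, (1 - π x)) * ((∏ x ∈ T, π x) * ∏ x ∈ T, (π x)⁻¹) := by
        rw [e3]; ring
    _ = _ := by ring

/-- splitting a random subset of `E ⊕ E` -/
lemma Ex_sum {E : Type*} [Fintype E] [DecidableEq E] (π : E ⊕ E → ℝ) (φ : Finset E → ℝ) :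
    Ex π (fun W => φ (W.toLeft ∪ W.toRight)) =
      Ex (fun e => π (Sum.inl e) + π (Sum.inr e) - π (Sum.inl e) * π (Sum.inr e)) φ := by
  rw [← Ex_union (fun e => π (Sum.inl e)) (fun e => π (Sum.inr e))]
  unfold Ex
  simp only [Finset.mul_sum]
  rw [← Finset.sum_product', Finset.univ_product_univ]
  apply Fintype.sum_equiv Finset.sumEquiv.toEquiv
  intro W
  have hW : W = W.toLeft.disjSum W.toRight := (Finset.toLeft_disjSum_toRight).symm
  have hWc : Wᶜ = (W.toLeftᶜ).disjSum (W.toRightᶜ) := by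
    ext x; cases x <;> simp
  have : pw π W = pw (fun e => π (Sum.inl e)) W.toLeft * pw (fun e => π (Sum.inr e)) W.toRight := by
    have h1 : ∏ x ∈ W, π x = (∏ x ∈ W.toLeft, π (Sum.inl x)) * ∏ x ∈ W.toRight, π (Sum.inr x) := by
      conv_lhs => rw [hW]
      rw [Finset.prod_disjSum]
    unfold pw
    rw [hWc, Finset.prod_disjSum, h1]
    ring
  rw [this]
  simp [mul_assoc]
end PartA
end KF

namespace KF
set_option linter.unusedSectionVars false
set_option linter.unusedSimpArgs false
section PartB

/-- indicator -/
noncomputable def ind (P : Prop) : ℝ := if P then 1 else 0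

lemma ind_nonneg (P : Prop) : 0 ≤ ind P := by unfold ind; split_ifs <;> norm_num
lemma ind_le_one (P : Prop) : ind P ≤ 1 := by unfold ind; split_ifs <;> norm_num
lemma ind_true {P : Prop} (h : P) : ind P = 1 := by simp [ind, h]
lemma ind_false {P : Prop} (h : ¬ P) : ind P = 0 := by simp [ind, h]
lemma ind_mono {P Q : Prop} (h : P → Q) : ind P ≤ ind Q := by
  by_cases hp : P
  · rw [ind_true hp, ind_true (h hp)]
  · rw [ind_false hp]; exact ind_nonneg Q

variable {X : Type*} [Fintype X] [DecidableEq X] {Ω : Type*} [Fintype Ω]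

/-- the minimum fragment size -/
noncomputable def tt (A : Finset Ω) (R : Ω → Finset X) (W : Finset X) (ω : Ω) : ℕ :=
  sInf {j | ∃ ω' ∈ A, R ω' \ W ⊆ R ω ∧ #(R ω' \ W) = j}

lemma tt_le (A : Finset Ω) (R : Ω → Finset X) (W : Finset X) {ω ω' : Ω} (h : ω' ∈ A)
    (h2 : R ω' \ W ⊆ R ω) : tt A R W ω ≤ #(R ω' \ W) :=
  Nat.sInf_le ⟨ω', h, h2, rfl⟩

lemma tt_spec (A : Finset Ω) (R : Ω → Finset X) (W : Finset X) {ω : Ω} (h : ω ∈ A) :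
    ∃ ω' ∈ A, R ω' \ W ⊆ R ω ∧ #(R ω' \ W) = tt A R W ω :=
  Nat.sInf_mem (s := {j | ∃ ω' ∈ A, R ω' \ W ⊆ R ω ∧ #(R ω' \ W) = j})
    ⟨#(R ω \ W), ω, h, Finset.sdiff_subset, rfl⟩

/-- μ-measure of `{T ⊆ S}` -/
noncomputable def mS (μ : Ω → ℝ) (S : Ω → Finset X) (T : Finset X) : ℝ :=
  ∑ ω, μ ω * ind (T ⊆ S ω)

/-- spread hypothesis -/
def HypS (μ : Ω → ℝ) (S : Ω → Finset X) (L0 : Finset X) (π : X → ℝ) (κ y : ℝ) (c : ℕ) : Prop :=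
  ∀ ω, ∀ D ⊆ S ω, ∃ Loc : Finset X, #Loc ≤ c * #D ∧ ∀ T ⊆ S ω, T \ L0 ⊆ D →
    (∏ x ∈ T, (π x)⁻¹) * mS μ S T ≤ κ ^ #T * y ^ #(T \ Loc)

lemma frag_struct (A : Finset Ω) (R : Ω → Finset X) (L0 B W : Finset X) (u : ℕ) {ω : Ω} (hω : ω ∈ A)
    (hu : u ≤ tt A R (W ∪ B) ω)
    (h2 : tt A R ((W ∩ L0) ∪ B) ω ≤ 2 * tt A R (W ∪ B) ω) :
    ∃ T : Finset X, Disjoint T W ∧ T ⊆ R ω ∧ u ≤ #T ∧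
      (∃ ω₁ ∈ A, R ω₁ ⊆ (W ∪ T) ∪ B) ∧
      ∀ ω₂ ∈ A, R ω₂ ⊆ (W ∪ T) ∪ B →
        (∀ ω₃ ∈ A, R ω₃ ⊆ (W ∪ T) ∪ B →
          #(R ω₂ \ (((W ∪ T) ∩ L0) ∪ B)) ≤ #(R ω₃ \ (((W ∪ T) ∩ L0) ∪ B))) →
        T ⊆ R ω₂ ∧ #(R ω₂ \ (((W ∪ T) ∩ L0) ∪ B)) ≤ 4 * #T ∧
          T \ L0 ⊆ R ω₂ \ (((W ∪ T) ∩ L0) ∪ B) := by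
  have hne : (A.filter fun ω' => R ω' \ (W ∪ B) ⊆ R ω).Nonempty :=
    ⟨ω, Finset.mem_filter.2 ⟨hω, Finset.sdiff_subset⟩⟩
  obtain ⟨ω', h', hmin⟩ := Finset.exists_min_image _
    (fun ω' => #(R ω' \ (W ∪ B)) + #(R ω' \ ((W ∩ L0) ∪ B))) hne
  rw [Finset.mem_filter] at h'
  obtain ⟨hA', hsub'⟩ := h'
  obtain ⟨ω1, hA1, hs1, hc1⟩ := tt_spec A R ((W ∩ L0) ∪ B) hω
  have hWW : (W ∩ L0) ∪ B ⊆ W ∪ B := Finset.union_subset_union_left Finset.inter_subset_left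
  have hss : R ω1 \ (W ∪ B) ⊆ R ω1 \ ((W ∩ L0) ∪ B) := Finset.sdiff_subset_sdiff le_rfl hWW
  have hm1 := hmin ω1 (by simp only [Finset.mem_filter]; exact ⟨hA1, hss.trans hs1⟩)
  have hcc := Finset.card_le_card hss
  have htT := tt_le A R (W ∪ B) hA' hsub'
  set T := R ω' \ (W ∪ B) with hT
  have hTW : Disjoint T W := by
    rw [Finset.disjoint_left]; intro x hx; simp only [hT, Finset.mem_sdiff, Finset.mem_union] at hx; tauto
  have hTB : ∀ x ∈ T, x ∉ B := by
    intro x hx; simp only [hT, Finset.mem_sdiff, Finset.mem_union] at hx; tauto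
  have hcand : R ω' ⊆ (W ∪ T) ∪ B := by
    intro x hx; simp only [hT, Finset.mem_sdiff, Finset.mem_union]; tauto
  refine ⟨T, hTW, hsub', hu.trans htT, ⟨ω', hA', hcand⟩, ?_⟩
  intro ω₂ hA2 hR2 hmin2
  have h3 := hmin2 ω' hA' hcand
  have hTR' : T ⊆ R ω' := Finset.sdiff_subset
  -- decomposition
  have hdec : ∀ Q : Finset X, #(Q \ ((W ∩ L0) ∪ B)) =
      #(Q \ (((W ∪ T) ∩ L0) ∪ B)) + #(Q ∩ (T ∩ L0)) := by
    intro Q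
    rw [← Finset.card_union_of_disjoint]
    · congr 1
      ext x
      have hb := hTB x
      have hw : x ∈ T → x ∉ W := fun h => Finset.disjoint_left.1 hTW h
      simp only [Finset.mem_sdiff, Finset.mem_union, Finset.mem_inter]
      tauto
    · rw [Finset.disjoint_left]
      intro x hx hx'
      simp only [Finset.mem_sdiff, Finset.mem_union, Finset.mem_inter] at hx hx'
      tauto
  have hsubT : R ω₂ \ (W ∪ B) ⊆ T := by
    intro x hx
    have := @hR2 x
    simp only [Finset.mem_sdiff, Finset.mem_union] at hx this
    tauto
  have hTR2 : T ⊆ R ω₂ := by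
    by_contra hcon
    have hlt : #(R ω₂ \ (W ∪ B)) < #T := by
      apply Finset.card_lt_card
      refine ⟨hsubT, fun h => hcon (h.trans Finset.sdiff_subset)⟩
    have h4 := hmin ω₂ (by simp only [Finset.mem_filter]; exact ⟨hA2, hsubT.trans hsub'⟩)
    have e1 := hdec (R ω₂)
    have e2 := hdec (R ω')
    have e3 : R ω' ∩ (T ∩ L0) = T ∩ L0 :=
      Finset.inter_eq_right.2 (Finset.inter_subset_left.trans hTR')
    have e4 : #(R ω₂ ∩ (T ∩ L0)) ≤ #(T ∩ L0) := Finset.card_le_card Finset.inter_subset_right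
    rw [e3] at e2
    omega
  refine ⟨hTR2, ?_, ?_⟩
  · have e2 := hdec (R ω')
    omega
  · intro x hx
    have hb := hTB x
    have hw : x ∈ T → x ∉ W := fun h => Finset.disjoint_left.1 hTW h
    have h2 := @hTR2 x
    simp only [Finset.mem_sdiff, Finset.mem_union, Finset.mem_inter] at hx ⊢
    tauto

lemma sum_loc (R Loc : Finset X) (y : ℝ) (hy : 0 ≤ y) :
    ∑ T ∈ R.powerset, y ^ #(T \ Loc) ≤ 2 ^ #Loc * (1 + y) ^ #R := by
  have h1 : ∀ T : Finset X, y ^ #(T \ Loc) = ∏ x ∈ T, (if x ∈ Loc then 1 else y) := by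
    intro T
    rw [Finset.prod_ite, Finset.prod_const_one, one_mul, Finset.prod_const]
    congr 2
    ext x; simp
  simp only [h1]
  have h2 := Finset.prod_add (fun x => if x ∈ Loc then (1:ℝ) else y) (fun _ => 1) R
  simp only [Finset.prod_const_one, mul_one] at h2
  rw [← h2]
  calc ∏ x ∈ R, ((if x ∈ Loc then (1:ℝ) else y) + 1)
      ≤ ∏ x ∈ R, ((if x ∈ Loc then (2:ℝ) else 1) * (1 + y)) := by
        apply Finset.prod_le_prod
        · intro x _; split_ifs <;> positivity
        · intro x _; split_ifs <;> nlinarith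
    _ = (∏ x ∈ R, (if x ∈ Loc then (2:ℝ) else 1)) * (1 + y) ^ #R := by
        rw [Finset.prod_mul_distrib, Finset.prod_const]
    _ ≤ 2 ^ #Loc * (1 + y) ^ #R := by
        apply mul_le_mul_of_nonneg_right _ (by positivity)
        rw [Finset.prod_ite, Finset.prod_const_one, mul_one, Finset.prod_const]
        apply pow_le_pow_right₀ (by norm_num)
        apply Finset.card_le_card
        intro x hx; simp at hx; exact hx.2

lemma OS (μ : Ω → ℝ) (hμ : ∀ ω, 0 ≤ μ ω) (S : Ω → Finset X) (L0 : Finset X) (π : X → ℝ)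
    (hπ0 : ∀ x, 0 < π x) (hπ1 : ∀ x, π x ≤ 1) (κ y : ℝ) (c : ℕ) (hκ : 0 < κ)
    (hκ1 : κ * 2 ^ (4 * c) ≤ 1) (hy : 0 ≤ y) (hH : HypS μ S L0 π κ y c)
    (A : Finset Ω) (R : Ω → Finset X) (k : ℕ) (hRS : ∀ ω ∈ A, R ω ⊆ S ω) (hRk : ∀ ω ∈ A, #(R ω) ≤ k)
    (u : ℕ) (B : Finset X) :
    Ex π (fun W => ∑ ω ∈ A, μ ω * ind (u ≤ tt A R (W ∪ B) ω ∧
      tt A R ((W ∩ L0) ∪ B) ω ≤ 2 * tt A R (W ∪ B) ω)) ≤ (κ * 2 ^ (4 * c)) ^ u * (1 + y) ^ k := by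
  set β := (κ * 2 ^ (4 * c)) ^ u * (1 + y) ^ k with hβ
  have hβ0 : 0 ≤ β := by positivity
  -- the set of admissible pairs
  let OK : Finset X → Finset X → Prop := fun Z T => u ≤ #T ∧
      (∃ ω₁ ∈ A, R ω₁ ⊆ Z ∪ B) ∧
      ∀ ω₂ ∈ A, R ω₂ ⊆ Z ∪ B →
        (∀ ω₃ ∈ A, R ω₃ ⊆ Z ∪ B →
          #(R ω₂ \ ((Z ∩ L0) ∪ B)) ≤ #(R ω₃ \ ((Z ∩ L0) ∪ B))) →
        T ⊆ R ω₂ ∧ #(R ω₂ \ ((Z ∩ L0) ∪ B)) ≤ 4 * #T ∧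
          T \ L0 ⊆ R ω₂ \ ((Z ∩ L0) ∪ B)
  have hm0 : ∀ T, 0 ≤ mS μ S T := fun T =>
    Finset.sum_nonneg fun ω _ => mul_nonneg (hμ ω) (ind_nonneg _)
  have step1 : ∀ W : Finset X, ∑ ω ∈ A, μ ω * ind (u ≤ tt A R (W ∪ B) ω ∧
      tt A R ((W ∩ L0) ∪ B) ω ≤ 2 * tt A R (W ∪ B) ω) ≤
      ∑ T ∈ Wᶜ.powerset, ind (OK (W ∪ T) T) * mS μ S T := by
    intro W
    unfold mS
    simp only [Finset.mul_sum]
    rw [Finset.sum_comm]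
    refine le_trans ?_ (Finset.sum_le_sum_of_subset_of_nonneg (Finset.subset_univ A)
      (fun ω _ _ => Finset.sum_nonneg fun T _ => mul_nonneg (ind_nonneg _)
        (mul_nonneg (hμ ω) (ind_nonneg _))))
    apply Finset.sum_le_sum
    intro ω hω
    by_cases hb : u ≤ tt A R (W ∪ B) ω ∧ tt A R ((W ∩ L0) ∪ B) ω ≤ 2 * tt A R (W ∪ B) ω
    · rw [ind_true hb, mul_one]
      obtain ⟨T, h1, h2, h3, h4, h5⟩ := frag_struct A R L0 B W u hω hb.1 hb.2
      have hTm : T ∈ Wᶜ.powerset := by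
        rw [Finset.mem_powerset]; intro x hx; rw [Finset.mem_compl]
        exact Finset.disjoint_left.1 h1 hx
      refine le_trans ?_ (Finset.single_le_sum (f := fun T => ind (OK (W ∪ T) T) * (μ ω * ind (T ⊆ S ω)))
        (fun T _ => mul_nonneg (ind_nonneg _) (mul_nonneg (hμ ω) (ind_nonneg _))) hTm)
      have hok : OK (W ∪ T) T := ⟨h3, h4, h5⟩
      rw [ind_true hok, ind_true (h2.trans (hRS ω hω))]
      simp
    · rw [ind_false hb, mul_zero]
      exact Finset.sum_nonneg fun T _ => mul_nonneg (ind_nonneg _) (mul_nonneg (hμ ω) (ind_nonneg _))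
  have step2 : ∀ Z : Finset X, ∑ T ∈ Z.powerset, pw π (Z \ T) * (ind (OK Z T) * mS μ S T) ≤ pw π Z * β := by
    intro Z
    have hp := pw_nonneg (fun x => (hπ0 x).le) hπ1 Z
    by_cases hex : ∃ ω₁ ∈ A, R ω₁ ⊆ Z ∪ B
    · have hne : (A.filter fun ω => R ω ⊆ Z ∪ B).Nonempty := by
        obtain ⟨ω, h1, h2⟩ := hex; exact ⟨ω, by simp [h1, h2]⟩
      obtain ⟨ω₂, h2, hmin⟩ := Finset.exists_min_image _ (fun ω => #(R ω \ ((Z ∩ L0) ∪ B))) hne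
      rw [Finset.mem_filter] at h2
      have hmin' : ∀ ω₃ ∈ A, R ω₃ ⊆ Z ∪ B →
          #(R ω₂ \ ((Z ∩ L0) ∪ B)) ≤ #(R ω₃ \ ((Z ∩ L0) ∪ B)) := fun ω₃ h3 h4 =>
        hmin ω₃ (by simp [h3, h4])
      obtain ⟨Loc, hLoc, hT⟩ := hH ω₂ (R ω₂ \ ((Z ∩ L0) ∪ B)) (Finset.sdiff_subset.trans (hRS _ h2.1))
      have key : ∀ T ∈ Z.powerset, pw π (Z \ T) * (ind (OK Z T) * mS μ S T) ≤
          pw π Z * ((κ * 2 ^ (4 * c)) ^ u * (2 ^ #Loc)⁻¹) * (if T ⊆ R ω₂ then y ^ #(T \ Loc) else 0) := by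
        intro T hTZ
        rw [Finset.mem_powerset] at hTZ
        by_cases hok : OK Z T
        · obtain ⟨k1, -, k3⟩ := hok
          obtain ⟨k4, k5, k6⟩ := k3 ω₂ h2.1 h2.2 hmin'
          rw [if_pos k4]
          have h7 := hT T (k4.trans (hRS _ h2.1)) k6
          have h8 := pw_sdiff hπ0 hπ1 hTZ
          have h9 : κ ^ #T ≤ (κ * 2 ^ (4 * c)) ^ u * (2 ^ #Loc)⁻¹ := by
            rw [← div_eq_mul_inv, le_div_iff₀ (by positivity)]
            calc κ ^ #T * 2 ^ #Loc ≤ κ ^ #T * 2 ^ (4 * c * #T) := by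
                  apply mul_le_mul_of_nonneg_left _ (by positivity)
                  apply pow_le_pow_right₀ (by norm_num)
                  calc #Loc ≤ c * #(R ω₂ \ ((Z ∩ L0) ∪ B)) := hLoc
                    _ ≤ c * (4 * #T) := Nat.mul_le_mul_left _ k5
                    _ = _ := by ring
              _ = (κ * 2 ^ (4 * c)) ^ #T := by rw [mul_pow, ← pow_mul]
              _ ≤ _ := pow_le_pow_of_le_one (by positivity) hκ1 k1
          have n1 : 0 ≤ ∏ x ∈ T, (π x)⁻¹ := Finset.prod_nonneg fun x _ => inv_nonneg.2 (hπ0 x).le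
          calc pw π (Z \ T) * (ind (OK Z T) * mS μ S T) ≤ (pw π Z * ∏ x ∈ T, (π x)⁻¹) * (1 * mS μ S T) := by
                apply mul_le_mul h8 _ (mul_nonneg (ind_nonneg _) (hm0 T)) (mul_nonneg hp n1)
                exact mul_le_mul_of_nonneg_right (ind_le_one _) (hm0 T)
            _ = pw π Z * ((∏ x ∈ T, (π x)⁻¹) * mS μ S T) := by ring
            _ ≤ pw π Z * (κ ^ #T * y ^ #(T \ Loc)) := mul_le_mul_of_nonneg_left h7 hp
            _ ≤ pw π Z * (((κ * 2 ^ (4 * c)) ^ u * (2 ^ #Loc)⁻¹) * y ^ #(T \ Loc)) := by gcongr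
            _ = _ := by ring
        · rw [ind_false hok]
          simp only [zero_mul, mul_zero]
          split_ifs <;> positivity
      refine (Finset.sum_le_sum key).trans ?_
      rw [← Finset.mul_sum, mul_assoc]
      apply mul_le_mul_of_nonneg_left _ hp
      have h10 : ∑ T ∈ Z.powerset, (if T ⊆ R ω₂ then y ^ #(T \ Loc) else 0) ≤
          ∑ T ∈ (R ω₂).powerset, y ^ #(T \ Loc) := by
        rw [← Finset.sum_filter]
        apply Finset.sum_le_sum_of_subset_of_nonneg
        · intro T hT; simp at hT ⊢; exact hT.2
        · intros; positivity
      calc (κ * 2 ^ (4 * c)) ^ u * (2 ^ #Loc)⁻¹ * ∑ T ∈ Z.powerset, (if T ⊆ R ω₂ then y ^ #(T \ Loc) else 0)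
          ≤ (κ * 2 ^ (4 * c)) ^ u * (2 ^ #Loc)⁻¹ * (2 ^ #Loc * (1 + y) ^ #(R ω₂)) := by
            apply mul_le_mul_of_nonneg_left (h10.trans (sum_loc _ _ _ hy)) (by positivity)
        _ = (κ * 2 ^ (4 * c)) ^ u * (1 + y) ^ #(R ω₂) := by
            field_simp
        _ ≤ β := by
            apply mul_le_mul_of_nonneg_left _ (by positivity)
            exact pow_le_pow_right₀ (by linarith) (hRk _ h2.1)
    · have : ∀ T ∈ Z.powerset, pw π (Z \ T) * (ind (OK Z T) * mS μ S T) = 0 := by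
        intro T _
        rw [ind_false (fun h => hex h.2.1)]; ring
      rw [Finset.sum_eq_zero this]
      positivity
  calc Ex π _ ≤ Ex π (fun W => ∑ T ∈ Wᶜ.powerset, ind (OK (W ∪ T) T) * mS μ S T) :=
        Ex_mono (fun x => (hπ0 x).le) hπ1 step1
    _ = ∑ Z : Finset X, ∑ T ∈ Z.powerset, pw π (Z \ T) * (ind (OK Z T) * mS μ S T) := by
        unfold Ex
        simp only [Finset.mul_sum]
        rw [Finset.sum_sigma', Finset.sum_sigma']
        refine Finset.sum_nbij' (fun p => ⟨p.1 ∪ p.2, p.2⟩) (fun p => ⟨p.1 \ p.2, p.2⟩) ?_ ?_ ?_ ?_ ?_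
        · rintro ⟨W, T⟩ h
          simp only [Finset.mem_sigma, Finset.mem_univ, Finset.mem_powerset, true_and]
          exact Finset.subset_union_right
        · rintro ⟨W, T⟩ h; simp only [Finset.mem_sigma, Finset.mem_univ, Finset.mem_powerset, true_and]
          intro x hx; simp [hx]
        · rintro ⟨W, T⟩ h
          simp only [Finset.mem_sigma, Finset.mem_univ, Finset.mem_powerset, true_and] at h
          have : (W ∪ T) \ T = W := by
            ext x; have := @h x; simp only [Finset.mem_compl, Finset.mem_sdiff, Finset.mem_union] at this ⊢; tauto
          simp [this]
        · rintro ⟨W, T⟩ h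
          simp only [Finset.mem_sigma, Finset.mem_univ, Finset.mem_powerset, true_and] at h
          simp [Finset.union_eq_left.2 h]
        · rintro ⟨W, T⟩ h
          simp only [Finset.mem_sigma, Finset.mem_univ, Finset.mem_powerset, true_and] at h
          have : (W ∪ T) \ T = W := by
            ext x; have := @h x; simp only [Finset.mem_compl, Finset.mem_sdiff, Finset.mem_union] at this ⊢; tauto
          simp only [this]
    _ ≤ ∑ Z : Finset X, pw π Z * β := Finset.sum_le_sum fun Z _ => step2 Z
    _ = β := by rw [← Finset.sum_mul, sum_pw, one_mul]
end PartB
end KF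

namespace KF
set_option linter.unusedSectionVars false
set_option linter.unusedSimpArgs false
section PartB2
variable {X : Type*} [Fintype X] [DecidableEq X] {Ω : Type*} [Fintype Ω]

/-- layer-0 part of `π` -/
noncomputable def piA (L0 : Finset X) (π : X → ℝ) : X → ℝ := fun x => if x ∈ L0 then π x else 0
/-- layer-1 part of `π` -/
noncomputable def piB (L0 : Finset X) (π : X → ℝ) : X → ℝ := fun x => if x ∈ L0 then 0 else π x
/-- probability for `L` rounds of layer 1 -/
noncomputable def piL (L0 : Finset X) (π : X → ℝ) (L : ℕ) : X → ℝ := fun x => 1 - (1 - piB L0 π x) ^ L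
/-- probability for the epoch -/
noncomputable def piE (L0 : Finset X) (π : X → ℝ) (L : ℕ) : X → ℝ :=
  fun x => if x ∈ L0 then π x else 1 - (1 - π x) ^ L

variable (L0 : Finset X) (π : X → ℝ)

lemma piL_succ (L : ℕ) (φ : Finset X → ℝ) : Ex (piL L0 π (L + 1)) φ =
    Ex (piB L0 π) (fun Y => Ex (piL L0 π L) (fun C => φ (Y ∪ C))) := by
  rw [Ex_union]
  congr 1
  funext x
  simp only [piL]
  ring

lemma piE_eq (L : ℕ) (φ : Finset X → ℝ) : Ex (piE L0 π L) φ =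
    Ex (piA L0 π) (fun G => Ex (piL L0 π L) (fun C => φ (G ∪ C))) := by
  rw [Ex_union]
  congr 1
  funext x
  simp only [piL, piE, piA, piB]
  split_ifs <;> simp

lemma pi_split (φ : Finset X → ℝ) : Ex π φ =
    Ex (piA L0 π) (fun G => Ex (piB L0 π) (fun C => φ (G ∪ C))) := by
  rw [Ex_union]
  congr 1
  funext x
  simp only [piA, piB]
  split_ifs <;> simp

lemma piA_nonneg (hπ0 : ∀ x, 0 < π x) (hπ1 : ∀ x, π x ≤ 1) (x : X) : 0 ≤ piA L0 π x := by
  unfold piA; split_ifs; exacts [(hπ0 x).le, le_rfl]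
lemma piA_le (hπ0 : ∀ x, 0 < π x) (hπ1 : ∀ x, π x ≤ 1) (x : X) : piA L0 π x ≤ 1 := by
  unfold piA; split_ifs; exacts [(hπ1 x), zero_le_one]
lemma piB_nonneg (hπ0 : ∀ x, 0 < π x) (hπ1 : ∀ x, π x ≤ 1) (x : X) : 0 ≤ piB L0 π x := by
  unfold piB; split_ifs; exacts [le_rfl, (hπ0 x).le]
lemma piB_le (hπ0 : ∀ x, 0 < π x) (hπ1 : ∀ x, π x ≤ 1) (x : X) : piB L0 π x ≤ 1 := by
  unfold piB; split_ifs; exacts [zero_le_one, (hπ1 x)]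
lemma piL_nonneg (hπ0 : ∀ x, 0 < π x) (hπ1 : ∀ x, π x ≤ 1) (L : ℕ) (x : X) : 0 ≤ piL L0 π L x := by
  have h1 := piB_nonneg L0 π hπ0 hπ1 x
  have h2 := piB_le L0 π hπ0 hπ1 x
  unfold piL
  have := pow_le_one₀ (n := L) (sub_nonneg.2 h2) (by linarith)
  linarith
lemma piL_le (hπ0 : ∀ x, 0 < π x) (hπ1 : ∀ x, π x ≤ 1) (L : ℕ) (x : X) : piL L0 π L x ≤ 1 := by
  have h2 := piB_le L0 π hπ0 hπ1 x
  unfold piL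
  have := pow_nonneg (sub_nonneg.2 h2) L
  linarith
lemma piE_nonneg (hπ0 : ∀ x, 0 < π x) (hπ1 : ∀ x, π x ≤ 1) (L : ℕ) (x : X) : 0 ≤ piE L0 π L x := by
  unfold piE
  split_ifs
  · exact (hπ0 x).le
  · have := pow_le_one₀ (n := L) (sub_nonneg.2 (hπ1 x)) (by linarith [hπ0 x])
    linarith
lemma piE_le (hπ0 : ∀ x, 0 < π x) (hπ1 : ∀ x, π x ≤ 1) (L : ℕ) (x : X) : piE L0 π L x ≤ 1 := by
  unfold piE
  split_ifs
  · exact hπ1 x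
  · have := pow_nonneg (sub_nonneg.2 (hπ1 x)) L
    linarith

lemma epoch (hπ0 : ∀ x, 0 < π x) (hπ1 : ∀ x, π x ≤ 1) (μ : Ω → ℝ) (hμ : ∀ ω, 0 ≤ μ ω) (S : Ω → Finset X) 
    (κ y : ℝ) (c : ℕ) (hκ : 0 < κ)
    (hκ1 : κ * 2 ^ (4 * c) ≤ 1) (hy : 0 ≤ y) (hH : HypS μ S L0 π κ y c)
    (A : Finset Ω) (R : Ω → Finset X) (k : ℕ) (hRS : ∀ ω ∈ A, R ω ⊆ S ω) (hRk : ∀ ω ∈ A, #(R ω) ≤ k)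
    (u : ℕ) (L : ℕ) : ∀ B : Finset X,
    Ex (piA L0 π) (fun G => Ex (piL L0 π L) (fun C => ∑ ω ∈ A, μ ω *
      ind (u ≤ tt A R (G ∪ (B ∪ C)) ω ∧ tt A R (G ∪ B) ω < 2 ^ L * tt A R (G ∪ (B ∪ C)) ω))) ≤
      L * ((κ * 2 ^ (4 * c)) ^ u * (1 + y) ^ k) := by
  induction L with
  | zero =>
    intro B
    rw [show (fun G => Ex (piL L0 π 0) (fun C => ∑ ω ∈ A, μ ω *
      ind (u ≤ tt A R (G ∪ (B ∪ C)) ω ∧ tt A R (G ∪ B) ω < 2 ^ 0 * tt A R (G ∪ (B ∪ C)) ω)))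
      = fun _ => 0 from ?_]
    · rw [Ex_const]; simp
    · funext G
      rw [Ex_congr_supp (ψ := fun _ => 0), Ex_const]
      intro W hW
      have : W = ∅ := by
        rw [Finset.eq_empty_iff_forall_notMem]
        intro x hx
        exact hW x hx (by simp [piL])
      subst this
      simp [ind]
  | succ L ih =>
    intro B
    simp only [piL_succ]
    set β := ((κ * 2 ^ (4 * c)) ^ u * (1 + y) ^ k) with hβ
    have nA := piA_nonneg L0 π hπ0 hπ1
    have lA := piA_le L0 π hπ0 hπ1
    have nB := piB_nonneg L0 π hπ0 hπ1
    have lB := piB_le L0 π hπ0 hπ1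
    have nL := piL_nonneg L0 π hπ0 hπ1 L
    have lL := piL_le L0 π hπ0 hπ1 L
    have hpt : ∀ G Y C : Finset X, ∑ ω ∈ A, μ ω *
      ind (u ≤ tt A R (G ∪ (B ∪ (Y ∪ C))) ω ∧ tt A R (G ∪ B) ω < 2 ^ (L + 1) * tt A R (G ∪ (B ∪ (Y ∪ C))) ω)
      ≤ ∑ ω ∈ A, μ ω *
      ind (u ≤ tt A R (G ∪ ((B ∪ Y) ∪ C)) ω ∧ tt A R (G ∪ (B ∪ Y)) ω < 2 ^ L * tt A R (G ∪ ((B ∪ Y) ∪ C)) ω)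
      + ∑ ω ∈ A, μ ω * ind (u ≤ tt A R ((G ∪ Y) ∪ B) ω ∧ tt A R (G ∪ B) ω ≤ 2 * tt A R ((G ∪ Y) ∪ B) ω) := by
      intro G Y C
      rw [← Finset.sum_add_distrib]
      apply Finset.sum_le_sum
      intro ω _
      rw [← mul_add]
      apply mul_le_mul_of_nonneg_left _ (hμ ω)
      rw [show B ∪ (Y ∪ C) = (B ∪ Y) ∪ C by rw [Finset.union_assoc],
        show (G ∪ Y) ∪ B = G ∪ (B ∪ Y) by rw [Finset.union_assoc, Finset.union_comm Y B]]
      by_cases h1 : u ≤ tt A R (G ∪ ((B ∪ Y) ∪ C)) ω ∧ tt A R (G ∪ B) ω < 2 ^ (L + 1) * tt A R (G ∪ ((B ∪ Y) ∪ C)) ω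
      · by_cases h2 : tt A R (G ∪ (B ∪ Y)) ω < 2 ^ L * tt A R (G ∪ ((B ∪ Y) ∪ C)) ω
        · rw [ind_true h1, ind_true ⟨h1.1, h2⟩]
          linarith [ind_nonneg (u ≤ tt A R (G ∪ (B ∪ Y)) ω ∧ tt A R (G ∪ B) ω ≤ 2 * tt A R (G ∪ (B ∪ Y)) ω)]
        · push Not at h2
          have h3 : u ≤ tt A R (G ∪ (B ∪ Y)) ω ∧ tt A R (G ∪ B) ω ≤ 2 * tt A R (G ∪ (B ∪ Y)) ω := by
            constructor
            · have : 1 ≤ 2 ^ L := Nat.one_le_two_pow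
              nlinarith [h1.1]
            · have := h1.2
              rw [pow_succ] at this
              nlinarith
          rw [ind_true h1, ind_true h3]
          linarith [ind_nonneg (u ≤ tt A R (G ∪ ((B ∪ Y) ∪ C)) ω ∧ tt A R (G ∪ (B ∪ Y)) ω < 2 ^ L * tt A R (G ∪ ((B ∪ Y) ∪ C)) ω)]
      · rw [ind_false h1]
        exact add_nonneg (ind_nonneg _) (ind_nonneg _)
    calc _ ≤ Ex (piA L0 π) (fun G => Ex (piB L0 π) (fun Y => Ex (piL L0 π L) (fun C => 
          ∑ ω ∈ A, μ ω *
      ind (u ≤ tt A R (G ∪ ((B ∪ Y) ∪ C)) ω ∧ tt A R (G ∪ (B ∪ Y)) ω < 2 ^ L * tt A R (G ∪ ((B ∪ Y) ∪ C)) ω)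
      + ∑ ω ∈ A, μ ω * ind (u ≤ tt A R ((G ∪ Y) ∪ B) ω ∧ tt A R (G ∪ B) ω ≤ 2 * tt A R ((G ∪ Y) ∪ B) ω)))) :=
          Ex_mono nA lA fun G => Ex_mono nB lB fun Y => Ex_mono nL lL fun C => hpt G Y C
      _ = Ex (piB L0 π) (fun Y => Ex (piA L0 π) (fun G => Ex (piL L0 π L) (fun C => 
          ∑ ω ∈ A, μ ω *
      ind (u ≤ tt A R (G ∪ ((B ∪ Y) ∪ C)) ω ∧ tt A R (G ∪ (B ∪ Y)) ω < 2 ^ L * tt A R (G ∪ ((B ∪ Y) ∪ C)) ω))))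
      + Ex (piA L0 π) (fun G => Ex (piB L0 π) (fun Y =>
         ∑ ω ∈ A, μ ω * ind (u ≤ tt A R ((G ∪ Y) ∪ B) ω ∧ tt A R (G ∪ B) ω ≤ 2 * tt A R ((G ∪ Y) ∪ B) ω))) := by
          simp only [Ex_add, Ex_const]
          congr 1
          rw [Ex_comm]
      _ ≤ Ex (piB L0 π) (fun _ => L * β) + β := by
          apply add_le_add
          · exact Ex_mono nB lB fun Y => ih (B ∪ Y)
          · refine le_trans (le_of_eq ?_) (OS μ hμ S L0 π hπ0 hπ1 κ y c hκ hκ1 hy hH A R k hRS hRk u B)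
            rw [pi_split L0 π]
            apply Ex_congr_supp
            intro G hG
            apply Ex_congr_supp
            intro Y hY
            have : (G ∪ Y) ∩ L0 = G := by
              ext x
              have h1 := hG x
              have h2 := hY x
              simp only [piA, piB] at h1 h2
              simp only [Finset.mem_inter, Finset.mem_union]
              by_cases hx : x ∈ L0
              · simp [hx] at h1 h2 ⊢; exact fun h => absurd h h2
              · simp [hx] at h1 h2 ⊢; exact h1
            rw [this]
      _ = _ := by rw [Ex_const]; push_cast; ring

lemma epoch_final (hπ0 : ∀ x, 0 < π x) (hπ1 : ∀ x, π x ≤ 1) (μ : Ω → ℝ) (hμ : ∀ ω, 0 ≤ μ ω) (S : Ω → Finset X) 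
    (κ y : ℝ) (c : ℕ) (hκ : 0 < κ)
    (hκ1 : κ * 2 ^ (4 * c) ≤ 1) (hy : 0 ≤ y) (hH : HypS μ S L0 π κ y c)
    (A : Finset Ω) (R : Ω → Finset X) (k : ℕ) (hRS : ∀ ω ∈ A, R ω ⊆ S ω) (hRk : ∀ ω ∈ A, #(R ω) ≤ k)
    (u : ℕ) (hu : 1 ≤ u) (L : ℕ) (hL : k < 2 ^ L) :
    Ex (piE L0 π L) (fun W => ∑ ω ∈ A, μ ω * ind (u ≤ tt A R W ω)) ≤
      L * ((κ * 2 ^ (4 * c)) ^ u * (1 + y) ^ k) := by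
  refine le_trans ?_ (epoch L0 π hπ0 hπ1 μ hμ S κ y c hκ hκ1 hy hH A R k hRS hRk u L ∅)
  rw [piE_eq]
  apply Ex_mono (piA_nonneg L0 π hπ0 hπ1) (piA_le L0 π hπ0 hπ1)
  intro G
  apply Ex_mono (piL_nonneg L0 π hπ0 hπ1 L) (piL_le L0 π hπ0 hπ1 L)
  intro C
  apply Finset.sum_le_sum
  intro ω hω
  apply mul_le_mul_of_nonneg_left _ (hμ ω)
  apply ind_mono
  intro h
  rw [Finset.empty_union, Finset.union_empty]
  refine ⟨h, ?_⟩
  have h1 : tt A R G ω ≤ k :=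
    (tt_le A R G hω Finset.sdiff_subset).trans ((Finset.card_le_card Finset.sdiff_subset).trans (hRk ω hω))
  have h2 : 1 ≤ tt A R (G ∪ C) ω := hu.trans h
  nlinarith

/-- the main inductive claim -/
def ClaimC (μ : Ω → ℝ) (S : Ω → Finset X) (k : ℕ) (δ : ℝ) (π' : X → ℝ) : Prop :=
  ∀ (A : Finset Ω) (R : Ω → Finset X), (∀ ω ∈ A, R ω ⊆ S ω) → (∀ ω ∈ A, #(R ω) ≤ k) →
    Ex π' (fun W => ind (¬ ∃ ω ∈ A, R ω ⊆ W)) ≤ δ + 1 - ∑ ω ∈ A, μ ω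

lemma claimC_zero (μ : Ω → ℝ) (hμ : ∀ ω, 0 ≤ μ ω) (hμ1 : ∑ ω, μ ω = 1) (S : Ω → Finset X) :
    ClaimC μ S 0 0 (fun _ => 0) := by
  intro A R _ hk
  have hA : ∑ ω ∈ A, μ ω ≤ 1 := by
    rw [← hμ1]
    exact Finset.sum_le_sum_of_subset_of_nonneg (Finset.subset_univ _) fun ω _ _ => hμ ω
  rcases A.eq_empty_or_nonempty with rfl | ⟨ω, hω⟩
  · simp only [Finset.sum_empty]
    have : Ex (fun _ : X => (0:ℝ)) (fun W => ind (¬ ∃ ω ∈ (∅ : Finset Ω), R ω ⊆ W)) ≤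
      Ex (fun _ : X => (0:ℝ)) (fun _ => 1) := Ex_mono (by simp) (by simp) fun W => ind_le_one _
    rw [Ex_const] at this
    linarith
  · have h0 : R ω = ∅ := by
      have := hk ω hω
      simpa using this
    have : Ex (fun _ : X => (0:ℝ)) (fun W => ind (¬ ∃ ω ∈ A, R ω ⊆ W)) = 0 := by
      rw [show (fun W => ind (¬ ∃ ω ∈ A, R ω ⊆ W)) = fun _ => 0 from ?_, Ex_const]
      funext W
      rw [ind_false]
      push Not
      exact ⟨ω, hω, by simp [h0]⟩
    rw [this]
    linarith

lemma claimC_step (hπ0 : ∀ x, 0 < π x) (hπ1 : ∀ x, π x ≤ 1)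
    (μ : Ω → ℝ) (hμ : ∀ ω, 0 ≤ μ ω) (S : Ω → Finset X) 
    (κ y : ℝ) (c : ℕ) (hκ : 0 < κ)
    (hκ1 : κ * 2 ^ (4 * c) ≤ 1) (hy : 0 ≤ y) (hH : HypS μ S L0 π κ y c)
    (k k' L : ℕ) (hL : k < 2 ^ L) (δ : ℝ) (π' : X → ℝ) (hπ'0 : ∀ x, 0 ≤ π' x) (hπ'1 : ∀ x, π' x ≤ 1)
    (hC : ClaimC μ S k' δ π') :
    ClaimC μ S k (δ + L * ((κ * 2 ^ (4 * c)) ^ (k' + 1) * (1 + y) ^ k))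
      (fun x => piE L0 π L x + π' x - piE L0 π L x * π' x) := by
  intro A R hRS hRk
  rw [← Ex_union]
  have hep := epoch_final L0 π hπ0 hπ1 μ hμ S κ y c hκ hκ1 hy hH A R k hRS hRk (k' + 1) (by omega) L hL
  have nE := piE_nonneg L0 π hπ0 hπ1 L
  have lE := piE_le L0 π hπ0 hπ1 L
  have key : ∀ W : Finset X, Ex π' (fun W' => ind (¬ ∃ ω ∈ A, R ω ⊆ W ∪ W')) ≤
      (δ + 1 - ∑ ω ∈ A, μ ω) + ∑ ω ∈ A, μ ω * ind (k' + 1 ≤ tt A R W ω) := by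
    intro W
    have hch : ∀ ω, ∃ ω', ω ∈ A → ω' ∈ A ∧ R ω' \ W ⊆ R ω ∧ #(R ω' \ W) = tt A R W ω := by
      intro ω
      by_cases h : ω ∈ A
      · obtain ⟨ω', h1, h2⟩ := tt_spec A R W h
        exact ⟨ω', fun _ => ⟨h1, h2⟩⟩
      · exact ⟨ω, fun h' => absurd h' h⟩
    choose f hf using hch
    have h1 := hC (A.filter fun ω => ¬ (k' + 1 ≤ tt A R W ω)) (fun ω => R (f ω) \ W) (by
      intro ω hω
      rw [Finset.mem_filter] at hω
      exact (hf ω hω.1).2.1.trans (hRS ω hω.1)) (by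
      intro ω hω
      rw [Finset.mem_filter] at hω
      have := (hf ω hω.1).2.2
      omega)
    have h2 : Ex π' (fun W' => ind (¬ ∃ ω ∈ A, R ω ⊆ W ∪ W')) ≤
        Ex π' (fun W' => ind (¬ ∃ ω ∈ A.filter fun ω => ¬ (k' + 1 ≤ tt A R W ω), R (f ω) \ W ⊆ W')) := by
      apply Ex_mono hπ'0 hπ'1
      intro W'
      apply ind_mono
      intro h h'
      apply h
      obtain ⟨ω, hω, hs⟩ := h'
      rw [Finset.mem_filter] at hω
      refine ⟨f ω, (hf ω hω.1).1, ?_⟩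
      exact sdiff_le_iff.1 hs
    have h3 : ∑ ω ∈ A, μ ω = ∑ ω ∈ A, μ ω * ind (k' + 1 ≤ tt A R W ω) +
        ∑ ω ∈ A.filter fun ω => ¬ (k' + 1 ≤ tt A R W ω), μ ω := by
      rw [Finset.sum_filter, ← Finset.sum_add_distrib]
      apply Finset.sum_congr rfl
      intro ω _
      by_cases h : k' + 1 ≤ tt A R W ω
      · rw [ind_true h]; simp [h]
      · rw [ind_false h]; simp [h]
    linarith
  calc _ ≤ Ex (piE L0 π L) (fun W => (δ + 1 - ∑ ω ∈ A, μ ω) + ∑ ω ∈ A, μ ω * ind (k' + 1 ≤ tt A R W ω)) :=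
        Ex_mono nE lE key
    _ ≤ _ := by rw [Ex_add, Ex_const]; linarith
end PartB2
end KF

namespace KF
set_option linter.unusedSectionVars false
set_option linter.unusedSimpArgs false
set_option linter.unusedVariables false
section PartC

/-- non-loop pairs -/
abbrev EE (V : Type*) := {e : Sym2 V // ¬ e.IsDiag}

/-- underlying pair -/
def und {V : Type*} (x : EE V ⊕ EE V) : EE V := Sum.elim id id x

variable {V Λ Ω : Type*} [Fintype V] [Fintype Λ] [Fintype Ω]

/-- pair inside a block -/
def inb (blk : V → Λ) (e : EE V) : Prop := ∀ x ∈ e.1, ∀ y ∈ e.1, blk x = blk y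

/-- block label of a pair -/
noncomputable def bl (blk : V → Λ) (e : EE V) : Λ := blk (Quot.out e.1).1

lemma bl_eq {blk : V → Λ} {e : EE V} (h : inb blk e) {x : V} (hx : x ∈ e.1) : bl blk e = blk x :=
  h _ (Sym2.out_fst_mem e.1) _ hx

/-- designated edges -/
noncomputable def des (blk : V → Λ) (e : EE V) : Prop :=
  e = @Classical.epsilon (EE V) ⟨e⟩ (fun e' => inb blk e' ∧ bl blk e' = bl blk e)

lemma des_unique {blk : V → Λ} {e e' : EE V} (hb : bl blk e = bl blk e')
    (h : des blk e) (h' : des blk e') : e = e' := by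
  unfold des at h h'
  rw [h, h', hb]

lemma des_exists {blk : V → Λ} {e : EE V} (h : inb blk e) :
    ∃ e', inb blk e' ∧ bl blk e' = bl blk e ∧ des blk e' := by
  have := @Classical.epsilon_spec_aux (EE V) ⟨e⟩ (fun e' => inb blk e' ∧ bl blk e' = bl blk e) ⟨e, h, rfl⟩
  refine ⟨_, this.1, this.2, ?_⟩
  unfold des
  rw [this.2]

/-- the hyperedge associated with a block structure -/
noncomputable def SS (blk : V → Λ) : Finset (EE V ⊕ EE V) :=
  univ.filter fun x => inb blk (und x) ∧ (des blk (und x) ↔ x.isRight)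

lemma SS_inj {blk : V → Λ} {x y : EE V ⊕ EE V} (hx : x ∈ SS blk) (hy : y ∈ SS blk) (h : und x = und y) :
    x = y := by
  simp only [SS, Finset.mem_filter, Finset.mem_univ, true_and] at hx hy
  have h1 := hx.2
  have h2 := hy.2
  rw [h] at h1
  rcases x with x | x <;> rcases y with y | y <;> simp [und] at h h1 h2 ⊢
  · exact h
  · exact absurd h2 h1
  · exact absurd h1 h2
  · exact h

/-- the root map of a set of pairs -/
noncomputable def rt (T : Finset (EE V ⊕ EE V)) (x : V) : V :=
  Quotient.out (Quotient.mk (Relation.EqvGen.setoid (fun a b => ∃ e ∈ T, (und e).1 = s(a, b))) x)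

lemma rt_idem (T : Finset (EE V ⊕ EE V)) (x : V) : rt T (rt T x) = rt T x := by
  unfold rt; rw [Quotient.out_eq]

lemma rt_edge {T : Finset (EE V ⊕ EE V)} {e : EE V ⊕ EE V} (he : e ∈ T) {x y : V} (h : (und e).1 = s(x, y)) :
    rt T x = rt T y := by
  unfold rt
  congr 1
  apply Quotient.sound
  exact Relation.EqvGen.rel _ _ ⟨e, he, h⟩

lemma rt_blk {T : Finset (EE V ⊕ EE V)} {blk : V → Λ} (h : ∀ e ∈ T, inb blk (und e)) (x : V) :
    blk (rt T x) = blk x := by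
  have h1 : Relation.EqvGen (fun a b => ∃ e ∈ T, (und e).1 = s(a, b)) (rt T x) x :=
    Quotient.mk_out (s := Relation.EqvGen.setoid (fun a b => ∃ e ∈ T, (und e).1 = s(a, b))) x
  generalize rt T x = z at h1
  induction h1 with
  | rel a b hab =>
    obtain ⟨e, he, hs⟩ := hab
    exact h e he a (by rw [hs]; simp) b (by rw [hs]; simp)
  | refl => rfl
  | symm _ _ _ ih => exact ih.symm
  | trans _ _ _ _ _ ih1 ih2 => exact ih1.trans ih2

/-- vertex spread -/
def VS (μ : Ω → ℝ) (blk : Ω → V → Λ) (b : ℝ) : Prop :=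
  ∀ f : V → V, (∀ x, f (f x) = f x) →
    ∑ ω, μ ω * ind (∀ x, blk ω (f x) = blk ω x) ≤ b ^ #(univ.filter fun x => f x ≠ x)

/-- number of nonroots in a block -/
noncomputable def nrt (T : Finset (EE V ⊕ EE V)) (blk : V → Λ) (l : Λ) : Finset V :=
  univ.filter fun x => rt T x ≠ x ∧ blk x = l

/-- edges of a block -/
noncomputable def Tl (T : Finset (EE V ⊕ EE V)) (blk : V → Λ) (l : Λ) : Finset (EE V ⊕ EE V) :=
  T.filter fun x => bl blk (und x) = l

lemma prod_Tl (T : Finset (EE V ⊕ EE V)) (blk : V → Λ) (F : EE V ⊕ EE V → ℝ) :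
    ∏ l : Λ, ∏ x ∈ Tl T blk l, F x = ∏ x ∈ T, F x := by
  unfold Tl
  convert Finset.prod_fiberwise T (fun x => bl blk (und x)) F

lemma card_pairs (N : Finset V) : #((univ : Finset (EE V)).filter fun e => ∀ x ∈ e.1, x ∈ N) ≤ (#N).choose 2 := by
  rw [← Sym2.card_image_offDiag]
  apply Finset.card_le_card_of_injOn (fun e => e.1)
  · intro e he
    simp only [Finset.coe_filter, Finset.mem_univ, true_and, Set.mem_ofPred_eq] at he
    obtain ⟨e, hd⟩ := e
    induction e with | _ x y
    simp only [Finset.coe_image, Set.mem_image, Finset.mem_coe, Finset.mem_offDiag]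
    refine ⟨(x, y), ⟨he x (by simp), he y (by simp), ?_⟩, rfl⟩
    intro h
    exact hd (by simpa using h)
  · intro a _ b _ h
    exact Subtype.ext h

lemma card_Tl {T : Finset (EE V ⊕ EE V)} {blk : V → Λ} (hT : T ⊆ SS blk) (l : Λ) :
    #(Tl T blk l) ≤ (#(nrt T blk l) + 1).choose 2 := by
  have hin : ∀ e ∈ T, inb blk (und e) := fun e he => by
    have := hT he; simp only [SS, Finset.mem_filter] at this; exact this.2.1
  have h1 : #(Tl T blk l) ≤ #(((univ : Finset (EE V)).filter fun e => ∀ x ∈ e.1, x ∈ nrt T blk l).image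
      (fun e => e.1) ∪ (nrt T blk l).image (fun x => s(x, rt T x))) := by
    apply Finset.card_le_card_of_injOn (fun e => (und e).1)
    · intro e he
      simp only [Finset.mem_coe, Tl, Finset.mem_filter] at he
      obtain ⟨heT, hl⟩ := he
      have hb := hin e heT
      have hbl : ∀ x ∈ (und e).1, blk x = l := fun x hx => (bl_eq hb hx).symm.trans hl
      obtain ⟨x, y, hxy⟩ : ∃ x y, (und e).1 = s(x, y) := ⟨_, _, (Quot.out_eq _).symm⟩
      have hne : x ≠ y := by
        intro h
        apply (und e).2
        rw [hxy, h]; simp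
      have hx := hbl x (by rw [hxy]; simp)
      have hy := hbl y (by rw [hxy]; simp)
      have hr := rt_edge heT hxy
      simp only [Finset.coe_union, Set.mem_union, Finset.coe_image, Set.mem_image, Finset.mem_coe]
      by_cases h1 : rt T x = x
      · right
        refine ⟨y, ?_, ?_⟩
        · simp only [nrt, Finset.mem_filter, Finset.mem_univ, true_and]
          exact ⟨fun h => hne (by rw [← h1, hr, h]), hy⟩
        · rw [← hr, h1, hxy, Sym2.eq_swap]
      · by_cases h2 : rt T y = y
        · right
          refine ⟨x, ?_, ?_⟩
          · simp only [nrt, Finset.mem_filter, Finset.mem_univ, true_and]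
            exact ⟨h1, hx⟩
          · rw [hr, h2, hxy]
        · left
          refine ⟨und e, ?_, rfl⟩
          simp only [Finset.mem_filter, Finset.mem_univ, true_and, nrt]
          intro z hz
          rw [hxy] at hz
          simp only [Sym2.mem_iff] at hz
          rcases hz with rfl | rfl
          · exact ⟨h1, hx⟩
          · exact ⟨h2, hy⟩
    · intro a ha b hb h
      simp only [Finset.mem_coe, Tl, Finset.mem_filter] at ha hb
      exact SS_inj (hT ha.1) (hT hb.1) (Subtype.ext h)
  refine h1.trans ((Finset.card_union_le _ _).trans ?_)
  have h2 := (Finset.card_image_le (s := ((univ : Finset (EE V)).filter fun e => ∀ x ∈ e.1, x ∈ nrt T blk l))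
    (f := fun e => e.1)).trans (card_pairs (nrt T blk l))
  have h3 := Finset.card_image_le (s := nrt T blk l) (f := fun x => s(x, rt T x))
  have h4 : (#(nrt T blk l) + 1).choose 2 = #(nrt T blk l) + (#(nrt T blk l)).choose 2 := by
    rw [Nat.choose_succ_succ']; simp
  omega

lemma card_nrt {T : Finset (EE V ⊕ EE V)} {blk : V → Λ} (hT : T ⊆ SS blk) {s : ℕ} (hs : 1 ≤ s)
    (hfib : ∀ l, #(univ.filter fun x => blk x = l) ≤ s) (l : Λ) : #(nrt T blk l) + 1 ≤ s := by
  have hin : ∀ e ∈ T, inb blk (und e) := fun e he => by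
    have := hT he; simp only [SS, Finset.mem_filter] at this; exact this.2.1
  rcases (nrt T blk l).eq_empty_or_nonempty with h | ⟨y, hy⟩
  · rw [h]; simpa using hs
  · have hy' := hy
    simp only [nrt, Finset.mem_filter, Finset.mem_univ, true_and] at hy
    have h1 : rt T y ∉ nrt T blk l := by
      simp only [nrt, Finset.mem_filter, Finset.mem_univ, true_and]
      intro h; exact h.1 (rt_idem T y)
    rw [← Finset.card_insert_of_notMem h1]
    refine le_trans (Finset.card_le_card ?_) (hfib l)
    intro z hz
    rw [Finset.mem_insert] at hz
    simp only [nrt, Finset.mem_filter, Finset.mem_univ, true_and] at hz ⊢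
    rcases hz with rfl | hz
    · rw [rt_blk hin, hy.2]
    · exact hz.2

lemma card_blockedges (blk : V → Λ) {s : ℕ}
    (hfib : ∀ l, #(univ.filter fun x => blk x = l) ≤ s) (l : Λ) :
    #((univ : Finset (EE V)).filter fun e => inb blk e ∧ bl blk e = l) ≤ s.choose 2 := by
  refine le_trans (Finset.card_le_card ?_) ((card_pairs (univ.filter fun x => blk x = l)).trans
    (Nat.choose_le_choose 2 (hfib l)))
  intro e he
  simp only [Finset.mem_filter, Finset.mem_univ, true_and] at he ⊢
  intro x hx
  rw [← bl_eq he.1 hx, he.2]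

/-- numeric condition on a block -/
def NumC (s : ℕ) (b p q κ y : ℝ) : Prop :=
  (∀ ρ f0 f1 : ℕ, ρ + 1 ≤ s → f1 ≤ 1 → 1 ≤ f0 + f1 → f0 + f1 ≤ (ρ + 1).choose 2 →
    b ^ ρ * (p⁻¹ ^ f0 * q⁻¹ ^ f1) ≤ κ ^ (s.choose 2)) ∧
  (∀ ρ f0 : ℕ, ρ + 1 ≤ s → 1 ≤ f0 → f0 ≤ (ρ + 1).choose 2 → f0 + 1 ≤ s.choose 2 →
    b ^ ρ * p⁻¹ ^ f0 ≤ κ ^ (s.choose 2) * y ^ (s.choose 2))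

/-- layer zero -/
noncomputable def LZ (V : Type*) [Fintype V] : Finset (EE V ⊕ EE V) := univ.filter fun x => x.isLeft

lemma hypS_of_VS (μ : Ω → ℝ) (hμ : ∀ ω, 0 ≤ μ ω) (blk : Ω → V → Λ) (b p q κ y : ℝ) (s : ℕ) (hs : 1 ≤ s)
    (hb : 0 ≤ b) (hp : 0 < p) (hq : 0 < q)
    (hκ : 0 ≤ κ) (hκ1 : κ ≤ 1) (hy : 0 ≤ y) (hy1 : y ≤ 1)
    (hfib : ∀ ω l, #(univ.filter fun x => blk ω x = l) ≤ s)
    (hVS : VS μ blk b) (hN : NumC s b p q κ y) :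
    HypS μ (fun ω => SS (blk ω)) (LZ V) (Sum.elim (fun _ => p) (fun _ => q)) κ y (s.choose 2) := by
  intro ω D hD
  refine ⟨(SS (blk ω)).filter fun x => ∃ d ∈ D, bl (blk ω) (und x) = bl (blk ω) (und d), ?_, ?_⟩
  · have h1 : ((SS (blk ω)).filter fun x => ∃ d ∈ D, bl (blk ω) (und x) = bl (blk ω) (und d)) ⊆
        D.biUnion fun d => (SS (blk ω)).filter fun x => bl (blk ω) (und x) = bl (blk ω) (und d) := by
      intro x hx
      simp only [Finset.mem_filter, Finset.mem_biUnion] at hx ⊢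
      obtain ⟨hx, d, hd, h⟩ := hx
      exact ⟨d, hd, hx, h⟩
    refine (Finset.card_le_card h1).trans ?_
    rw [mul_comm]
    apply Finset.card_biUnion_le_card_mul
    intro d _
    refine le_trans ?_ (card_blockedges (blk ω) (hfib ω) (bl (blk ω) (und d)))
    apply Finset.card_le_card_of_injOn und
    · intro x hx
      simp only [Finset.coe_filter, Set.mem_ofPred_eq] at hx
      simp only [Finset.coe_filter, Set.mem_ofPred_eq, Finset.mem_univ, true_and]
      refine ⟨?_, hx.2⟩
      have := hx.1
      simp only [SS, Finset.mem_filter] at this; exact this.2.1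
    · intro x hx z hz h
      simp only [Finset.coe_filter, Set.mem_ofPred_eq] at hx hz
      exact SS_inj hx.1 hz.1 h
  · intro T hT hTD
    set Loc := (SS (blk ω)).filter fun x => ∃ d ∈ D, bl (blk ω) (und x) = bl (blk ω) (und d) with hLoc
    have hm : mS μ (fun ω => SS (blk ω)) T ≤ b ^ #(univ.filter fun x => rt T x ≠ x) := by
      refine le_trans ?_ (hVS (rt T) (rt_idem T))
      unfold mS
      apply Finset.sum_le_sum
      intro ω' _
      apply mul_le_mul_of_nonneg_left _ (hμ ω')
      apply ind_mono
      intro h x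
      apply rt_blk
      intro e he
      have := h he; simp only [SS, Finset.mem_filter] at this; exact this.2.1
    have hπ0 : ∀ x : EE V ⊕ EE V, 0 ≤ (Sum.elim (fun _ => p) (fun _ => q) x)⁻¹ := by
      rintro (x | x) <;> simp [hp.le, hq.le]
    refine (mul_le_mul_of_nonneg_left hm (Finset.prod_nonneg fun x _ => hπ0 x)).trans ?_
    have e1 : b ^ #(univ.filter fun x => rt T x ≠ x) = ∏ l : Λ, b ^ #(nrt T (blk ω) l) := by
      rw [Finset.prod_pow_eq_pow_sum]
      congr 1
      rw [Finset.card_eq_sum_card_fiberwise (f := blk ω) (t := univ) (by simp)]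
      apply Finset.sum_congr rfl
      intro l _
      unfold nrt
      rw [Finset.filter_filter]
    have e2 : ∏ x ∈ T, (Sum.elim (fun _ => p) (fun _ => q) x)⁻¹ =
        ∏ l : Λ, ∏ x ∈ Tl T (blk ω) l, (Sum.elim (fun _ => p) (fun _ => q) x)⁻¹ := by
      rw [prod_Tl]
    have e3 : κ ^ #T * y ^ #(T \ Loc) = ∏ l : Λ, ∏ x ∈ Tl T (blk ω) l, (κ * if x ∈ Loc then 1 else y) := by
      rw [prod_Tl, Finset.prod_mul_distrib, Finset.prod_const, Finset.prod_ite,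
        Finset.prod_const_one, one_mul, Finset.prod_const]
      congr 3
      ext x; simp
    rw [e1, e2, e3, ← Finset.prod_mul_distrib]
    apply Finset.prod_le_prod
    · intro l _
      exact mul_nonneg (Finset.prod_nonneg fun x _ => hπ0 x) (pow_nonneg hb _)
    · intro l _
      -- per-block estimate
      have hρ := card_nrt hT hs (hfib ω) l
      have hcT := card_Tl hT l
      have hchoose : (#(nrt T (blk ω) l) + 1).choose 2 ≤ s.choose 2 := Nat.choose_le_choose 2 hρ
      rcases (Tl T (blk ω) l).eq_empty_or_nonempty with h0 | hne
      · rw [h0]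
        simp only [Finset.prod_empty, one_mul]
        rcases (nrt T (blk ω) l).eq_empty_or_nonempty with h1 | ⟨x, hx⟩
        · rw [h1]; simp
        · -- a nonroot without edges is impossible
          exfalso
          simp only [nrt, Finset.mem_filter, Finset.mem_univ, true_and] at hx
          have hno : ∀ e ∈ T, ∀ z ∈ (und e).1, blk ω z ≠ l := by
            intro e he z hz hzl
            have : e ∈ Tl T (blk ω) l := by
              simp only [Tl, Finset.mem_filter]
              refine ⟨he, ?_⟩
              have hi := hT he; simp only [SS, Finset.mem_filter] at hi
              rw [bl_eq hi.2.1 hz, hzl]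
            rw [h0] at this
            simp at this
          have hbx : ∀ e ∈ T, inb (fun z => if z = x then (none : Option V) else some x) (und e) := by
            intro e he z hz w hw
            have hz' := hno e he z hz
            have hw' := hno e he w hw
            have : z ≠ x := fun h => hz' (h ▸ hx.2)
            have : w ≠ x := fun h => hw' (h ▸ hx.2)
            simp [*]
          have := rt_blk hbx x
          simp at this
          exact hx.1 this
      · set f0 := #((Tl T (blk ω) l).filter fun x => x.isLeft) with hf0
        set f1 := #((Tl T (blk ω) l).filter fun x => ¬ x.isLeft) with hf1
        have hf : f0 + f1 = #(Tl T (blk ω) l) := Finset.card_filter_add_card_filter_not _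
        have hpos : 1 ≤ #(Tl T (blk ω) l) := Finset.card_pos.2 hne
        have hf11 : f1 ≤ 1 := by
          rw [hf1, Finset.card_le_one]
          intro x hx z hz
          simp only [Tl, Finset.mem_filter] at hx hz
          have h1 := hT hx.1.1
          have h2 := hT hz.1.1
          simp only [SS, Finset.mem_filter, Finset.mem_univ, true_and] at h1 h2
          apply SS_inj (hT hx.1.1) (hT hz.1.1)
          apply des_unique (hx.1.2.trans hz.1.2.symm)
          · exact h1.2.2 (by simpa using hx.2)
          · exact h2.2.2 (by simpa using hz.2)
        have e4 : ∏ x ∈ Tl T (blk ω) l, (Sum.elim (fun _ => p) (fun _ => q) x)⁻¹ = p⁻¹ ^ f0 * q⁻¹ ^ f1 := by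
          rw [← Finset.prod_filter_mul_prod_filter_not _ (fun x => x.isLeft = true), hf0, hf1,
            ← Finset.prod_const, ← Finset.prod_const]
          congr 1
          · apply Finset.prod_congr rfl
            rintro (x | x) hx <;> simp at hx ⊢
          · apply Finset.prod_congr rfl
            rintro (x | x) hx <;> simp at hx ⊢
        rw [e4, mul_comm]
        by_cases hmeet : ∃ d ∈ D, bl (blk ω) (und d) = l
        · obtain ⟨d, hd, hdl⟩ := hmeet
          have e5 : ∏ x ∈ Tl T (blk ω) l, (κ * if x ∈ Loc then 1 else y) = κ ^ #(Tl T (blk ω) l) := by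
            rw [← Finset.prod_const]
            apply Finset.prod_congr rfl
            intro x hx
            simp only [Tl, Finset.mem_filter] at hx
            rw [if_pos, mul_one]
            rw [hLoc, Finset.mem_filter]
            exact ⟨hT hx.1, d, hd, hx.2.trans hdl.symm⟩
          rw [e5]
          exact (hN.1 _ f0 f1 hρ hf11 (by omega) (by omega)).trans
            (pow_le_pow_of_le_one hκ hκ1 (by omega))
        · have hnoR : ∀ x ∈ Tl T (blk ω) l, x.isLeft := by
            intro x hx
            by_contra hcon
            simp only [Tl, Finset.mem_filter] at hx
            apply hmeet
            refine ⟨x, hTD ?_, hx.2⟩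
            simp only [Finset.mem_sdiff, LZ, Finset.mem_filter, Finset.mem_univ, true_and]
            exact ⟨hx.1, hcon⟩
          have hf10 : f1 = 0 := by
            rw [hf1, Finset.card_eq_zero, Finset.filter_eq_empty_iff]
            intro x hx; simpa using hnoR x hx
          have hlt : #(Tl T (blk ω) l) + 1 ≤ s.choose 2 := by
            obtain ⟨x, hx⟩ := hne
            simp only [Tl, Finset.mem_filter] at hx
            have hi := hT hx.1
            simp only [SS, Finset.mem_filter, Finset.mem_univ, true_and] at hi
            obtain ⟨e', hin', hbl', hdes'⟩ := des_exists hi.1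
            have hnot : e' ∉ (Tl T (blk ω) l).image und := by
              intro hmem
              obtain ⟨z, hz, hze⟩ := Finset.mem_image.1 hmem
              have hzl := hnoR z hz
              simp only [Tl, Finset.mem_filter] at hz
              have hzi := hT hz.1
              simp only [SS, Finset.mem_filter, Finset.mem_univ, true_and] at hzi
              rw [hze] at hzi
              have := hzi.2.1 hdes'
              rcases z with z | z <;> simp at this hzl
            have hcard : #((Tl T (blk ω) l).image und) = #(Tl T (blk ω) l) := by
              apply Finset.card_image_of_injOn
              intro a ha c hc h
              simp only [Tl, Finset.coe_filter, Set.mem_ofPred_eq] at ha hc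
              exact SS_inj (hT ha.1) (hT hc.1) h
            rw [← hcard, ← Finset.card_insert_of_notMem hnot]
            refine (Finset.card_le_card ?_).trans (card_blockedges (blk ω) (hfib ω) l)
            intro z hz
            rw [Finset.mem_insert] at hz
            simp only [Finset.mem_filter, Finset.mem_univ, true_and]
            rcases hz with rfl | hz
            · exact ⟨hin', hbl'.trans hx.2⟩
            · obtain ⟨w, hw, rfl⟩ := Finset.mem_image.1 hz
              simp only [Tl, Finset.mem_filter] at hw
              have hwi := hT hw.1
              simp only [SS, Finset.mem_filter, Finset.mem_univ, true_and] at hwi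
              exact ⟨hwi.1, hw.2⟩
          have e5 : κ ^ (s.choose 2) * y ^ (s.choose 2) ≤
              ∏ x ∈ Tl T (blk ω) l, (κ * if x ∈ Loc then 1 else y) := by
            have h6 : (κ * y) ^ #(Tl T (blk ω) l) ≤
              ∏ x ∈ Tl T (blk ω) l, (κ * if x ∈ Loc then 1 else y) := by
              rw [← Finset.prod_const]
              apply Finset.prod_le_prod
              · intros; positivity
              · intro x _
                apply mul_le_mul_of_nonneg_left _ hκ
                split_ifs
                exacts [hy1, le_rfl]
            refine le_trans ?_ h6
            rw [← mul_pow]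
            exact pow_le_pow_of_le_one (by positivity) (mul_le_one₀ hκ1 hy hy1) (by omega)
          refine le_trans ?_ e5
          rw [hf10, pow_zero, mul_one]
          exact hN.2 _ f0 hρ (by omega) (by omega) (by omega)
end PartC
end KF

namespace KF
set_option linter.unusedSectionVars false
set_option linter.unusedSimpArgs false
set_option linter.unusedVariables false
section PartC2

lemma two_choose (ρ : ℕ) : (ρ + 1).choose 2 * 2 = (ρ + 1) * ρ := by
  have := Nat.add_one_mul_choose_eq ρ 1
  simp at this
  exact this.symm

lemma num_aux {s ρ f : ℕ} (hs : 2 ≤ s) {N K : ℝ} (hN : 1 ≤ N) (hK : 1 ≤ K) (hρ : ρ ≤ s) (hf : 2 * f + 1 ≤ s * ρ) :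
    (K / N) ^ ρ * (N ^ ((2:ℝ) / s)) ^ f ≤ K ^ s * N ^ (-(1:ℝ) / s) := by
  have hN0 : 0 < N := by linarith
  have hs0 : (0:ℝ) < s := by exact_mod_cast (by omega : 0 < s)
  have e : (K / N) ^ ρ * (N ^ ((2:ℝ) / s)) ^ f = K ^ ρ * N ^ ((2:ℝ) / s * f - ρ) := by
    rw [div_pow, ← Real.rpow_natCast (N ^ ((2:ℝ) / s)), ← Real.rpow_mul hN0.le, Real.rpow_sub hN0,
      Real.rpow_natCast]
    ring
  rw [e]
  apply mul_le_mul
  · exact pow_le_pow_right₀ hK hρ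
  · apply Real.rpow_le_rpow_of_exponent_le hN
    rw [div_mul_eq_mul_div, div_sub' hs0.ne', div_le_div_iff_of_pos_right hs0]
    have : (2 * f + 1 : ℝ) ≤ s * ρ := by exact_mod_cast hf
    linarith
  · positivity
  · positivity

lemma numC_of {s : ℕ} (hs : 2 ≤ s) {N K a l κ y L p : ℝ} (hN : 1 ≤ N) (hK : 1 ≤ K) (ha : 1 ≤ a) (hl : 1 ≤ l)
    (hL : 1 ≤ L) (hκ : 0 < κ) (hκ1 : κ ≤ 1) (hy : 0 < y) (hy1 : y ≤ 1)
    (hp : p = a * N ^ (-(2:ℝ) / s) * l ^ ((1:ℝ) / (s.choose 2 : ℕ))) (hp1 : p ≤ 1)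
    (hi : K ^ (s - 1) * L ≤ (a * κ) ^ (s.choose 2) * l)
    (hii : K ^ s * N ^ (-(1:ℝ) / s) * L ≤ κ ^ (s.choose 2) * y ^ (s.choose 2)) :
    NumC s (K / N) p (p / L) κ y := by
  have hN0 : 0 < N := by linarith
  have hs0 : (0:ℝ) < s := by exact_mod_cast (by omega : 0 < s)
  have hc2 : 2 * s.choose 2 = s * (s - 1) := by
    obtain ⟨s', rfl⟩ : ∃ s', s = s' + 1 := ⟨s - 1, by omega⟩
    have := two_choose s'
    simp; omega
  have hc1 : 1 ≤ s.choose 2 := Nat.choose_pos hs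
  have hcpos : (0:ℝ) < (s.choose 2 : ℕ) := by exact_mod_cast hc1
  have hpα : N ^ (-(2:ℝ) / s) ≤ p := by
    rw [hp]
    have h1 : 1 ≤ l ^ ((1:ℝ) / (s.choose 2 : ℕ)) := Real.one_le_rpow hl (by positivity)
    have h2 : 0 < N ^ (-(2:ℝ) / s) := by positivity
    calc N ^ (-(2:ℝ) / s) = 1 * N ^ (-(2:ℝ) / s) * 1 := by ring
      _ ≤ _ := by gcongr
  have hp0 : 0 < p := lt_of_lt_of_le (by positivity) hpα
  have hpinv : p⁻¹ ≤ N ^ ((2:ℝ) / s) := by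
    have := inv_anti₀ (by positivity) hpα
    rwa [← Real.rpow_neg hN0.le, neg_div, neg_neg] at this
  have hpinv1 : 1 ≤ p⁻¹ := (one_le_inv₀ hp0).2 hp1
  have hb0 : 0 ≤ K / N := by positivity
  have gen : ∀ ρ f : ℕ, ρ ≤ s → 2 * f + 1 ≤ s * ρ → (K / N) ^ ρ * p⁻¹ ^ f * L ≤ κ ^ (s.choose 2) * y ^ (s.choose 2) := by
    intro ρ f h1 h2
    refine le_trans ?_ hii
    apply mul_le_mul_of_nonneg_right _ (by linarith)
    refine le_trans ?_ (num_aux hs hN hK h1 h2)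
    gcongr
  have hκy : κ ^ (s.choose 2) * y ^ (s.choose 2) ≤ κ ^ (s.choose 2) := by
    have : y ^ (s.choose 2) ≤ 1 := pow_le_one₀ hy.le hy1
    have h2 : 0 < κ ^ (s.choose 2) := by positivity
    nlinarith
  have small : ∀ ρ f : ℕ, 1 ≤ f → f ≤ (ρ + 1).choose 2 → ρ + 2 ≤ s → 2 * f + 1 ≤ s * ρ := by
    intro ρ f h1 h2 h3
    have h4 := two_choose ρ
    have h5 : 1 ≤ ρ := by
      rcases Nat.eq_zero_or_pos ρ with rfl | h
      · simp at h2; omega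
      · exact h
    nlinarith
  refine ⟨?_, ?_⟩
  · intro ρ f0 f1 hρ hf1 hf hle
    have h1 : p⁻¹ ^ f0 * (p / L)⁻¹ ^ f1 ≤ p⁻¹ ^ (f0 + f1) * L := by
      rw [inv_div, div_eq_mul_inv, mul_pow, pow_add]
      have : L ^ f1 ≤ L := by
        rcases Nat.le_one_iff_eq_zero_or_eq_one.1 hf1 with rfl | rfl
        · simpa using hL
        · simp
      have h3 : 0 ≤ p⁻¹ ^ f0 * p⁻¹ ^ f1 := by positivity
      nlinarith
    rcases Nat.lt_or_ge (ρ + 1) s with h2 | h2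
    · refine le_trans ?_ ((gen ρ (f0 + f1) (by omega) (small _ _ hf hle (by omega))).trans hκy)
      rw [mul_assoc]
      gcongr
    · have hρs : ρ = s - 1 := by omega
      have hle' : f0 + f1 ≤ s.choose 2 := by rw [show s = ρ + 1 by omega]; exact hle
      have h3 : p⁻¹ ^ (f0 + f1) ≤ p⁻¹ ^ (s.choose 2) := pow_le_pow_right₀ hpinv1 hle'
      have h4 : p ^ (s.choose 2) = a ^ (s.choose 2) * (N ^ (s - 1))⁻¹ * l := by
        rw [hp, mul_pow, mul_pow]
        congr 1
        · congr 1
          rw [← Real.rpow_natCast (N ^ _), ← Real.rpow_mul hN0.le, ← Real.rpow_natCast N, ← Real.rpow_neg hN0.le]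
          congr 1
          have : (2 : ℝ) * (s.choose 2 : ℕ) = s * ((s - 1 : ℕ) : ℝ) := by exact_mod_cast hc2
          field_simp
          linarith
        · rw [← Real.rpow_natCast, ← Real.rpow_mul (by linarith)]
          rw [one_div, inv_mul_cancel₀ hcpos.ne', Real.rpow_one]
      calc (K / N) ^ ρ * (p⁻¹ ^ f0 * (p / L)⁻¹ ^ f1) ≤ (K / N) ^ ρ * (p⁻¹ ^ (s.choose 2) * L) := by
            apply mul_le_mul_of_nonneg_left _ (by positivity)
            exact h1.trans (mul_le_mul_of_nonneg_right h3 (by linarith))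
        _ = (K ^ (s - 1) * L) / (a ^ (s.choose 2) * l) := by
            rw [inv_pow, h4, hρs, div_pow]
            have : N ^ (s - 1) ≠ 0 := by positivity
            field_simp
        _ ≤ κ ^ (s.choose 2) := by
            rw [div_le_iff₀ (by positivity)]
            refine hi.trans (le_of_eq ?_)
            rw [mul_pow]; ring
  · intro ρ f0 hρ hf hle hlt
    have : (K / N) ^ ρ * p⁻¹ ^ f0 ≤ (K / N) ^ ρ * p⁻¹ ^ f0 * L :=
      le_mul_of_one_le_right (by positivity) hL
    refine this.trans (gen ρ f0 (by omega) ?_)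
    rcases Nat.lt_or_ge (ρ + 1) s with h2 | h2
    · exact small _ _ hf hle (by omega)
    · have hρs : ρ = s - 1 := by omega
      rw [hρs, ← hc2]; omega
end PartC2
end KF

namespace KF
set_option linter.unusedSectionVars false
set_option linter.unusedSimpArgs false
set_option linter.unusedVariables false
section PartC3

lemma claimC_mono {X Ω : Type*} [Fintype X] [DecidableEq X] [Fintype Ω] {μ : Ω → ℝ} {S : Ω → Finset X}
    {k : ℕ} {δ δ' : ℝ} {π π' : X → ℝ} (h0 : ∀ x, 0 ≤ π x) (h1 : ∀ x, π x ≤ π' x) (h2 : ∀ x, π' x ≤ 1)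
    (hδ : δ ≤ δ') (h : ClaimC μ S k δ π) : ClaimC μ S k δ' π' := by
  intro A R hRS hRk
  refine (Ex_anti h0 h1 h2 ?_).trans ((h A R hRS hRk).trans (by linarith))
  intro W W' hW
  apply ind_mono
  rintro h ⟨ω, h3, h4⟩
  exact h ⟨ω, h3, h4.trans hW⟩

lemma claimC_congr {X Ω : Type*} [Fintype X] [DecidableEq X] [Fintype Ω] {μ : Ω → ℝ} {S : Ω → Finset X}
    {k : ℕ} {δ δ' : ℝ} {π π' : X → ℝ} (h : ClaimC μ S k δ π)
    (hδ : δ = δ') (h1 : ∀ x, π x = π' x) : ClaimC μ S k δ' π' := by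
  rw [← hδ, ← funext h1]; exact h

variable {V Λ Ω : Type*} [Fintype V] [Fintype Λ] [Fintype Ω]

lemma epoch_num (μ : Ω → ℝ) (hμ : ∀ ω, 0 ≤ μ ω) (blk : Ω → V → Λ) (b p κ y : ℝ) (s : ℕ) (hs : 1 ≤ s)
    (hb : 0 ≤ b) (hp : 0 < p) (L : ℕ) (hL1 : 1 ≤ L)
    (hκ : 0 < κ) (hκ1 : κ * 2 ^ (4 * s.choose 2) ≤ 1) (hy : 0 ≤ y) (hy1 : y ≤ 1)
    (hfib : ∀ ω l, #(univ.filter fun x => blk ω x = l) ≤ s)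
    (hVS : VS μ blk b) (hN : NumC s b p (p / L) κ y) (k k' : ℕ) (hk : k < 2 ^ L) (P δ δ₁ : ℝ)
    (hP : 0 ≤ P) (hP1 : P + p ≤ 1)
    (hδ : L * ((κ * 2 ^ (4 * s.choose 2)) ^ (k' + 1) * (1 + y) ^ k) ≤ δ₁)
    (hC : ClaimC μ (fun ω => SS (blk ω)) k' δ (fun _ => P)) :
    ClaimC μ (fun ω => SS (blk ω)) k (δ + δ₁) (fun _ => P + p) := by
  have hLr : (1:ℝ) ≤ L := by exact_mod_cast hL1
  have hq : 0 < p / L := by positivity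
  have hp1 : p ≤ 1 := by linarith
  have hq1 : p / L ≤ 1 := (div_le_one (by linarith)).2 (by linarith)
  have h2 : (1:ℝ) ≤ 2 ^ (4 * s.choose 2) := one_le_pow₀ (by norm_num)
  have hκ1' : κ ≤ 1 := by nlinarith
  have hH := hypS_of_VS μ hμ blk b p (p / L) κ y s hs hb hp hq hκ.le hκ1' hy hy1 hfib hVS hN
  have hπ0 : ∀ x : EE V ⊕ EE V, 0 < (Sum.elim (fun _ => p) (fun _ => p / L) x : ℝ) := by
    rintro (x | x)
    · exact hp
    · exact hq
  have hπ1 : ∀ x : EE V ⊕ EE V, (Sum.elim (fun _ => p) (fun _ => p / L) x : ℝ) ≤ 1 := by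
    rintro (x | x)
    · exact hp1
    · exact hq1
  have hst := claimC_step (LZ V) _ hπ0 hπ1 μ hμ _ κ y (s.choose 2) hκ hκ1 hy hH k k' L hk δ
    (fun _ => P) (fun _ => hP) (fun _ => by linarith) hC
  have hn := piE_nonneg (LZ V) _ hπ0 hπ1 L
  have hle : ∀ x, piE (LZ V) (Sum.elim (fun _ => p) (fun _ => p / L)) L x ≤ p := by
    rintro (x | x)
    · simp [piE, LZ]
    · simp only [piE, LZ, Finset.mem_filter, Finset.mem_univ, true_and, Sum.isLeft_inr, Sum.elim_inr]
      rw [if_neg (by simp)]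
      have := one_add_mul_le_pow (a := -(p / L)) (by linarith) L
      have e : (L:ℝ) * -(p / L) = - p := by field_simp
      rw [e] at this
      rw [sub_eq_add_neg 1 (p / L)]
      linarith
  refine claimC_mono ?_ ?_ ?_ ?_ hst
  · intro x
    have := hn x
    have := hle x
    nlinarith
  · intro x
    have := hn x
    have := hle x
    nlinarith
  · intro _; exact hP1
  · linarith

lemma one_add_pow_le {y : ℝ} (hy : 0 ≤ y) (k : ℕ) : (1 + y) ^ k ≤ Real.exp (y * k) := by
  rw [mul_comm, Real.exp_nat_mul]
  have := Real.add_one_le_exp y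
  apply pow_le_pow_left₀ (by linarith)
  linarith

set_option maxHeartbeats 4000000 in
/-- deterministic version -/
lemma CF_det (s : ℕ) (hs : 2 ≤ s) (K κ a η A δ N l p : ℝ) (n : ℕ) (hK : 1 ≤ K)
    (hκd : κ = Real.exp (-3) / 2 ^ (4 * s.choose 2)) (had : a = 5 * K ^ (s - 1) / κ)
    (hηd : η = 1 / (2 * s * (s.choose 2 : ℕ))) (hδ : 0 < δ)
    (hN : N = n) (hn1 : 1 ≤ n) (hl : l = Real.log N)
    (hA1 : 5 * K ^ s / κ ^ (s.choose 2) ≤ A) (hA2 : 2 * (4 * s * (s.choose 2 : ℕ) + 1) * a ≤ A)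
    (hA3 : 2 ≤ A) (hA4 : K ^ s ≤ A) (hA5 : 2 * K ^ (s - 1) ≤ A) (hA6 : 2 ^ (4 * s.choose 2) ≤ A)
    (hA7 : 2 * 2 ^ (4 * s.choose 2) * Real.exp 1 * 2 / δ ≤ A)
    (H1 : A * l ^ 2 ≤ N ^ η) (H2 : A * (Real.log l) ^ 2 ≤ l ^ ((1:ℝ) / (2 * (s.choose 2 : ℕ))))
    (H3 : 1 ≤ Real.log l) (H4 : 10 * (4 * s * (s.choose 2 : ℕ)) / δ ≤ l) (hl1 : 1 ≤ l)
    (hp : p = a * N ^ (-(2:ℝ) / s) * l ^ ((1:ℝ) / (s.choose 2 : ℕ)))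
    (μ : Ω → ℝ) (hμ : ∀ ω, 0 ≤ μ ω) (hμ1 : ∑ ω, μ ω = 1) (blk : Ω → V → Λ)
    (hfib : ∀ ω l, #(univ.filter fun x => blk ω x = l) ≤ s)
    (hVS : VS μ blk (K / N)) :
    0 < p ∧ 2 * (4 * s * (s.choose 2 : ℕ) + 1) * p ≤ 1 ∧
    ClaimC μ (fun ω => SS (blk ω)) (n ^ 2) δ (fun _ => (4 * s * (s.choose 2 : ℕ) + 1) * p) := by
  obtain ⟨c, hc⟩ : ∃ c, c = s.choose 2 := ⟨_, rfl⟩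
  rw [← hc] at hκd hηd hA1 hA2 hA6 hA7 H2 H4 hp ⊢
  have hc1 : 1 ≤ c := by rw [hc]; exact Nat.choose_pos hs
  have hcr : (1:ℝ) ≤ c := by exact_mod_cast hc1
  have hsr : (2:ℝ) ≤ s := by exact_mod_cast hs
  have hN1 : 1 ≤ N := by rw [hN]; exact_mod_cast hn1
  have hN0 : 0 < N := by linarith
  have hκ0 : 0 < κ := by rw [hκd]; positivity
  have h2c : (1:ℝ) ≤ 2 ^ (4 * c) := one_le_pow₀ (by norm_num)
  have he3 : Real.exp (-3) ≤ 1 := Real.exp_le_one_iff.2 (by norm_num)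
  have hκe : κ * 2 ^ (4 * c) = Real.exp (-3) := by rw [hκd]; field_simp
  have hκ1 : κ ≤ 1 := by nlinarith only [hκe, he3, h2c, hκ0]
  have hK1 : (1:ℝ) ≤ K ^ (s - 1) := one_le_pow₀ hK
  have hKs : (1:ℝ) ≤ K ^ s := one_le_pow₀ hK
  have haκ : a * κ = 5 * K ^ (s - 1) := by rw [had]; field_simp
  have ha1 : 1 ≤ a := by
    have : 5 * K ^ (s - 1) ≤ a := by
      rw [had, le_div_iff₀ hκ0]; nlinarith only [hκ1, hK1]
    linarith
  have hη0 : 0 < η := by rw [hηd]; positivity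
  have hηc : η * c = 1 / (2 * s) := by rw [hηd]; field_simp
  have hηs : η ≤ 1 / (2 * s) := by rw [← hηc]; nlinarith only [hη0, hcr]
  have hll : l ≤ l ^ 2 := by nlinarith only [hl1]
  have hlog : Real.log l ≤ l := (Real.log_le_sub_one_of_pos (by linarith)).trans (by linarith)
  obtain ⟨E0, hE0⟩ : ∃ E0 : ℕ, E0 = 4 * s * c := ⟨_, rfl⟩
  have hE0r : (E0 : ℝ) = 4 * s * c := by rw [hE0]; push_cast; ring
  have hp0 : 0 < p := by rw [hp]; positivity
  -- p small
  have hNη2 : N ^ η ≤ N ^ ((2:ℝ) / s) := by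
    apply Real.rpow_le_rpow_of_exponent_le hN1
    refine hηs.trans ?_
    rw [div_le_div_iff₀ (by positivity) (by positivity)]
    linarith only [hsr]
  have hpsmall : 2 * (E0 + 1) * p ≤ 1 := by
    have h1 : l ^ ((1:ℝ) / (c : ℕ)) ≤ l := by
      conv_rhs => rw [← Real.rpow_one l]
      apply Real.rpow_le_rpow_of_exponent_le hl1
      rw [div_le_one (by linarith)]; exact hcr
    have h3 : 2 * (E0 + 1) * a * l ≤ N ^ ((2:ℝ) / s) := by
      refine le_trans ?_ (H1.trans hNη2)
      rw [hE0r]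
      apply mul_le_mul hA2 hll (by linarith) (by linarith)
    have h4 : N ^ (-(2:ℝ) / s) * N ^ ((2:ℝ) / s) = 1 := by
      rw [← Real.rpow_add hN0, neg_div, neg_add_cancel, Real.rpow_zero]
    have h5 : 0 < N ^ (-(2:ℝ) / s) := by positivity
    calc 2 * (E0 + 1) * p = (2 * (E0 + 1) * a * l ^ ((1:ℝ) / (c : ℕ))) * N ^ (-(2:ℝ) / s) := by rw [hp]; ring
      _ ≤ (2 * (E0 + 1) * a * l) * N ^ (-(2:ℝ) / s) := by gcongr
      _ ≤ N ^ ((2:ℝ) / s) * N ^ (-(2:ℝ) / s) := by gcongr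
      _ = 1 := by rw [mul_comm, h4]
  have hp1 : p ≤ 1 := by
    have : (0:ℝ) ≤ E0 := Nat.cast_nonneg _
    nlinarith only [this, hpsmall, hp0]
  refine ⟨hp0, by rw [← hE0r]; exact hpsmall, ?_⟩
  -- y
  obtain ⟨y, hy⟩ : ∃ y : ℝ, y = N ^ (-η) := ⟨_, rfl⟩
  have hy0 : 0 < y := by rw [hy]; positivity
  have hy1 : y ≤ 1 := by rw [hy]; exact Real.rpow_le_one_of_one_le_of_nonpos hN1 (by linarith)
  have hyc : y ^ c = N ^ (-(1:ℝ) / (2 * s)) := by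
    rw [hy, ← Real.rpow_natCast, ← Real.rpow_mul hN0.le]
    congr 1
    rw [neg_mul, hηc]; ring
  have hyN : y * N ^ η = 1 := by rw [hy, ← Real.rpow_add hN0]; simp
  have hsplit : N ^ (-(1:ℝ) / s) = N ^ (-(1:ℝ) / (2 * s)) * N ^ (-(1:ℝ) / (2 * s)) := by
    rw [← Real.rpow_add hN0]; congr 1; field_simp; ring
  have hhalf : N ^ (-(1:ℝ) / (2 * s)) * N ^ η ≤ 1 := by
    rw [← Real.rpow_add hN0]
    apply Real.rpow_le_one_of_one_le_of_nonpos hN1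
    have : -(1:ℝ) / (2 * s) = - (1 / (2 * s)) := by ring
    linarith
  -- generic form of (ii)
  have hii : ∀ z : ℝ, K ^ s * z ≤ N ^ η → 0 ≤ z → K ^ s * N ^ (-(1:ℝ) / s) * z ≤ y ^ c := by
    intro z hz hz0
    rw [hyc, hsplit]
    have h1 : 0 < N ^ (-(1:ℝ) / (2 * s)) := by positivity
    calc K ^ s * (N ^ (-(1:ℝ) / (2 * s)) * N ^ (-(1:ℝ) / (2 * s))) * z
        = N ^ (-(1:ℝ) / (2 * s)) * (N ^ (-(1:ℝ) / (2 * s)) * (K ^ s * z)) := by ring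
      _ ≤ N ^ (-(1:ℝ) / (2 * s)) * (N ^ (-(1:ℝ) / (2 * s)) * N ^ η) := by gcongr
      _ ≤ N ^ (-(1:ℝ) / (2 * s)) * 1 := by gcongr
      _ = _ := by ring
  have hb : 0 ≤ K / N := by positivity
  -- final epoch
  obtain ⟨K1, hK1d⟩ : ∃ K1 : ℕ, K1 = ⌈Real.log l⌉₊ := ⟨_, rfl⟩
  have hK1ge : Real.log l ≤ K1 := by rw [hK1d]; exact Nat.le_ceil _
  have hK1le : (K1 : ℝ) ≤ 2 * Real.log l := by
    have := Nat.ceil_lt_add_one (a := Real.log l) (by linarith)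
    rw [← hK1d] at this
    linarith
  have hK11 : 1 ≤ K1 := by
    have : (1:ℝ) ≤ K1 := H3.trans hK1ge
    exact_mod_cast this
  have hloglog : Real.log l ≤ Real.log l ^ 2 := by nlinarith only [H3]
  have hK1N : (K1:ℝ) ≤ N ^ η := by
    refine le_trans ?_ H1
    nlinarith only [hK1le, hlog, hll, hA3, hl1]
  have base : ClaimC μ (fun ω => SS (blk ω)) K1 (0 + δ / 2) (fun _ => 0 + p) := by
    obtain ⟨κ', hκ'⟩ : ∃ y : ℝ, y = l ^ (-(1:ℝ) / (2 * c)) := ⟨_, rfl⟩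
    have hκ'0 : 0 < κ' := by rw [hκ']; positivity
    have hκ'1 : κ' ≤ 1 := by
      rw [hκ']
      exact Real.rpow_le_one_of_one_le_of_nonpos hl1 (by
      rw [neg_div]; have : 0 < 1 / (2 * (c:ℝ)) := by positivity
      linarith)
    have hκi : κ' * l ^ ((1:ℝ) / (2 * c)) = 1 := by
      rw [hκ', ← Real.rpow_add (by linarith), neg_div, neg_add_cancel, Real.rpow_zero]
    have hκc : κ' ^ c = l ^ (-(1:ℝ) / 2) := by
      rw [hκ', ← Real.rpow_natCast, ← Real.rpow_mul (by linarith)]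
      congr 1; field_simp
    have hl2 : l ^ ((1:ℝ) / (2 * c)) ≤ l ^ ((1:ℝ) / 2) := by
      apply Real.rpow_le_rpow_of_exponent_le hl1
      apply div_le_div_of_nonneg_left <;> linarith
    have hlhalf : l ^ (-(1:ℝ) / 2) * l ^ ((1:ℝ) / 2) = 1 := by
      rw [← Real.rpow_add (by linarith), neg_div, neg_add_cancel, Real.rpow_zero]
    have hlhalf' : l ^ (-(1:ℝ) / 2) * l = l ^ ((1:ℝ) / 2) := by
      conv_lhs => rw [show l ^ (-(1:ℝ) / 2) * l = l ^ (-(1:ℝ) / 2) * l ^ (1:ℝ) by rw [Real.rpow_one]]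
      rw [← Real.rpow_add (by linarith)]; norm_num
    have hκ2 : κ' * 2 ^ (4 * c) ≤ 1 := by
      rw [← hκi]
      apply mul_le_mul_of_nonneg_left _ hκ'0.le
      refine le_trans ?_ H2
      have : (1:ℝ) ≤ Real.log l ^ 2 := by nlinarith only [H3]
      nlinarith only [this, hA6, h2c]
    have hnum : NumC s (K / N) p (p / (K1:ℕ)) κ' y := by
      refine numC_of hs hN1 hK ha1 hl1 (by exact_mod_cast hK11) hκ'0 hκ'1 hy0 hy1 (hc ▸ hp) hp1 ?_ ?_
      · rw [← hc, mul_pow, hκc, mul_assoc, hlhalf']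
        have h1 : (1:ℝ) ≤ a ^ c := one_le_pow₀ ha1
        have h2 : K ^ (s - 1) * K1 ≤ l ^ ((1:ℝ) / 2) := by
          refine le_trans ?_ (H2.trans hl2)
          calc K ^ (s - 1) * (K1:ℝ) ≤ K ^ (s - 1) * (2 * Real.log l) := by gcongr
            _ = (2 * K ^ (s - 1)) * Real.log l := by ring
            _ ≤ A * Real.log l ^ 2 := by gcongr
        have h3 : 0 < l ^ ((1:ℝ) / 2) := by positivity
        nlinarith only [h1, h2, h3]
      · rw [← hc]
        have h4 : 1 ≤ κ' ^ c * l := by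
          rw [hκc, hlhalf']; exact Real.one_le_rpow hl1 (by norm_num)
        have h5 := hii (K1 * l) (by
          refine le_trans ?_ H1
          have : (K1:ℝ) * l ≤ 2 * l ^ 2 := by nlinarith only [hK1le, hlog, hl1]
          have h7 : K ^ s * 2 ≤ A := by
            refine le_trans ?_ hA1
            rw [le_div_iff₀ (by positivity)]
            have q1 : κ ^ c ≤ 1 := pow_le_one₀ hκ0.le hκ1
            have q2 : 0 < κ ^ c := by positivity
            nlinarith only [q1, q2, hKs]
          calc K ^ s * (K1 * l) ≤ K ^ s * (2 * l ^ 2) := by gcongr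
            _ = (K ^ s * 2) * l ^ 2 := by ring
            _ ≤ _ := by gcongr) (by positivity)
        have h8 : 0 < κ' ^ c := by positivity
        calc K ^ s * N ^ (-(1:ℝ) / s) * K1 ≤ K ^ s * N ^ (-(1:ℝ) / s) * K1 * (κ' ^ c * l) :=
              le_mul_of_one_le_right (by positivity) h4
          _ = κ' ^ c * (K ^ s * N ^ (-(1:ℝ) / s) * (K1 * l)) := by ring
          _ ≤ κ' ^ c * y ^ c := by gcongr
    refine epoch_num μ hμ blk (K / N) p κ' y s (by omega) hb hp0 K1 hK11 hκ'0 (hc ▸ hκ2) hy0.le hy1 hfib hVS hnum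
      K1 0 Nat.lt_two_pow_self 0 0 (δ / 2) le_rfl (by linarith) ?_ ?_
    · rw [← hc, zero_add, pow_one]
      have h1 : (1 + y) ^ K1 ≤ Real.exp 1 := by
        refine (one_add_pow_le hy0.le K1).trans (Real.exp_le_exp.2 ?_)
        rw [← hyN]; gcongr
      have h2 : Real.log l * (2 * 2 ^ (4 * c) * Real.exp 1 * 2 / δ) ≤ l ^ ((1:ℝ) / (2 * c)) := by
        refine le_trans ?_ H2
        rw [mul_comm]
        gcongr
      calc (K1:ℝ) * (κ' * 2 ^ (4 * c) * (1 + y) ^ K1) ≤ (2 * Real.log l) * (κ' * 2 ^ (4 * c) * Real.exp 1) := by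
            gcongr
        _ = κ' * (Real.log l * (2 * 2 ^ (4 * c) * Real.exp 1 * 2 / δ)) * (δ / 2) := by field_simp
        _ ≤ κ' * l ^ ((1:ℝ) / (2 * c)) * (δ / 2) := by gcongr
        _ = δ / 2 := by rw [hκi, one_mul]
    · exact claimC_zero μ hμ hμ1 _
  -- ordinary epochs
  obtain ⟨L, hL⟩ : ∃ L : ℕ, L = ⌈4 * l⌉₊ := ⟨_, rfl⟩
  have hLge : 4 * l ≤ L := by rw [hL]; exact Nat.le_ceil _
  have hLle : (L:ℝ) ≤ 5 * l := by
    have := Nat.ceil_lt_add_one (a := 4 * l) (by linarith)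
    rw [← hL] at this
    linarith
  have hL1 : 1 ≤ L := by
    have : (1:ℝ) ≤ L := by linarith
    exact_mod_cast this
  have hL2 : ((n ^ 2 : ℕ) : ℝ) < 2 ^ L := by
    have h1 : Real.exp (2 * l) = N ^ 2 := by
      rw [two_mul, Real.exp_add, hl, Real.exp_log hN0]; ring
    have h2 : (2:ℝ) ^ L = Real.exp (L * Real.log 2) := by
      rw [Real.exp_nat_mul, Real.exp_log (by norm_num)]
    have h3 := Real.log_two_gt_d9
    push_cast
    rw [← hN, ← h1, h2]
    apply Real.exp_lt_exp.2
    nlinarith only [h3, hLge, hl1]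
  have hnum : NumC s (K / N) p (p / (L:ℕ)) κ y := by
    refine numC_of hs hN1 hK ha1 hl1 (by exact_mod_cast hL1) hκ0 hκ1 hy0 hy1 (hc ▸ hp) hp1 ?_ ?_
    · rw [← hc, haκ]
      have h1 : 5 * K ^ (s - 1) ≤ (5 * K ^ (s - 1)) ^ c := le_self_pow₀ (by linarith) (by omega)
      calc K ^ (s - 1) * L ≤ K ^ (s - 1) * (5 * l) := by gcongr
        _ = (5 * K ^ (s - 1)) * l := by ring
        _ ≤ _ := by gcongr
    · rw [← hc]
      have h5 := hii (L / κ ^ c) (by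
        refine le_trans ?_ H1
        calc K ^ s * (L / κ ^ c) ≤ K ^ s * ((5 * l) / κ ^ c) := by gcongr
          _ = (5 * K ^ s / κ ^ c) * l := by ring
          _ ≤ A * l ^ 2 := by gcongr) (by positivity)
      have h8 : 0 < κ ^ c := by positivity
      calc K ^ s * N ^ (-(1:ℝ) / s) * L = κ ^ c * (K ^ s * N ^ (-(1:ℝ) / s) * (L / κ ^ c)) := by
            field_simp
        _ ≤ κ ^ c * y ^ c := by gcongr
  have step : ∀ (k k' i : ℕ) (δ' : ℝ), i + 1 ≤ E0 → k ≤ n ^ 2 → y * k ≤ k' + 1 → Real.log l ≤ k' + 1 →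
      ClaimC μ (fun ω => SS (blk ω)) k' δ' (fun _ => (i + 1) * p) →
      ClaimC μ (fun ω => SS (blk ω)) k (δ' + 5 / l) (fun _ => (i + 1) * p + p) := by
    intro k k' i δ' hi hk h1 h2 hC
    refine epoch_num μ hμ blk (K / N) p κ y s (by omega) hb hp0 L hL1 hκ0 (by rw [← hc, hκe]; exact he3) hy0.le hy1 hfib hVS hnum
      k k' ?_ ((i + 1) * p) δ' (5 / l) (by positivity) ?_ ?_ hC
    · have : (k:ℝ) < 2 ^ L := lt_of_le_of_lt (by exact_mod_cast hk) hL2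
      exact_mod_cast this
    · have : ((i:ℝ) + 1) ≤ E0 := by exact_mod_cast hi
      nlinarith only [this, hpsmall, hp0]
    · rw [← hc, hκe]
      have h3 : Real.exp (-3) ^ (k' + 1) * (1 + y) ^ k ≤ Real.exp (-2 * Real.log l) := by
        calc Real.exp (-3) ^ (k' + 1) * (1 + y) ^ k ≤ Real.exp ((k' + 1 : ℕ) * (-3)) * Real.exp (y * k) := by
              rw [Real.exp_nat_mul]
              gcongr
              exact one_add_pow_le hy0.le k
          _ = Real.exp ((k' + 1 : ℕ) * (-3) + y * k) := by rw [Real.exp_add]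
          _ ≤ _ := by
              apply Real.exp_le_exp.2
              push_cast
              linarith
      have h4 : Real.exp (-2 * Real.log l) = (l ^ 2)⁻¹ := by
        rw [show -2 * Real.log l = - (Real.log l + Real.log l) by ring, Real.exp_neg, Real.exp_add,
          Real.exp_log (by linarith)]
        ring
      calc (L:ℝ) * (Real.exp (-3) ^ (k' + 1) * (1 + y) ^ k) ≤ (5 * l) * (l ^ 2)⁻¹ := by
            rw [← h4]; gcongr
        _ = 5 / l := by field_simp
  -- chain
  have chain : ∀ i : ℕ, i + 1 ≤ E0 → ClaimC μ (fun ω => SS (blk ω)) ⌊N ^ ((i + 1) * η)⌋₊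
      (δ / 2 + (i + 1) * (5 / l)) (fun _ => (i + 1 + 1) * p) := by
    have hexp : ∀ i : ℕ, i + 1 ≤ E0 → ⌊N ^ (((i:ℝ) + 1) * η)⌋₊ ≤ n ^ 2 := by
      intro i hi
      have : (⌊N ^ (((i:ℝ) + 1) * η)⌋₊ : ℝ) ≤ ((n ^ 2 : ℕ) : ℝ) := by
        refine (Nat.floor_le (by positivity)).trans ?_
        push_cast
        rw [← hN, ← Real.rpow_natCast N 2]
        apply Real.rpow_le_rpow_of_exponent_le hN1
        have h1 : ((i:ℝ) + 1) ≤ E0 := by exact_mod_cast hi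
        have h2 : (E0:ℝ) * η = 2 := by rw [hE0r, hηd]; field_simp; ring
        push_cast
        nlinarith only [h1, h2, hη0]
      exact_mod_cast this
    intro i
    induction i with
    | zero =>
      intro hi
      have := step ⌊N ^ (((0:ℕ) + 1 : ℝ) * η)⌋₊ K1 0 (0 + δ / 2) hi (hexp 0 hi) (by
        have : (⌊N ^ (((0:ℕ) + 1 : ℝ) * η)⌋₊ : ℝ) ≤ N ^ η := by
          refine (Nat.floor_le (by positivity)).trans (le_of_eq ?_)
          congr 1; push_cast; ring
        calc y * _ ≤ y * N ^ η := by gcongr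
          _ = 1 := hyN
          _ ≤ _ := by linarith [Nat.cast_nonneg (α := ℝ) K1]) (by linarith) (by
          exact claimC_congr base rfl (fun _ => by push_cast; ring))
      exact claimC_congr this (by push_cast; ring) (fun _ => by push_cast; ring)
    | succ i ih =>
      intro hi
      have hf1 := Nat.lt_floor_add_one (N ^ (((i:ℝ) + 1) * η))
      have := step ⌊N ^ ((((i + 1 : ℕ) : ℝ) + 1) * η)⌋₊ ⌊N ^ (((i:ℝ) + 1) * η)⌋₊ (i + 1) _ hi (hexp (i + 1) hi) (by
        have h1 : (⌊N ^ ((((i + 1 : ℕ) : ℝ) + 1) * η)⌋₊ : ℝ) ≤ N ^ ((((i + 1 : ℕ) : ℝ) + 1) * η) :=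
          Nat.floor_le (by positivity)
        have h2 : y * N ^ ((((i + 1 : ℕ) : ℝ) + 1) * η) = N ^ (((i:ℝ) + 1) * η) := by
          rw [hy, ← Real.rpow_add hN0]
          congr 1; push_cast; ring
        have h3 : y * (⌊N ^ ((((i + 1 : ℕ) : ℝ) + 1) * η)⌋₊ : ℝ) ≤ y * N ^ ((((i + 1 : ℕ) : ℝ) + 1) * η) := by gcongr
        linarith) (by
        have h1 : N ^ η ≤ N ^ (((i:ℝ) + 1) * η) := by
          apply Real.rpow_le_rpow_of_exponent_le hN1
          have : (0:ℝ) ≤ i := Nat.cast_nonneg _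
          nlinarith only [this, hη0]
        linarith) (by
          exact claimC_congr (ih (by omega)) rfl (fun _ => by push_cast; ring))
      exact claimC_congr this (by push_cast; ring) (fun _ => by push_cast; ring)
  have hfin := chain (E0 - 1) (by have : 1 ≤ E0 := by rw [hE0]; exact Nat.mul_pos (by omega) hc1
                                  omega)
  have hE01 : 1 ≤ E0 := by rw [hE0]; exact Nat.mul_pos (by omega) hc1
  have e1 : ((E0 - 1 : ℕ) : ℝ) + 1 = E0 := by
    rw [Nat.cast_sub hE01]; simp
  rw [e1] at hfin
  have e2 : ⌊N ^ ((E0:ℝ) * η)⌋₊ = n ^ 2 := by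
    have h2 : (E0:ℝ) * η = 2 := by rw [hE0r, hηd]; field_simp; ring
    rw [h2, hN]
    rw [show ((n:ℝ) ^ (2:ℝ)) = ((n ^ 2 : ℕ) : ℝ) by push_cast; exact Real.rpow_two _, Nat.floor_natCast]
  rw [e2] at hfin
  rw [← hE0r]
  refine claimC_mono (fun _ => by positivity) (fun _ => le_rfl) (fun _ => ?_) ?_ hfin
  · have : (0:ℝ) ≤ E0 := Nat.cast_nonneg _
    nlinarith only [this, hpsmall, hp0]
  · have : (E0:ℝ) * (5 / l) ≤ δ / 2 := by
      rw [← hE0r, div_le_iff₀ hδ] at H4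
      rw [← mul_div_assoc, div_le_iff₀ (by linarith)]
      linarith only [H4]
    linarith
end PartC3
end KF

namespace KF
set_option linter.unusedSectionVars false
set_option linter.unusedSimpArgs false
set_option linter.unusedVariables false
section PartC4

lemma ev_log (A τ : ℝ) (hτ : 0 < τ) : ∀ᶠ x : ℝ in Filter.atTop, A * (Real.log x) ^ 2 ≤ x ^ τ := by
  have h := isLittleO_log_rpow_rpow_atTop 2 hτ
  have h2 := h.bound (c := 1 / (|A| + 1)) (by positivity)
  filter_upwards [h2, Filter.eventually_ge_atTop (1:ℝ)] with x hx hx1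
  have h3 : 0 ≤ Real.log x := Real.log_nonneg hx1
  rw [Real.rpow_two, Real.norm_of_nonneg (by positivity), Real.norm_of_nonneg (by positivity)] at hx
  have h4 : (|A| + 1) * (Real.log x) ^ 2 ≤ x ^ τ := by
    calc (|A| + 1) * (Real.log x) ^ 2 ≤ (|A| + 1) * (1 / (|A| + 1) * x ^ τ) := by gcongr
      _ = x ^ τ := by field_simp
  have : A ≤ |A| + 1 := by linarith [le_abs_self A]
  exact (mul_le_mul_of_nonneg_right this (by positivity)).trans h4

theorem CF (s : ℕ) (hs : 2 ≤ s) (K : ℝ) (hK : 1 ≤ K) : ∃ C : ℝ, 0 < C ∧ ∀ δ : ℝ, 0 < δ → ∃ n0 : ℕ, ∀ n ≥ n0,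
    ∀ (V Λ Ω : Type) [Fintype V] [Fintype Λ] [Fintype Ω] (hV : Fintype.card V = n) (μ : Ω → ℝ) (hμ : ∀ ω, 0 ≤ μ ω) (hμ1 : ∑ ω, μ ω = 1)
      (blk : Ω → V → Λ) (hfib : ∀ ω l, #(univ.filter fun x => blk ω x = l) ≤ s)
      (hVS : VS μ blk (K / n)),
      0 ≤ C * (n:ℝ) ^ (-(2:ℝ) / s) * Real.log n ^ ((2:ℝ) / (s * ((s:ℝ) - 1))) ∧
      C * (n:ℝ) ^ (-(2:ℝ) / s) * Real.log n ^ ((2:ℝ) / (s * ((s:ℝ) - 1))) ≤ 1 ∧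
      Ex (fun _ : EE V => C * (n:ℝ) ^ (-(2:ℝ) / s) * Real.log n ^ ((2:ℝ) / (s * ((s:ℝ) - 1))))
        (fun W => ind (¬ ∃ ω, ∀ e, inb (blk ω) e → e ∈ W)) ≤ δ := by
  obtain ⟨κ, hκ⟩ : ∃ κ, κ = Real.exp (-3) / 2 ^ (4 * s.choose 2) := ⟨_, rfl⟩
  obtain ⟨a, ha⟩ : ∃ a, a = 5 * K ^ (s - 1) / κ := ⟨_, rfl⟩
  obtain ⟨η, hη⟩ : ∃ η : ℝ, η = 1 / (2 * s * (s.choose 2 : ℕ)) := ⟨_, rfl⟩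
  have hκ0 : 0 < κ := by rw [hκ]; positivity
  have ha0 : 0 < a := by rw [ha]; positivity
  have hc1 : 1 ≤ s.choose 2 := Nat.choose_pos hs
  have hcr : (1:ℝ) ≤ (s.choose 2 : ℕ) := by exact_mod_cast hc1
  have hη0 : 0 < η := by rw [hη]; positivity
  refine ⟨2 * (4 * s * (s.choose 2 : ℕ) + 1) * a, by positivity, ?_⟩
  intro δ hδ
  have n1 : 0 ≤ 5 * K ^ s / κ ^ (s.choose 2) := by positivity
  have n2 : 0 ≤ 2 * (4 * s * (s.choose 2 : ℕ) + 1) * a := by positivity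
  have n4 : 0 ≤ K ^ s := by positivity
  have n5 : 0 ≤ 2 * K ^ (s - 1) := by positivity
  have n6 : (0:ℝ) ≤ 2 ^ (4 * s.choose 2) := by positivity
  have n7 : 0 ≤ 2 * 2 ^ (4 * s.choose 2) * Real.exp 1 * 2 / δ := by positivity
  obtain ⟨A, hA⟩ : ∃ A : ℝ, A = 5 * K ^ s / κ ^ (s.choose 2) + 2 * (4 * s * (s.choose 2 : ℕ) + 1) * a + 2
    + K ^ s + 2 * K ^ (s - 1) + 2 ^ (4 * s.choose 2) + 2 * 2 ^ (4 * s.choose 2) * Real.exp 1 * 2 / δ := ⟨_, rfl⟩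
  have tl : Filter.Tendsto (fun n : ℕ => Real.log (n:ℝ)) Filter.atTop Filter.atTop :=
    Real.tendsto_log_atTop.comp tendsto_natCast_atTop_atTop
  have E1 := tendsto_natCast_atTop_atTop.eventually (ev_log A η hη0)
  have E2 := tl.eventually (ev_log A ((1:ℝ) / (2 * (s.choose 2 : ℕ))) (by positivity))
  have E3 := (Real.tendsto_log_atTop.comp tl).eventually (Filter.eventually_ge_atTop 1)
  have E4 := tl.eventually (Filter.eventually_ge_atTop (10 * (4 * s * (s.choose 2 : ℕ)) / δ))
  have E5 := tl.eventually (Filter.eventually_ge_atTop 1)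
  obtain ⟨n0, hn0⟩ := Filter.eventually_atTop.1 (((E1.and E2).and (E3.and E4)).and (E5.and (Filter.eventually_ge_atTop 1)))
  refine ⟨n0, ?_⟩
  intro n hn V Λ Ω _ _ _ hV μ hμ hμ1 blk hfib hVS
  obtain ⟨⟨⟨H1, H2⟩, H3, H4⟩, H5, H6⟩ := hn0 n hn
  obtain ⟨p, hp⟩ : ∃ p : ℝ, p = a * (n:ℝ) ^ (-(2:ℝ) / s) * (Real.log n) ^ ((1:ℝ) / (s.choose 2 : ℕ)) := ⟨_, rfl⟩
  obtain ⟨hp0, hp1, hC⟩ := CF_det s hs K κ a η A δ n (Real.log n) p n hK hκ ha hη hδ rfl H6 rfl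
    (by linarith) (by linarith) (by linarith) (by linarith) (by linarith) (by linarith) (by linarith)
    H1 H2 H3 H4 H5 hp μ hμ hμ1 blk hfib hVS
  have e2 : ((1:ℝ) / (s.choose 2 : ℕ)) = (2:ℝ) / (s * ((s:ℝ) - 1)) := by
    rw [Nat.cast_choose_two]
    have : (2:ℝ) ≤ s := by exact_mod_cast hs
    have h1 : (s:ℝ) - 1 ≠ 0 := by linarith
    field_simp
  have e3 : 2 * (4 * s * (s.choose 2 : ℕ) + 1) * a * (n:ℝ) ^ (-(2:ℝ) / s) * Real.log n ^ ((2:ℝ) / (s * ((s:ℝ) - 1)))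
     = 2 * (4 * s * (s.choose 2 : ℕ) + 1) * p := by
    rw [hp, e2]; ring
  rw [e3]
  obtain ⟨P, hP⟩ : ∃ P : ℝ, P = (4 * s * (s.choose 2 : ℕ) + 1) * p := ⟨_, rfl⟩
  have hP0 : 0 < P := by rw [hP]; positivity
  have e4 : 2 * (4 * s * (s.choose 2 : ℕ) + 1) * p = 2 * P := by rw [hP]; ring
  rw [e4] at hp1 ⊢
  rw [← hP] at hC
  refine ⟨by positivity, hp1, ?_⟩
  have h1 := hC univ (fun ω => SS (blk ω)) (fun _ _ => Finset.Subset.refl _) (by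
    intro ω _
    have h2 : #(SS (blk ω)) ≤ #(univ : Finset (EE V)) := by
      apply Finset.card_le_card_of_injOn und (fun _ _ => Finset.mem_coe.2 (Finset.mem_univ _))
      intro x hx y hy h
      exact SS_inj hx hy h
    refine h2.trans ?_
    rw [Finset.card_univ, Sym2.card_subtype_not_diag, hV]
    exact (Nat.choose_le_pow n 2))
  rw [hμ1] at h1
  have h2 : Ex (fun _ : EE V => 2 * P) (fun W => ind (¬ ∃ ω, ∀ e, inb (blk ω) e → e ∈ W)) ≤
      Ex (fun _ : EE V => P + P - P * P) (fun W => ind (¬ ∃ ω, ∀ e, inb (blk ω) e → e ∈ W)) := by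
    apply Ex_anti
    · intro _; nlinarith
    · intro _; nlinarith
    · intro _; exact hp1
    · intro W W' hW
      apply ind_mono
      rintro h ⟨ω, h3⟩
      exact h ⟨ω, fun e he => hW (h3 e he)⟩
  refine h2.trans ?_
  have h3 := Ex_sum (fun _ : EE V ⊕ EE V => P) (fun W => ind (¬ ∃ ω, ∀ e, inb (blk ω) e → e ∈ W))
  have h4 : Ex (fun _ : EE V => P + P - P * P) (fun W => ind (¬ ∃ ω, ∀ e, inb (blk ω) e → e ∈ W)) =
     Ex (fun _ : EE V ⊕ EE V => P) (fun W => ind (¬ ∃ ω, ∀ e, inb (blk ω) e → e ∈ W.toLeft ∪ W.toRight)) := by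
    rw [h3]
  rw [h4]
  refine le_trans ?_ (h1.trans (by linarith))
  apply Ex_mono
  · intro _; exact hP0.le
  · intro _; linarith
  · intro W
    apply ind_mono
    rintro h ⟨ω, _, h5⟩
    refine h ⟨ω, fun e he => ?_⟩
    by_cases hd : des (blk ω) e
    · have : (Sum.inr e : EE V ⊕ EE V) ∈ SS (blk ω) := by
        unfold SS
        rw [Finset.mem_filter]
        exact ⟨Finset.mem_univ _, he, by simp [und, hd]⟩
      have := h5 this
      simp [this]
    · have : (Sum.inl e : EE V ⊕ EE V) ∈ SS (blk ω) := by
        unfold SS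
        rw [Finset.mem_filter]
        exact ⟨Finset.mem_univ _, he, by simp [und, hd]⟩
      have := h5 this
      simp [this]
end PartC4
end KF

namespace KF
set_option linter.unusedSectionVars false
set_option linter.unusedSimpArgs false
set_option linter.unusedVariables false
section PartE1

variable {J Y : Type*} [Fintype J] [Fintype Y]

lemma avg_update (i : J) (H : (J → Y) → ℝ) :
    ∑ z : J → Y, ∑ u : Y, H (Function.update z i u) = Fintype.card Y * ∑ z : J → Y, H z := by
  have h1 : ∑ p : (J → Y) × Y, H (Function.update p.1 i p.2) = ∑ p : (J → Y) × Y, H p.1 := by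
    apply Fintype.sum_equiv (⟨fun p => (Function.update p.1 i p.2, p.1 i), fun p => (Function.update p.1 i p.2, p.1 i),
      fun p => by simp, fun p => by simp⟩ : ((J → Y) × Y) ≃ ((J → Y) × Y))
    intro p
    rfl
  rw [Fintype.sum_prod_type, Fintype.sum_prod_type] at h1
  rw [h1]
  simp [Finset.mul_sum]

/-- cut bound -/
lemma cut_bound (g : Y → Y → ℝ) (ε : ℝ) (hε : 0 ≤ ε)
    (hg : ∑ u, ∑ u', |∑ v, g u v * g u' v| ≤ ε * (Fintype.card Y : ℝ) ^ 3)
    (a b : Y → ℝ) (ha : ∀ u, 0 ≤ a u ∧ a u ≤ 1) (hb : ∀ u, 0 ≤ b u ∧ b u ≤ 1) :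
    |∑ u, ∑ v, a u * b v * g u v| ≤ √ε * (Fintype.card Y : ℝ) ^ 2 := by
  set N : ℝ := (Fintype.card Y : ℝ) with hN
  have hN0 : 0 ≤ N := Nat.cast_nonneg _
  have e1 : ∑ u, ∑ v, a u * b v * g u v = ∑ v, b v * ∑ u, a u * g u v := by
    rw [Finset.sum_comm]
    refine Finset.sum_congr rfl fun v _ => ?_
    rw [Finset.mul_sum]
    exact Finset.sum_congr rfl fun u _ => by ring
  have h1 : (∑ u, ∑ v, a u * b v * g u v) ^ 2 ≤ ε * N ^ 4 := by
    rw [e1]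
    have cs := Finset.sum_mul_sq_le_sq_mul_sq (univ : Finset Y) b (fun v => ∑ u, a u * g u v)
    have hb2 : ∑ v, b v ^ 2 ≤ N := by
      calc ∑ v, b v ^ 2 ≤ ∑ v : Y, (1:ℝ) := Finset.sum_le_sum fun v _ => by
            have := hb v; nlinarith
        _ = N := by simp [hN]
    have h3 : ∑ v, (∑ u, a u * g u v) ^ 2 ≤ ε * N ^ 3 := by
      refine le_trans ?_ hg
      have : ∑ v, (∑ u, a u * g u v) ^ 2 = ∑ u, ∑ u', a u * a u' * ∑ v, g u v * g u' v := by
        simp_rw [sq, Finset.sum_mul_sum]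
        rw [Finset.sum_comm]
        refine Finset.sum_congr rfl fun u _ => ?_
        rw [Finset.sum_comm]
        refine Finset.sum_congr rfl fun u' _ => ?_
        rw [Finset.mul_sum]
        exact Finset.sum_congr rfl fun v _ => by ring
      rw [this]
      refine Finset.sum_le_sum fun u _ => Finset.sum_le_sum fun u' _ => ?_
      refine (le_abs_self _).trans ?_
      rw [abs_mul]
      have h1 := ha u
      have h2 := ha u'
      have : |a u * a u'| ≤ 1 := by
        rw [abs_of_nonneg (mul_nonneg h1.1 h2.1)]
        exact mul_le_one₀ h1.2 h2.1 h2.2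
      exact mul_le_of_le_one_left (abs_nonneg _) this
    refine cs.trans ?_
    calc (∑ v, b v ^ 2) * ∑ v, (∑ u, a u * g u v) ^ 2 ≤ N * (ε * N ^ 3) :=
          mul_le_mul hb2 h3 (Finset.sum_nonneg fun _ _ => sq_nonneg _) hN0
      _ = ε * N ^ 4 := by ring
  rw [← Real.sqrt_sq_eq_abs]
  have : √ε * N ^ 2 = √(ε * N ^ 4) := by
    rw [Real.sqrt_mul hε, show N ^ 4 = (N ^ 2) ^ 2 by ring, Real.sqrt_sq (by positivity)]
  rw [this]
  exact Real.sqrt_le_sqrt h1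

/-- functions that split with respect to two coordinates -/
def Spl (i j : J) (Φ : (J → Y) → ℝ) : Prop :=
  ∃ a b : (J → Y) → ℝ, (∀ z, Φ z = a z * b z) ∧ (∀ z, 0 ≤ a z ∧ a z ≤ 1) ∧ (∀ z, 0 ≤ b z ∧ b z ≤ 1) ∧
    (∀ z v, a (Function.update z j v) = a z) ∧ (∀ z u, b (Function.update z i u) = b z)

lemma Spl.mul {i j : J} {Φ Ψ : (J → Y) → ℝ} (h1 : Spl i j Φ) (h2 : Spl i j Ψ) : Spl i j (fun z => Φ z * Ψ z) := by
  obtain ⟨a, b, h, ha, hb, hj, hi⟩ := h1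
  obtain ⟨a', b', h', ha', hb', hj', hi'⟩ := h2
  refine ⟨fun z => a z * a' z, fun z => b z * b' z, fun z => ?_, fun z => ?_, fun z => ?_, fun z v => ?_, fun z u => ?_⟩
  · show Φ z * Ψ z = (a z * a' z) * (b z * b' z)
    rw [h, h']; ring
  · exact ⟨mul_nonneg (ha z).1 (ha' z).1, mul_le_one₀ (ha z).2 (ha' z).1 (ha' z).2⟩
  · exact ⟨mul_nonneg (hb z).1 (hb' z).1, mul_le_one₀ (hb z).2 (hb' z).1 (hb' z).2⟩
  · simp only [hj, hj']
  · simp only [hi, hi']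

lemma Spl.prod {i j : J} {κ : Type*} (s : Finset κ) (Φ : κ → (J → Y) → ℝ) (h : ∀ k ∈ s, Spl i j (Φ k)) :
    Spl i j (fun z => ∏ k ∈ s, Φ k z) := by
  induction s using Finset.induction_on with
  | empty =>
    exact ⟨fun _ => 1, fun _ => 1, by simp, by simp, by simp, by simp, by simp⟩
  | insert a s ha ih =>
    simp only [Finset.prod_insert ha]
    exact (h a (Finset.mem_insert_self _ _)).mul (ih fun k hk => h k (Finset.mem_insert_of_mem hk))

lemma Spl.left {i j : J} {Φ : (J → Y) → ℝ} (h : ∀ z, 0 ≤ Φ z ∧ Φ z ≤ 1) (hj : ∀ z v, Φ (Function.update z j v) = Φ z) :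
    Spl i j Φ := ⟨Φ, fun _ => 1, by simp, h, by simp, hj, by simp⟩

lemma Spl.right {i j : J} {Φ : (J → Y) → ℝ} (h : ∀ z, 0 ≤ Φ z ∧ Φ z ≤ 1) (hi : ∀ z v, Φ (Function.update z i v) = Φ z) :
    Spl i j Φ := ⟨fun _ => 1, Φ, by simp, by simp, h, by simp, hi⟩

lemma spl_bound [Nonempty Y] {i j : J} (hij : i ≠ j) {Φ : (J → Y) → ℝ} (h : Spl i j Φ)
    (g : Y → Y → ℝ) (ε : ℝ) (hε : 0 ≤ ε)
    (hg : ∑ u, ∑ u', |∑ v, g u v * g u' v| ≤ ε * (Fintype.card Y : ℝ) ^ 3) :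
    |∑ z, Φ z * g (z i) (z j)| ≤ √ε * (Fintype.card Y : ℝ) ^ (Fintype.card J) := by
  obtain ⟨a, b, h, ha, hb, hj, hi⟩ := h
  set N : ℝ := (Fintype.card Y : ℝ) with hN
  have hN0 : 0 < N := by rw [hN]; exact_mod_cast Fintype.card_pos
  have e1 : N * (N * ∑ z, Φ z * g (z i) (z j)) =
      ∑ z : J → Y, ∑ u, ∑ v, a (Function.update z i u) * b (Function.update z j v) * g u v := by
    rw [hN, ← avg_update j, ← avg_update i (fun z => ∑ u, _)]
    refine Finset.sum_congr rfl fun z _ => Finset.sum_congr rfl fun u _ => Finset.sum_congr rfl fun v _ => ?_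
    rw [h, hj]
    rw [show b (Function.update (Function.update z i u) j v) = b (Function.update z j v) by
      rw [Function.update_comm hij, hi]]
    congr 1
    simp [hij]
  have h2 : N * (N * |∑ z, Φ z * g (z i) (z j)|) ≤ N ^ (Fintype.card J) * (√ε * N ^ 2) := by
    calc N * (N * |∑ z, Φ z * g (z i) (z j)|) = |N * (N * ∑ z, Φ z * g (z i) (z j))| := by
          rw [abs_mul, abs_mul, abs_of_pos hN0]
      _ ≤ ∑ z : J → Y, |∑ u, ∑ v, a (Function.update z i u) * b (Function.update z j v) * g u v| := by
          rw [e1]; exact Finset.abs_sum_le_sum_abs _ _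
      _ ≤ ∑ z : J → Y, √ε * N ^ 2 := by
          refine Finset.sum_le_sum fun z _ => ?_
          exact cut_bound g ε hε hg (fun u => a (Function.update z i u)) (fun v => b (Function.update z j v))
            (fun u => ha _) (fun v => hb _)
      _ = _ := by simp [hN]
  have h3 : N ^ 2 * |∑ z, Φ z * g (z i) (z j)| ≤ N ^ 2 * (√ε * N ^ (Fintype.card J)) := by nlinarith
  exact le_of_mul_le_mul_left h3 (by positivity)

lemma sum_prod_pi (α : J → Y → ℝ) : ∑ z : J → Y, ∏ j, α j (z j) = ∏ j, ∑ u, α j u := by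
  rw [Finset.prod_univ_sum]
  simp [Fintype.piFinset_univ]

/-- counting lemma -/
lemma counting [Nonempty Y] (α : J → Y → ℝ) (hα : ∀ j u, 0 ≤ α j u ∧ α j u ≤ 1)
    (A : J → J → Y → Y → Prop) (d : J → J → ℝ) (hd : ∀ i j, 0 ≤ d i j ∧ d i j ≤ 1) (ε : ℝ) (hε : 0 ≤ ε)
    (hg : ∀ i j, ∑ u, ∑ u', |∑ v, (ind (A i j u v) - d i j) * (ind (A i j u' v) - d i j)| ≤ ε * (Fintype.card Y : ℝ) ^ 3)
    (P : Finset (J × J)) (hP : ∀ e ∈ P, e.1 ≠ e.2 ∧ (e.2, e.1) ∉ P) :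
    (∏ e ∈ P, d e.1 e.2) * ∏ j, ∑ u, α j u - #P * √ε * (Fintype.card Y : ℝ) ^ (Fintype.card J) ≤
      ∑ z : J → Y, (∏ j, α j (z j)) * ∏ e ∈ P, ind (A e.1 e.2 (z e.1) (z e.2)) := by
  induction P using Finset.induction_on with
  | empty => simp [sum_prod_pi]
  | insert e P he ih =>
    have ih' := ih (fun e' he' => ⟨(hP e' (Finset.mem_insert_of_mem he')).1,
      fun h => (hP e' (Finset.mem_insert_of_mem he')).2 (Finset.mem_insert_of_mem h)⟩)
    have hee := hP e (Finset.mem_insert_self _ _)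
    set N : ℝ := (Fintype.card Y : ℝ) with hN
    have hspl : Spl e.1 e.2 (fun z : J → Y => (∏ j, α j (z j)) * ∏ e ∈ P, ind (A e.1 e.2 (z e.1) (z e.2))) := by
      apply Spl.mul
      · apply Spl.prod
        intro k _
        by_cases hk : k = e.2
        · apply Spl.right (fun z => hα _ _)
          intro z v
          rw [Function.update_of_ne (by rw [hk]; exact hee.1.symm)]
        · apply Spl.left (fun z => hα _ _)
          intro z v
          rw [Function.update_of_ne hk]
      · apply Spl.prod
        intro k hk
        have hk' := hP k (Finset.mem_insert_of_mem hk)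
        by_cases h2 : k.1 = e.2 ∨ k.2 = e.2
        · have h3 : k.1 ≠ e.1 ∧ k.2 ≠ e.1 := by
            constructor
            · intro h4
              rcases h2 with h2 | h2
              · exact hee.1 (h4.symm.trans h2)
              · have : k = e := Prod.ext h4 h2
                exact he (this ▸ hk)
            · intro h4
              rcases h2 with h2 | h2
              · apply hee.2
                have : k = (e.2, e.1) := Prod.ext h2 h4
                exact this ▸ Finset.mem_insert_of_mem hk
              · exact hee.1 (h4.symm.trans h2)
          apply Spl.right (fun z => ⟨ind_nonneg _, ind_le_one _⟩)
          intro z v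
          rw [Function.update_of_ne h3.1, Function.update_of_ne h3.2]
        · push Not at h2
          apply Spl.left (fun z => ⟨ind_nonneg _, ind_le_one _⟩)
          intro z v
          rw [Function.update_of_ne h2.1, Function.update_of_ne h2.2]
    have hb := spl_bound hee.1 hspl (fun u v => ind (A e.1 e.2 u v) - d e.1 e.2) ε hε (hg e.1 e.2)
    rw [← hN] at hb
    have e1 : ∑ z : J → Y, (∏ j, α j (z j)) * ∏ e ∈ insert e P, ind (A e.1 e.2 (z e.1) (z e.2)) =
        d e.1 e.2 * (∑ z : J → Y, (∏ j, α j (z j)) * ∏ e ∈ P, ind (A e.1 e.2 (z e.1) (z e.2))) +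
        ∑ z : J → Y, ((∏ j, α j (z j)) * ∏ e ∈ P, ind (A e.1 e.2 (z e.1) (z e.2))) *
          (ind (A e.1 e.2 (z e.1) (z e.2)) - d e.1 e.2) := by
      rw [Finset.mul_sum, ← Finset.sum_add_distrib]
      refine Finset.sum_congr rfl fun z _ => ?_
      rw [Finset.prod_insert he]; ring
    rw [e1, Finset.prod_insert he, Finset.card_insert_of_notMem he]
    have h4 := (abs_le.1 hb).1
    have h5 := mul_le_mul_of_nonneg_left ih' (hd e.1 e.2).1
    have h6 : 0 ≤ #P * √ε * N ^ (Fintype.card J) := by positivity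
    have h7 := mul_le_of_le_one_left h6 (hd e.1 e.2).2
    push_cast
    linarith
end PartE1
end KF

namespace KF
set_option linter.unusedSectionVars false
set_option linter.unusedSimpArgs false
set_option linter.unusedVariables false
section PartE2

variable {ι Y : Type*} [Fintype ι] [Fintype Y]

lemma sum_ind_card {κ : Type*} (S : Finset κ) (p : κ → Prop) : ∑ u ∈ S, ind (p u) = (#(S.filter p) : ℝ) := by
  rw [Finset.card_filter]
  push_cast
  refine Finset.sum_congr rfl fun u _ => ?_
  unfold ind
  by_cases h : p u <;> simp [h]

/-- valid tile -/
def vld {ι Y : Type*} (adj : ι → ι → Y → Y → Prop) (x : ι → Y) : Prop := ∀ a b, adj a b (x a) (x b)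

/-- tileable families -/
inductive Tb {ι Y : Type*} (q : (ι → Y) → Prop) : (ι → Finset Y) → Prop
  | nil : Tb q (fun _ => ∅)
  | cons (x : ι → Y) (W : ι → Finset Y) : q x → (∀ b, x b ∉ W b) → Tb q W → Tb q (fun b => insert (x b) (W b))

lemma Tb.union {q : (ι → Y) → Prop} {W W' : ι → Finset Y} (h : Tb q W) (h' : Tb q W')
    (hd : ∀ b, Disjoint (W b) (W' b)) : Tb q (fun b => W b ∪ W' b) := by
  induction h with
  | nil => simpa using h'
  | cons x W hx hW hT ih =>
    have h1 : ∀ b, Disjoint (W b) (W' b) := fun b => (Finset.disjoint_insert_left.1 (hd b)).2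
    have h2 := Tb.cons x (fun b => W b ∪ W' b) hx (fun b => by
      rw [Finset.mem_union]
      rintro (h | h)
      · exact hW b h
      · exact (Finset.disjoint_insert_left.1 (hd b)).1 h) (ih h1)
    simpa [Finset.insert_union] using h2

lemma Tb.fam {q : (ι → Y) → Prop} {κ : Type*} (S : Finset κ) (t : κ → ι → Y) (ht : ∀ k ∈ S, q (t k))
    (hinj : ∀ b, Set.InjOn (fun k => t k b) S) : Tb q (fun b => S.image (fun k => t k b)) := by
  induction S using Finset.induction_on with
  | empty => simpa using Tb.nil
  | insert k S hk ih =>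
    have h1 := ih (fun k hk => ht k (Finset.mem_insert_of_mem hk))
      (fun b => (hinj b).mono (by simp))
    have h2 := Tb.cons (t k) _ (ht k (Finset.mem_insert_self _ _)) (fun b => by
      intro h
      obtain ⟨k', hk', e⟩ := Finset.mem_image.1 h
      have := hinj b (by simp [hk']) (by simp) e
      exact hk (this ▸ hk')) h1
    simpa [Finset.image_insert] using h2

/-- good structure on a common vertex type -/
structure GoodY (adj : ι → ι → Y → Y → Prop) (d : ι → ι → ℝ) (θ ε : ℝ) : Prop where
  symm : ∀ a b u v, adj a b u v → adj b a v u
  refl : ∀ a u v, adj a a u v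
  dl : ∀ a b, θ ≤ d a b
  du : ∀ a b, d a b ≤ 1
  deg : ∀ a b u, θ * Fintype.card Y ≤ ∑ v, ind (adj a b u v)
  cut : ∀ a b, ∑ u, ∑ u', |∑ v, (ind (adj a b u v) - d a b) * (ind (adj a b u' v) - d a b)| ≤ ε * (Fintype.card Y : ℝ) ^ 3

lemma counting2 [Nonempty Y] {J : Type*} [Fintype J] {adj : ι → ι → Y → Y → Prop} {d : ι → ι → ℝ} {θ ε : ℝ}
    (hG : GoodY adj d θ ε) (hθ : 0 < θ) (hθ1 : θ ≤ 1) (hε : 0 ≤ ε) (τ : J → ι) (R : J → J → Prop) (W : J → Finset Y)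
    (hR : ∀ i j, R i j → R j i) :
    θ ^ (Fintype.card J ^ 2) * ∏ j, (#(W j) : ℝ) - (Fintype.card J ^ 2 : ℕ) * √ε * (Fintype.card Y : ℝ) ^ (Fintype.card J) ≤
      #(univ.filter fun z : J → Y => (∀ j, z j ∈ W j) ∧ ∀ i j, i ≠ j → R i j → adj (τ i) (τ j) (z i) (z j)) := by
  let f := Fintype.equivFin J
  let P : Finset (J × J) := univ.filter fun e => f e.1 < f e.2 ∧ R e.1 e.2
  have hP : ∀ e ∈ P, e.1 ≠ e.2 ∧ (e.2, e.1) ∉ P := by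
    intro e he
    simp only [P, Finset.mem_filter, Finset.mem_univ, true_and] at he ⊢
    refine ⟨fun h => ?_, fun h => ?_⟩
    · rw [h] at he; exact lt_irrefl _ he.1
    · exact lt_asymm he.1 h.1
  have hPc : #P ≤ Fintype.card J ^ 2 := by
    refine (Finset.card_le_univ _).trans ?_
    rw [Fintype.card_prod, sq]
  have h := counting (fun j u => ind (u ∈ W j)) (fun j u => ⟨ind_nonneg _, ind_le_one _⟩)
    (fun i j => adj (τ i) (τ j)) (fun i j => d (τ i) (τ j)) (fun i j => ⟨hθ.le.trans (hG.dl _ _), hG.du _ _⟩) ε hε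
    (fun i j => hG.cut _ _) P hP
  have h1 : ∀ j, ∑ u, ind (u ∈ W j) = (#(W j) : ℝ) := by
    intro j
    rw [sum_ind_card]
    congr 2
    ext u; simp
  simp only [h1] at h
  have h2 : θ ^ (Fintype.card J ^ 2) ≤ ∏ e ∈ P, d (τ e.1) (τ e.2) := by
    calc θ ^ (Fintype.card J ^ 2) ≤ θ ^ #P := pow_le_pow_of_le_one hθ.le hθ1 hPc
      _ = ∏ e ∈ P, θ := by simp
      _ ≤ _ := Finset.prod_le_prod (fun _ _ => hθ.le) (fun _ _ => hG.dl _ _)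
  have h3 : (#P : ℝ) ≤ (Fintype.card J ^ 2 : ℕ) := by exact_mod_cast hPc
  have h4 : ∑ z : J → Y, (∏ j, ind (z j ∈ W j)) * ∏ e ∈ P, ind (adj (τ e.1) (τ e.2) (z e.1) (z e.2)) ≤
      #(univ.filter fun z : J → Y => (∀ j, z j ∈ W j) ∧ ∀ i j, i ≠ j → R i j → adj (τ i) (τ j) (z i) (z j)) := by
    rw [Finset.card_filter]
    push_cast
    refine Finset.sum_le_sum fun z _ => ?_
    split_ifs with hz
    · exact mul_le_one₀ (Finset.prod_le_one (fun _ _ => ind_nonneg _) (fun _ _ => ind_le_one _))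
        (Finset.prod_nonneg fun _ _ => ind_nonneg _)
        (Finset.prod_le_one (fun _ _ => ind_nonneg _) (fun _ _ => ind_le_one _))
    · apply le_of_eq
      by_contra hne
      apply hz
      have hne1 := left_ne_zero_of_mul hne
      have hne2 := right_ne_zero_of_mul hne
      rw [Finset.prod_ne_zero_iff] at hne1 hne2
      have hin : ∀ p : Prop, ind p ≠ 0 → p := by
        intro p hp; by_contra h; exact hp (by simp [ind, h])
      have key : ∀ i j, f i < f j → R i j → adj (τ i) (τ j) (z i) (z j) := fun i j h h' =>
        hin _ (hne2 (i, j) (by simp [P, h, h']))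
      refine ⟨fun j => hin _ (hne1 j (Finset.mem_univ _)), fun i j hij hr => ?_⟩
      rcases lt_trichotomy (f i) (f j) with h5 | h5 | h5
      · exact key i j h5 hr
      · exact absurd (f.injective h5) hij
      · exact hG.symm _ _ _ _ (key j i h5 (hR _ _ hr))
  refine le_trans ?_ (h.trans h4)
  have h5 : 0 ≤ ∏ j, (#(W j) : ℝ) := Finset.prod_nonneg fun _ _ => Nat.cast_nonneg _
  have h6 := mul_le_mul_of_nonneg_right h2 h5
  have h7 : (#P : ℝ) * √ε * (Fintype.card Y : ℝ) ^ (Fintype.card J) ≤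
      (Fintype.card J ^ 2 : ℕ) * √ε * (Fintype.card Y : ℝ) ^ (Fintype.card J) := by gcongr
  linarith

/-- tiles in large sets -/
lemma exists_tile [Nonempty Y] {adj : ι → ι → Y → Y → Prop} {d : ι → ι → ℝ} {θ ε : ℝ}
    (hG : GoodY adj d θ ε) (hθ : 0 < θ) (hθ1 : θ ≤ 1) (hε : 0 ≤ ε) (β : ℝ) (hβ : 0 < β)
    (hc : (Fintype.card ι ^ 2 : ℕ) * √ε < θ ^ (Fintype.card ι ^ 2) * β ^ Fintype.card ι)
    (W : ι → Finset Y) (hW : ∀ b, β * Fintype.card Y ≤ #(W b)) :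
    ∃ x, vld adj x ∧ ∀ b, x b ∈ W b := by
  have h := counting2 hG hθ hθ1 hε (fun b : ι => b) (fun _ _ => True) W (fun _ _ _ => trivial)
  have hN : (0:ℝ) < Fintype.card Y := by exact_mod_cast Fintype.card_pos
  have h1 : (β * Fintype.card Y) ^ Fintype.card ι ≤ ∏ j, (#(W j) : ℝ) := by
    calc (β * Fintype.card Y) ^ Fintype.card ι = ∏ j : ι, (β * Fintype.card Y) := by simp
      _ ≤ _ := Finset.prod_le_prod (fun _ _ => by positivity) (fun j _ => hW j)
  have h2 : (0:ℝ) < θ ^ (Fintype.card ι ^ 2) * ∏ j, (#(W j) : ℝ) - (Fintype.card ι ^ 2 : ℕ) * √ε * (Fintype.card Y : ℝ) ^ (Fintype.card ι) := by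
    have h3 := mul_lt_mul_of_pos_right hc (pow_pos hN (Fintype.card ι))
    have h4 := mul_le_mul_of_nonneg_left h1 (pow_pos hθ (Fintype.card ι ^ 2)).le
    rw [mul_pow] at h4
    linarith
  have h2' := lt_of_lt_of_le h2 h
  obtain ⟨z, hz⟩ := Finset.card_pos.1 (Nat.cast_pos.1 h2')
  simp only [Finset.mem_filter, Finset.mem_univ, true_and] at hz
  refine ⟨z, fun a b => ?_, hz.1⟩
  by_cases hab : a = b
  · subst hab; exact hG.refl _ _ _
  · exact hz.2 a b hab trivial

/-- greedy partial tiling -/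
lemma partial_tiling [Nonempty Y] {q : (ι → Y) → Prop} (B : ℕ)
    (hq : ∀ W : ι → Finset Y, (∀ b, B ≤ #(W b)) → ∃ x, q x ∧ ∀ b, x b ∈ W b)
    (k : ℕ) (R : ι → Finset Y) (hR : ∀ b, #(R b) = k) :
    ∃ (W : ι → Finset Y) (l : ℕ), Tb q W ∧ (∀ b, W b ⊆ R b) ∧ (∀ b, #(R b \ W b) = l) ∧ (l < B ∨ l = 0) := by
  induction k generalizing R with
  | zero => exact ⟨fun _ => ∅, 0, Tb.nil, by simp, by simpa using hR, Or.inr rfl⟩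
  | succ k ih =>
    by_cases hB : k + 1 < B
    · exact ⟨fun _ => ∅, k + 1, Tb.nil, by simp, by simpa using hR, Or.inl hB⟩
    · obtain ⟨x, hx, hxR⟩ := hq R (fun b => by rw [hR]; omega)
      obtain ⟨W, l, h1, h2, h3, h4⟩ := ih (fun b => (R b).erase (x b)) (fun b => by
        rw [Finset.card_erase_of_mem (hxR b), hR]; rfl)
      refine ⟨_, l, Tb.cons x W hx (fun b h => by simpa using h2 b h) h1, ?_, ?_, h4⟩
      · intro b
        apply Finset.insert_subset (hxR b)
        exact (h2 b).trans (Finset.erase_subset _ _)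
      · intro b
        rw [← h3 b]
        congr 1
        ext y
        simp only [Finset.mem_sdiff, Finset.mem_insert, Finset.mem_erase]
        tauto

/-- columns of an absorber -/
noncomputable def csl (z : ι × ι → Y) (b : ι) : Finset Y := univ.image fun a => z (a, b)

/-- absorbers -/
structure Abs (adj : ι → ι → Y → Y → Prop) (z : ι × ι → Y) : Prop where
  row : ∀ a, vld adj (fun b => z (a, b))
  diag : vld adj (fun a => z (a, a))
  inj : ∀ a a' b, z (a, b) = z (a', b) → a = a'

/-- `z` can absorb `X` -/
def Absb (adj : ι → ι → Y → Y → Prop) (X : ι → Y) (z : ι × ι → Y) : Prop :=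
  ∀ a, vld adj (Function.update (fun b => z (a, b)) a (X a))

lemma Abs.tb {adj : ι → ι → Y → Y → Prop} {z : ι × ι → Y} (h : Abs adj z) : Tb (vld adj) (csl z) :=
  Tb.fam univ (fun a b => z (a, b)) (fun a _ => h.row a) (fun b a _ a' _ e => h.inj a a' b e)

lemma Abs.tb2 {adj : ι → ι → Y → Y → Prop} {z : ι × ι → Y} (h : Abs adj z) {X : ι → Y} (hX : Absb adj X z)
    (hd : ∀ b, X b ∉ csl z b) : Tb (vld adj) (fun b => insert (X b) (csl z b)) := by
  have hd' : ∀ a b, z (a, b) ≠ X b := fun a b e => hd b (by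
    rw [← e]; exact Finset.mem_image_of_mem (fun a => z (a, b)) (Finset.mem_univ a))
  have h1 := Tb.fam (q := vld adj) (univ : Finset (Option ι))
    (fun o => o.elim (fun a => z (a, a)) (fun a => Function.update (fun b => z (a, b)) a (X a)))
    (by
      rintro (_ | a) _
      · exact h.diag
      · exact hX a)
    (by
      intro b o _ o' _ e
      have key : ∀ a, (Function.update (fun b => z (a, b)) a (X a) b) = if a = b then X b else z (a, b) := by
        intro a
        by_cases hab : a = b
        · subst hab; simp
        · simp [hab, Function.update_of_ne (Ne.symm hab)]
      rcases o with _ | a <;> rcases o' with _ | a'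
      · rfl
      · simp only [Option.elim_none, Option.elim_some, key] at e
        split_ifs at e with h1
        · exact absurd e (hd' _ _)
        · exact absurd (h.inj _ _ _ e).symm h1
      · simp only [Option.elim_none, Option.elim_some, key] at e
        split_ifs at e with h1
        · exact absurd e.symm (hd' _ _)
        · exact absurd (h.inj _ _ _ e) h1
      · simp only [Option.elim_none, Option.elim_some, key] at e
        split_ifs at e with h1 h2 h2
        · rw [h1, h2]
        · exact absurd e.symm (hd' _ _)
        · exact absurd e (hd' _ _)
        · rw [h.inj _ _ _ e])
  convert h1 using 2 with b
  ext y
  simp only [csl, Finset.mem_insert, Finset.mem_image, Finset.mem_univ, true_and, Option.exists, Option.elim_none, Option.elim_some]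
  constructor
  · rintro (rfl | ⟨a, rfl⟩)
    · exact Or.inr ⟨b, by simp⟩
    · by_cases hab : a = b
      · subst hab; exact Or.inl rfl
      · exact Or.inr ⟨a, by rw [Function.update_of_ne (Ne.symm hab)]⟩
  · rintro (rfl | ⟨a, rfl⟩)
    · exact Or.inr ⟨b, rfl⟩
    · by_cases hab : a = b
      · subst hab; simp
      · exact Or.inr ⟨a, by rw [Function.update_of_ne (Ne.symm hab)]⟩

/-- disjointness of absorbers -/
def Dj (z z' : ι × ι → Y) : Prop := ∀ b, Disjoint (csl z b) (csl z' b)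

lemma tb_family {adj : ι → ι → Y → Y → Prop} (F : Finset (ι × ι → Y)) (hF : ∀ z ∈ F, Abs adj z)
    (hD : ∀ z ∈ F, ∀ z' ∈ F, z ≠ z' → Dj z z') : Tb (vld adj) (fun b => F.biUnion fun z => csl z b) := by
  induction F using Finset.induction_on with
  | empty => simpa using Tb.nil
  | insert z F hz ih =>
    have h1 := ih (fun z hz => hF z (Finset.mem_insert_of_mem hz))
      (fun z hz z' hz' => hD z (Finset.mem_insert_of_mem hz) z' (Finset.mem_insert_of_mem hz'))
    have h2 := ((hF z (Finset.mem_insert_self _ _)).tb).union h1 (fun b => by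
      rw [Finset.disjoint_biUnion_right]
      intro z' hz'
      exact hD z (Finset.mem_insert_self _ _) z' (Finset.mem_insert_of_mem hz') (fun e => hz (e ▸ hz')) b)
    simpa [Finset.biUnion_insert] using h2

lemma absorb {adj : ι → ι → Y → Y → Prop} (l : ℕ) (F : Finset (ι × ι → Y)) (hF : ∀ z ∈ F, Abs adj z)
    (hD : ∀ z ∈ F, ∀ z' ∈ F, z ≠ z' → Dj z z') (hc : ∀ X, l ≤ #(F.filter fun z => Absb adj X z))
    (Lf : ι → Finset Y) (hL : ∀ b, #(Lf b) = l) (hLF : ∀ b, ∀ z ∈ F, Disjoint (Lf b) (csl z b)) :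
    Tb (vld adj) (fun b => Lf b ∪ F.biUnion fun z => csl z b) := by
  induction l generalizing F Lf with
  | zero =>
    have : Lf = fun _ => ∅ := by
      funext b; exact Finset.card_eq_zero.1 (hL b)
    subst this
    simpa using tb_family F hF hD
  | succ l ih =>
    have hne : ∀ b, ∃ x, x ∈ Lf b := fun b => Finset.card_pos.1 (by rw [hL]; omega)
    choose X hX using hne
    obtain ⟨z, hz⟩ := Finset.card_pos.1 (lt_of_lt_of_le (Nat.succ_pos l) (hc X))
    rw [Finset.mem_filter] at hz
    have h1 := (hF z hz.1).tb2 hz.2 (fun b h => Finset.disjoint_left.1 (hLF b z hz.1) (hX b) h)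
    have h2 := ih (F.erase z) (fun z' hz' => hF z' (Finset.mem_of_mem_erase hz'))
      (fun z1 h1 z2 h2 => hD z1 (Finset.mem_of_mem_erase h1) z2 (Finset.mem_of_mem_erase h2))
      (fun X' => by
        have h3 := hc X'
        have h4 : #((F.filter fun z => Absb adj X' z).erase z) ≤ #((F.erase z).filter fun z => Absb adj X' z) := by
          apply Finset.card_le_card
          intro y hy
          simp only [Finset.mem_erase, Finset.mem_filter] at hy ⊢
          tauto
        have h5 := Finset.pred_card_le_card_erase (s := F.filter fun z => Absb adj X' z) (a := z)
        omega)
      (fun b => (Lf b).erase (X b)) (fun b => by rw [Finset.card_erase_of_mem (hX b), hL]; rfl)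
      (fun b z' hz' => (hLF b z' (Finset.mem_of_mem_erase hz')).mono_left (Finset.erase_subset _ _))
    have h3 := h1.union h2 (fun b => by
      rw [Finset.disjoint_union_right, Finset.disjoint_insert_left, Finset.disjoint_insert_left, Finset.disjoint_biUnion_right]
      refine ⟨⟨by simp, ?_⟩, ?_, ?_⟩
      · exact (hLF b z hz.1).symm.mono_right (Finset.erase_subset _ _)
      · rw [Finset.mem_biUnion]
        rintro ⟨z', hz', h⟩
        exact Finset.disjoint_left.1 (hLF b z' (Finset.mem_of_mem_erase hz')) (hX b) h
      · intro z' hz'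
        exact hD z hz.1 z' (Finset.mem_of_mem_erase hz') (Finset.ne_of_mem_erase hz').symm b)
    convert h3 using 2 with b
    ext y
    have hXb := hX b
    simp only [Finset.mem_union, Finset.mem_insert, Finset.mem_erase, Finset.mem_biUnion]
    constructor
    · rintro (h | ⟨z', hz', h⟩)
      · by_cases hy : y = X b
        · exact Or.inl (Or.inl hy)
        · exact Or.inr (Or.inl ⟨hy, h⟩)
      · by_cases hzz : z' = z
        · subst hzz; exact Or.inl (Or.inr h)
        · exact Or.inr (Or.inr ⟨z', ⟨hzz, hz'⟩, h⟩)
    · rintro ((rfl | h) | (h | ⟨z', hz', h⟩))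
      · exact Or.inl hXb
      · exact Or.inr ⟨z, hz.1, h⟩
      · exact Or.inl h.2
      · exact Or.inr ⟨z', hz'.2, h⟩
end PartE2
end KF

namespace KF
set_option linter.unusedSectionVars false
set_option linter.unusedSimpArgs false
set_option linter.unusedVariables false
section PartE3

lemma upd_count {J Y : Type*} [Fintype J] [Fintype Y] (i : J) (S : Finset (J → Y))
    (h : ∀ z ∈ S, ∀ z' ∈ S, (∀ j, j ≠ i → z j = z' j) → z = z') :
    (#S : ℝ) * Fintype.card Y ≤ (Fintype.card Y : ℝ) ^ Fintype.card J := by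
  have h1 : #(S ×ˢ (univ : Finset Y)) ≤ #(univ : Finset (J → Y)) := by
    apply Finset.card_le_card_of_injOn (fun p => Function.update p.1 i p.2) (fun _ _ => by simp)
    rintro ⟨z, y⟩ hz ⟨z', y'⟩ hz' e
    simp only [Finset.coe_product, Set.mem_prod, Finset.mem_coe] at hz hz'
    simp only at e
    have e1 : y = y' := by simpa using congrFun e i
    have e2 : z = z' := h z hz.1 z' hz'.1 (fun j hj => by
      have := congrFun e j
      simpa [Function.update_of_ne hj] using this)
    rw [e1, e2]
  rw [Finset.card_product, Finset.card_univ, Finset.card_univ, Fintype.card_fun] at h1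
  exact_mod_cast h1

lemma select {Z X : Type*} [Fintype Z] [Fintype X] [Nonempty X] (base : Z → Prop) (good : X → Z → Prop)
    (conf : Z → Z → Prop) (hrefl : ∀ z, conf z z) (hgb : ∀ x z, good x z → base z) (bad : Z → Prop) (κ : ℝ) (q : ℕ) (b c : ℝ)
    (hκ : 0 < κ) (hκ1 : κ ≤ 1)
    (hZ : 0 < Fintype.card Z)
    (h1 : ∀ x, 2 * κ * Fintype.card Z ≤ #(univ.filter fun z => good x z))
    (hb : (#(univ.filter fun z => bad z) : ℝ) ≤ b) (hc : ∀ z', (#(univ.filter fun z => conf z z') : ℝ) ≤ c) (hc0 : 0 ≤ c)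
    (hbc : b + q * c ≤ κ * Fintype.card Z) :
    ∀ j ≤ q, ∃ F : Finset Z, #F = j ∧ (∀ z ∈ F, base z ∧ ¬ bad z) ∧ (∀ z ∈ F, ∀ z' ∈ F, z ≠ z' → ¬ conf z z' ∨ ¬ conf z' z) ∧
      ∑ x, (1/2 : ℝ) ^ #(F.filter fun z => good x z) ≤ Fintype.card X * (1 - κ / 2) ^ j := by
  intro j
  induction j with
  | zero => intro _; exact ⟨∅, by simp⟩
  | succ j ih =>
    intro hj
    obtain ⟨F, hF, hF1, hF2, hF3⟩ := ih (by omega)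
    obtain ⟨A, hA⟩ : ∃ A : Finset Z, A = univ.filter fun z => base z ∧ ¬ bad z ∧ ∀ z' ∈ F, ¬ conf z z' := ⟨_, rfl⟩
    have hM : (0:ℝ) < Fintype.card Z := by exact_mod_cast hZ
    have hgA : ∀ x, κ * Fintype.card Z ≤ #(A.filter fun z => good x z) := by
      intro x
      have hsub : (univ.filter fun z => good x z) ⊆ (A.filter fun z => good x z) ∪
          ((univ.filter fun z => bad z) ∪ F.biUnion fun z' => univ.filter fun z => conf z z') := by
        intro z hz
        simp only [hA, Finset.mem_union, Finset.mem_filter, Finset.mem_univ, true_and, Finset.mem_biUnion] at hz ⊢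
        by_cases hb1 : bad z
        · exact Or.inr (Or.inl hb1)
        by_cases hb2 : ∃ z' ∈ F, conf z z'
        · exact Or.inr (Or.inr hb2)
        · push Not at hb2
          exact Or.inl ⟨⟨hgb x z hz, hb1, hb2⟩, hz⟩
      have h2 := (Finset.card_le_card hsub).trans ((Finset.card_union_le _ _).trans
        (Nat.add_le_add_left ((Finset.card_union_le _ _).trans (Nat.add_le_add_left Finset.card_biUnion_le _)) _))
      have h3 : (#(univ.filter fun z => good x z) : ℝ) ≤ #(A.filter fun z => good x z) +
        (#(univ.filter fun z => bad z) + ∑ z' ∈ F, (#(univ.filter fun z => conf z z') : ℝ)) := by exact_mod_cast h2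
      have h4 : ∑ z' ∈ F, (#(univ.filter fun z => conf z z') : ℝ) ≤ q * c := by
        calc _ ≤ ∑ z' ∈ F, c := Finset.sum_le_sum fun z' _ => hc z'
          _ = j * c := by rw [Finset.sum_const, hF]; simp
          _ ≤ _ := by
            apply mul_le_mul_of_nonneg_right _ hc0
            exact_mod_cast (by omega : j ≤ q)
      have := h1 x
      linarith
    have hAM : (#A : ℝ) ≤ Fintype.card Z := by exact_mod_cast Finset.card_le_univ _
    have hApos : 0 < #A := by
      obtain ⟨x⟩ := ‹Nonempty X›
      have h5 : (0:ℝ) < #(A.filter fun z => good x z) := lt_of_lt_of_le (by positivity) (hgA x)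
      exact (Nat.cast_pos.1 h5).trans_le (Finset.card_filter_le _ _)
    have hsum : ∑ z ∈ A, ∑ x, (1/2 : ℝ) ^ #((insert z F).filter fun z => good x z) ≤
        ∑ z ∈ A, (1 - κ/2) * ∑ x, (1/2 : ℝ) ^ #(F.filter fun z => good x z) := by
      rw [Finset.sum_comm, Finset.sum_const, nsmul_eq_mul, Finset.mul_sum, Finset.mul_sum]
      refine Finset.sum_le_sum fun x _ => ?_
      have h6 : ∀ z ∈ A, (1/2 : ℝ) ^ #((insert z F).filter fun z => good x z) =
          (1/2 : ℝ) ^ #(F.filter fun z => good x z) * (1 - (1/2) * ind (good x z)) := by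
        intro z hz
        rw [hA, Finset.mem_filter] at hz
        have hzF : z ∉ F := fun h => hz.2.2.2 z h (hrefl z)
        rw [Finset.filter_insert]
        split_ifs with hg
        · rw [Finset.card_insert_of_notMem (by simp [hzF]), pow_succ, ind_true hg]; norm_num
        · rw [ind_false hg]; norm_num
      rw [Finset.sum_congr rfl h6, ← Finset.mul_sum]
      have h7 : ∑ z ∈ A, (1 - (1/2) * ind (good x z)) = #A - 1/2 * #(A.filter fun z => good x z) := by
        rw [Finset.sum_sub_distrib, ← Finset.mul_sum, sum_ind_card]; simp
      rw [h7]
      have h8 := hgA x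
      have h9 : (0:ℝ) ≤ (1/2 : ℝ) ^ #(F.filter fun z => good x z) := by positivity
      have h10 : κ * #A ≤ #(A.filter fun z => good x z) := (mul_le_mul_of_nonneg_left hAM hκ.le).trans h8
      have h11 := mul_le_mul_of_nonneg_left (show (#A : ℝ) - 1/2 * #(A.filter fun z => good x z) ≤ #A * (1 - κ/2) by linarith) h9
      linarith
    obtain ⟨z, hzA, hz⟩ := Finset.exists_le_of_sum_le (Finset.card_pos.1 hApos) hsum
    have hzA' := hzA
    rw [hA, Finset.mem_filter] at hzA'
    have hzF : z ∉ F := fun h => hzA'.2.2.2 z h (hrefl z)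
    refine ⟨insert z F, by rw [Finset.card_insert_of_notMem hzF, hF], ?_, ?_, ?_⟩
    · intro y hy
      rcases Finset.mem_insert.1 hy with rfl | hy
      · exact ⟨hzA'.2.1, hzA'.2.2.1⟩
      · exact hF1 y hy
    · intro y hy y' hy' hne
      rcases Finset.mem_insert.1 hy with rfl | hy1 <;> rcases Finset.mem_insert.1 hy' with rfl | hy1'
      · exact absurd rfl hne
      · exact Or.inl (hzA'.2.2.2 _ hy1')
      · exact Or.inr (hzA'.2.2.2 _ hy1)
      · exact hF2 y hy1 y' hy1' hne
    · refine hz.trans ?_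
      have h12 := mul_le_mul_of_nonneg_left hF3 (show (0:ℝ) ≤ 1 - κ/2 by linarith)
      rw [pow_succ]
      linarith

lemma card_filter_imp {α : Type*} (i1 i2 : Fintype α) (p q : α → Prop) (dp : DecidablePred p) (dq : DecidablePred q)
    (h : ∀ z, p z → q z) : (#((@Finset.univ α i1).filter p) : ℝ) ≤ #((@Finset.univ α i2).filter q) := by
  refine Nat.cast_le.2 (Finset.card_le_card fun z hz => ?_)
  rw [Finset.mem_filter] at hz ⊢
  exact ⟨Finset.mem_univ _, h z hz.2⟩

lemma abs_of {ι Y : Type*} [Fintype ι] [Fintype Y] {adj : ι → ι → Y → Y → Prop} {d : ι → ι → ℝ} {θ ε : ℝ}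
    (hG : GoodY adj d θ ε) (X : ι → Y) (W : ι × ι → Finset Y)
    (hWd : ∀ j, W j = univ.filter fun v => j.1 = j.2 ∨ adj j.1 j.2 (X j.1) v) (z : ι × ι → Y) (hz1 : ∀ j, z j ∈ W j)
    (hz2 : ∀ i j : ι × ι, i ≠ j → i.1 = j.1 ∨ (i.1 = i.2 ∧ j.1 = j.2) → adj i.2 j.2 (z i) (z j)) :
    ((∀ a, vld adj (fun b => z (a, b))) ∧ vld adj (fun a => z (a, a))) ∧ Absb adj X z := by
  have hW : ∀ a b, a ≠ b → adj a b (X a) (z (a, b)) := by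
    intro a b hab
    have := hz1 (a, b)
    rw [hWd, Finset.mem_filter] at this
    exact this.2.resolve_left hab
  have hrow : ∀ a, vld adj (fun b => z (a, b)) := by
    intro a b b'
    by_cases hb : b = b'
    · subst hb; exact hG.refl _ _ _
    · exact hz2 (a, b) (a, b') (by simp [hb]) (Or.inl rfl)
  refine ⟨⟨hrow, ?_⟩, ?_⟩
  · intro b b'
    by_cases hb : b = b'
    · subst hb; exact hG.refl _ _ _
    · exact hz2 (b, b) (b', b') (by simp [hb]) (Or.inr ⟨rfl, rfl⟩)
  · intro a b b'
    by_cases hb : b = a <;> by_cases hb' : b' = a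
    · subst hb; subst hb'; exact hG.refl _ _ _
    · subst hb
      rw [Function.update_self, Function.update_of_ne hb']
      exact hW _ _ (Ne.symm hb')
    · subst hb'
      rw [Function.update_self, Function.update_of_ne hb]
      exact hG.symm _ _ _ _ (hW _ _ (Ne.symm hb))
    · rw [Function.update_of_ne hb, Function.update_of_ne hb']
      exact hrow a b b'

lemma abs_count {ι Y : Type*} [Fintype ι] [Fintype Y] [Nonempty Y] {adj : ι → ι → Y → Y → Prop} {d : ι → ι → ℝ} {θ ε : ℝ}
    (hG : GoodY adj d θ ε) (hθ : 0 < θ) (hθ1 : θ ≤ 1) (hε : 0 ≤ ε) (k : ℕ) (hk : k = Fintype.card (ι × ι))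
    (hc : (k ^ 2 : ℕ) * √ε ≤ θ ^ (k ^ 2 + k) / 2) (X : ι → Y) :
    θ ^ (k ^ 2 + k) / 2 * (Fintype.card Y : ℝ) ^ k ≤
      #(univ.filter fun z : ι × ι → Y => ((∀ a, vld adj (fun b => z (a, b))) ∧ vld adj (fun a => z (a, a))) ∧ Absb adj X z) := by
  obtain ⟨W, hWd⟩ : ∃ W : ι × ι → Finset Y, ∀ j, W j = univ.filter fun v => j.1 = j.2 ∨ adj j.1 j.2 (X j.1) v := ⟨_, fun _ => rfl⟩
  have h := counting2 hG hθ hθ1 hε (fun j : ι × ι => j.2) (fun i j => i.1 = j.1 ∨ (i.1 = i.2 ∧ j.1 = j.2))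
    W
    (by rintro i j (h | h); exacts [Or.inl h.symm, Or.inr ⟨h.2, h.1⟩])
  rw [← hk] at h
  have hNN : (0:ℝ) ≤ (Fintype.card Y : ℝ) := Nat.cast_nonneg _
  have h1 : (θ * Fintype.card Y) ^ k ≤ ∏ j : ι × ι, (#(W j) : ℝ) := by
    calc (θ * (Fintype.card Y : ℝ)) ^ k = ∏ j : ι × ι, (θ * (Fintype.card Y : ℝ)) := by
          rw [Finset.prod_const, Finset.card_univ, hk]
      _ ≤ _ := Finset.prod_le_prod (fun _ _ => by positivity) (fun j _ => by
        refine (hG.deg j.1 j.2 (X j.1)).trans ?_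
        rw [sum_ind_card]
        rw [hWd]
        refine Nat.cast_le.2 (Finset.card_le_card fun v hv => ?_)
        rw [Finset.mem_filter] at hv ⊢
        exact ⟨hv.1, Or.inr hv.2⟩)
  have h2 : θ ^ (k ^ 2 + k) / 2 * (Fintype.card Y : ℝ) ^ k ≤ θ ^ (k ^ 2) * ∏ j : ι × ι, (#(W j) : ℝ)
      - (k ^ 2 : ℕ) * √ε * (Fintype.card Y : ℝ) ^ k := by
    have h3 := mul_le_mul_of_nonneg_right hc (pow_nonneg hNN k)
    have h4 := mul_le_mul_of_nonneg_left h1 (pow_pos hθ (k ^ 2)).le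
    rw [mul_pow, ← mul_assoc, ← pow_add] at h4
    linarith
  refine h2.trans (h.trans ?_)
  exact card_filter_imp _ _ _ _ _ _ (fun z hz' => abs_of hG X W hWd z hz'.1 hz'.2)
end PartE3
end KF

namespace KF
set_option linter.unusedSectionVars false
set_option linter.unusedSimpArgs false
set_option linter.unusedVariables false
section PartE4

lemma inj_bad_count {ι Y : Type*} [Fintype ι] [Fintype Y] [Nonempty Y] :
    (#(univ.filter fun z : ι × ι → Y => ¬ ∀ a a' b, z (a, b) = z (a', b) → a = a') : ℝ) * Fintype.card Y ≤
      (Fintype.card ι : ℝ) ^ 3 * (Fintype.card Y : ℝ) ^ Fintype.card (ι × ι) := by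
  have hsub : (univ.filter fun z : ι × ι → Y => ¬ ∀ a a' b, z (a, b) = z (a', b) → a = a') ⊆
      (univ : Finset (ι × ι × ι)).biUnion fun e => univ.filter fun z : ι × ι → Y => e.1 ≠ e.2.1 ∧ z (e.1, e.2.2) = z (e.2.1, e.2.2) := by
    intro z hz
    have hz := (Finset.mem_filter.1 hz).2
    push Not at hz
    obtain ⟨a, a', b, h1, h2⟩ := hz
    exact Finset.mem_biUnion.2 ⟨(a, a', b), Finset.mem_univ _, Finset.mem_filter.2 ⟨Finset.mem_univ _, h2, h1⟩⟩
  have h1 := (Finset.card_le_card hsub).trans Finset.card_biUnion_le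
  have h2 : (#(univ.filter fun z : ι × ι → Y => ¬ ∀ a a' b, z (a, b) = z (a', b) → a = a') : ℝ) ≤
    ∑ e : ι × ι × ι, (#(univ.filter fun z : ι × ι → Y => e.1 ≠ e.2.1 ∧ z (e.1, e.2.2) = z (e.2.1, e.2.2)) : ℝ) := by exact_mod_cast h1
  refine (mul_le_mul_of_nonneg_right h2 (Nat.cast_nonneg _)).trans ?_
  rw [Finset.sum_mul]
  have h3 : ∀ e : ι × ι × ι, (#(univ.filter fun z : ι × ι → Y => e.1 ≠ e.2.1 ∧ z (e.1, e.2.2) = z (e.2.1, e.2.2)) : ℝ) * Fintype.card Y ≤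
      (Fintype.card Y : ℝ) ^ Fintype.card (ι × ι) := by
    intro e
    apply upd_count (e.1, e.2.2)
    intro z hz z' hz' h
    have hz := (Finset.mem_filter.1 hz).2
    have hz' := (Finset.mem_filter.1 hz').2
    funext j
    by_cases hj : j = (e.1, e.2.2)
    · rw [hj, hz.2, hz'.2]
      apply h
      intro h'
      exact hz.1 (Prod.mk.inj h').1.symm
    · exact h j hj
  refine (Finset.sum_le_sum fun e _ => h3 e).trans ?_
  rw [Finset.sum_const, Finset.card_univ, Fintype.card_prod, Fintype.card_prod, nsmul_eq_mul]
  push_cast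
  apply le_of_eq; ring

lemma conf_count {ι Y : Type*} [Fintype ι] [Fintype Y] [Nonempty Y] (z' : ι × ι → Y) :
    (#(univ.filter fun z : ι × ι → Y => ¬ Dj z z') : ℝ) * Fintype.card Y ≤
      (Fintype.card ι : ℝ) ^ 3 * (Fintype.card Y : ℝ) ^ Fintype.card (ι × ι) := by
  have hsub : (univ.filter fun z : ι × ι → Y => ¬ Dj z z') ⊆
      (univ : Finset (ι × ι × ι)).biUnion fun e => univ.filter fun z : ι × ι → Y => z (e.1, e.2.2) = z' (e.2.1, e.2.2) := by
    intro z hz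
    have hz := (Finset.mem_filter.1 hz).2
    unfold Dj at hz
    push Not at hz
    obtain ⟨b, hb⟩ := hz
    rw [Finset.not_disjoint_iff] at hb
    obtain ⟨y, h1, h2⟩ := hb
    obtain ⟨a, -, ha⟩ := Finset.mem_image.1 h1
    obtain ⟨a', -, ha'⟩ := Finset.mem_image.1 h2
    exact Finset.mem_biUnion.2 ⟨(a, a', b), Finset.mem_univ _, Finset.mem_filter.2 ⟨Finset.mem_univ _, ha.trans ha'.symm⟩⟩
  have h1 := (Finset.card_le_card hsub).trans Finset.card_biUnion_le
  have h2 : (#(univ.filter fun z : ι × ι → Y => ¬ Dj z z') : ℝ) ≤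
    ∑ e : ι × ι × ι, (#(univ.filter fun z : ι × ι → Y => z (e.1, e.2.2) = z' (e.2.1, e.2.2)) : ℝ) := by exact_mod_cast h1
  refine (mul_le_mul_of_nonneg_right h2 (Nat.cast_nonneg _)).trans ?_
  rw [Finset.sum_mul]
  have h3 : ∀ e : ι × ι × ι, (#(univ.filter fun z : ι × ι → Y => z (e.1, e.2.2) = z' (e.2.1, e.2.2)) : ℝ) * Fintype.card Y ≤
      (Fintype.card Y : ℝ) ^ Fintype.card (ι × ι) := by
    intro e
    apply upd_count (e.1, e.2.2)
    intro z hz z' hz' h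
    have hz := (Finset.mem_filter.1 hz).2
    have hz' := (Finset.mem_filter.1 hz').2
    funext j
    by_cases hj : j = (e.1, e.2.2)
    · rw [hj, hz, hz']
    · exact h j hj
  refine (Finset.sum_le_sum fun e _ => h3 e).trans ?_
  rw [Finset.sum_const, Finset.card_univ, Fintype.card_prod, Fintype.card_prod, nsmul_eq_mul]
  push_cast
  apply le_of_eq; ring

lemma ev_lin (A B D : ℝ) (hD : 0 < D) : ∃ Q : ℕ, ∀ N : ℕ, Q ≤ N → A * Real.log N + B ≤ D * N := by
  have h1 : Filter.Tendsto (fun x : ℝ => (A * Real.log x + B) / x) Filter.atTop (nhds 0) := by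
    have e1 : Filter.Tendsto (fun x : ℝ => Real.log x / x) Filter.atTop (nhds 0) :=
      Real.isLittleO_log_id_atTop.tendsto_div_nhds_zero
    have e2 : Filter.Tendsto (fun x : ℝ => B / x) Filter.atTop (nhds 0) := Filter.Tendsto.const_div_atTop Filter.tendsto_id B
    have e3 := (e1.const_mul A).add e2
    simp only [mul_zero, add_zero] at e3
    refine e3.congr fun x => ?_
    ring
  have h2 := (h1.eventually (gt_mem_nhds hD)).and (Filter.eventually_gt_atTop 0)
  obtain ⟨x0, hx0⟩ := Filter.eventually_atTop.1 h2
  refine ⟨⌈x0⌉₊, fun N hN => ?_⟩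
  have h3 := hx0 N ((Nat.le_ceil x0).trans (by exact_mod_cast hN))
  rw [div_lt_iff₀ h3.2] at h3
  exact h3.1.le

lemma card_filter_imp2 {α : Type*} (F : Finset α) (p q : α → Prop) (dp : DecidablePred p) (dq : DecidablePred q)
    (h : ∀ z, p z → q z) : #(F.filter p) ≤ #(F.filter q) := by
  refine Finset.card_le_card fun z hz => ?_
  rw [Finset.mem_filter] at hz ⊢
  exact ⟨hz.1, h z hz.2⟩

lemma half_single {X : Type*} [Fintype X] (f : X → ℕ) (B : ℝ) (h : ∑ x, (1/2 : ℝ) ^ f x ≤ B) (x : X) : (1/2 : ℝ) ^ f x ≤ B :=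
  (Finset.single_le_sum (f := fun x => (1/2 : ℝ) ^ f x) (fun _ _ => by positivity) (Finset.mem_univ x)).trans h

theorem exTiling (r : ℕ) (hr : 0 < r) (θ : ℝ) (hθ : 0 < θ) (hθ1 : θ ≤ 1) :
    ∃ ε : ℝ, 0 < ε ∧ ∃ Q : ℕ, ∀ (ι Y : Type) [Fintype ι] [Fintype Y], Fintype.card ι = r → Q ≤ Fintype.card Y →
      ∀ (adj : ι → ι → Y → Y → Prop) (d : ι → ι → ℝ), GoodY adj d θ ε → Tb (vld adj) (fun _ => univ) := by
  obtain ⟨k, hk⟩ : ∃ k, k = r * r := ⟨_, rfl⟩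
  obtain ⟨κ, hκd⟩ : ∃ κ : ℝ, κ = θ ^ (k ^ 2 + k) / 4 := ⟨_, rfl⟩
  have hκ : 0 < κ := by rw [hκd]; positivity
  have hκ1 : κ ≤ 1 := by
    have := pow_le_one₀ hθ.le hθ1 (n := k ^ 2 + k)
    rw [hκd]; linarith
  have hr0 : (0:ℝ) < r := by exact_mod_cast hr
  obtain ⟨γ, hγd⟩ : ∃ γ : ℝ, γ = κ / (2 * (r:ℝ) ^ 3) := ⟨_, rfl⟩
  have hγ : 0 < γ := by rw [hγd]; positivity
  have hγ2 : (r:ℝ) ^ 3 * γ = κ / 2 := by rw [hγd]; field_simp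
  obtain ⟨β, hβd⟩ : ∃ β : ℝ, β = κ * γ / 8 := ⟨_, rfl⟩
  have hβ : 0 < β := by rw [hβd]; positivity
  obtain ⟨η, hηd⟩ : ∃ η : ℝ, η = min (2 * κ / ((k ^ 2 : ℕ) + 1)) (θ ^ (r ^ 2) * β ^ r / ((r ^ 2 : ℕ) + 1)) := ⟨_, rfl⟩
  have hη : 0 < η := by rw [hηd]; apply lt_min <;> positivity
  obtain ⟨Q1, hQ1⟩ := ev_lin r (κ / 2) (3 * (κ * γ) / 8) (by positivity)
  obtain ⟨Q2, hQ2⟩ := ev_lin 0 ((r:ℝ) ^ 3) (κ / 2) (by positivity)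
  refine ⟨η ^ 2, by positivity, max 1 (max Q1 Q2), ?_⟩
  intro ι Y _ _ hι hY adj d hG
  have hN1 : 1 ≤ Fintype.card Y := (le_max_left _ _).trans hY
  have hQ1 := hQ1 _ (((le_max_left _ _).trans (le_max_right _ _)).trans hY)
  have hQ2 := hQ2 _ (((le_max_right _ _).trans (le_max_right _ _)).trans hY)
  rw [zero_mul, zero_add] at hQ2
  have : Nonempty Y := Fintype.card_pos_iff.1 hN1
  have : Nonempty ι := Fintype.card_pos_iff.1 (hι ▸ hr)
  obtain ⟨N, hN⟩ : ∃ N : ℕ, N = Fintype.card Y := ⟨_, rfl⟩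
  rw [← hN] at hN1 hQ1 hQ2
  have hNp : (0:ℝ) < N := by exact_mod_cast hN1
  have hkι : k = Fintype.card (ι × ι) := by rw [Fintype.card_prod, hι, hk]
  have hsq : √(η ^ 2) = η := Real.sqrt_sq hη.le
  have hc1 : (k ^ 2 : ℕ) * √(η ^ 2) ≤ θ ^ (k ^ 2 + k) / 2 := by
    rw [hsq]
    have h1 : η ≤ 2 * κ / ((k ^ 2 : ℕ) + 1) := by rw [hηd]; exact min_le_left _ _
    rw [le_div_iff₀ (by positivity)] at h1
    have h2 : θ ^ (k ^ 2 + k) / 2 = 2 * κ := by rw [hκd]; ring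
    rw [h2]
    linarith
  have hc2 : (Fintype.card ι ^ 2 : ℕ) * √(η ^ 2) < θ ^ (Fintype.card ι ^ 2) * β ^ Fintype.card ι := by
    rw [hsq, hι]
    have h1 : η ≤ θ ^ (r ^ 2) * β ^ r / ((r ^ 2 : ℕ) + 1) := by rw [hηd]; exact min_le_right _ _
    rw [le_div_iff₀ (by positivity)] at h1
    linarith
  have hac := abs_count hG hθ hθ1 (by positivity) k hkι hc1
  have hZ : (Fintype.card (ι × ι → Y) : ℝ) = (N:ℝ) ^ k := by rw [Fintype.card_fun, ← hkι, ← hN]; push_cast; rfl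
  obtain ⟨q, hq⟩ : ∃ q : ℕ, q = ⌊γ * N⌋₊ := ⟨_, rfl⟩
  have hq1 : (q:ℝ) ≤ γ * N := by rw [hq]; exact Nat.floor_le (by positivity)
  have hq2 : γ * N - 1 ≤ q := by rw [hq]; have := Nat.lt_floor_add_one (γ * N); linarith
  have hpk : (0:ℝ) < (N:ℝ) ^ k := by positivity
  have hbad := inj_bad_count (ι := ι) (Y := Y)
  rw [hι, ← hkι, ← hN, ← le_div_iff₀ hNp] at hbad
  have hconf := conf_count (ι := ι) (Y := Y)
  rw [hι, ← hkι, ← hN] at hconf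
  have hsel := select (Z := ι × ι → Y) (X := ι → Y)
    (fun z => (∀ a, vld adj (fun b => z (a, b))) ∧ vld adj (fun a => z (a, a)))
    (fun X z => ((∀ a, vld adj (fun b => z (a, b))) ∧ vld adj (fun a => z (a, a))) ∧ Absb adj X z)
    (fun z z' => ¬ Dj z z') (by
      intro z h
      obtain ⟨a⟩ := ‹Nonempty ι›
      have h1 := h a
      rw [disjoint_self] at h1
      have h2 : z (a, a) ∈ csl z a := Finset.mem_image_of_mem (fun a' => z (a', a)) (Finset.mem_univ a)
      rw [h1] at h2
      simp at h2) (fun X z h => h.1) (fun z => ¬ ∀ a a' b, z (a, b) = z (a', b) → a = a') κ q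
    ((r:ℝ) ^ 3 * (N:ℝ) ^ k / N) ((r:ℝ) ^ 3 * (N:ℝ) ^ k / N) hκ hκ1 Fintype.card_pos
    (by
      intro X
      rw [hZ]
      have h1 := hac X
      rw [← hN] at h1
      refine le_trans (le_of_eq ?_) (h1.trans (card_filter_imp _ _ _ _ _ _ (fun z h => h)))
      rw [hκd]; ring)
    ((card_filter_imp _ _ _ _ _ _ (fun z h => h)).trans hbad) (by
      intro z'
      have h1 := hconf z'
      rw [← le_div_iff₀ hNp] at h1
      exact (card_filter_imp _ _ _ _ _ _ (fun z h => h)).trans h1) (by positivity)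
    (by
      rw [hZ]
      have h1 : (r:ℝ) ^ 3 * (1 + q) ≤ κ * N := by
        have h2 : (r:ℝ) ^ 3 * q ≤ (r:ℝ) ^ 3 * (γ * N) := mul_le_mul_of_nonneg_left hq1 (by positivity)
        rw [← mul_assoc, hγ2] at h2
        linarith
      have h3 : (r:ℝ) ^ 3 * (N:ℝ) ^ k / N + q * ((r:ℝ) ^ 3 * (N:ℝ) ^ k / N) = ((r:ℝ) ^ 3 * (1 + q)) * ((N:ℝ) ^ k / N) := by ring
      rw [h3]
      refine (mul_le_mul_of_nonneg_right h1 (by positivity)).trans (le_of_eq ?_)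
      field_simp) q le_rfl
  obtain ⟨F, hF0, hF1, hF2, hF3⟩ := hsel
  have hAbs : ∀ z ∈ F, Abs adj z := by
    intro z hz
    obtain ⟨h1, h2⟩ := hF1 z hz
    exact ⟨h1.1, h1.2, not_not.1 h2⟩
  have hDj : ∀ z ∈ F, ∀ z' ∈ F, z ≠ z' → Dj z z' := by
    intro z hz z' hz' hne
    rcases hF2 z hz z' hz' hne with h | h
    · exact not_not.1 h
    · exact fun b => (not_not.1 h b).symm
  have hcnt : ∀ X, β * N ≤ #(F.filter fun z => Absb adj X z) := by
    intro X
    obtain ⟨c, h1, hcc⟩ : ∃ c : ℕ, (1/2 : ℝ) ^ c ≤ Fintype.card (ι → Y) * (1 - κ / 2) ^ q ∧ c ≤ #(F.filter fun z => Absb adj X z) := by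
      refine ⟨_, half_single _ _ hF3 X, ?_⟩
      exact card_filter_imp2 _ _ _ _ _ (fun z hz => hz.2)
    rw [Fintype.card_fun, hι, ← hN] at h1
    push_cast at h1
    have h2 : Real.exp (-(c:ℝ)) ≤ (1/2 : ℝ) ^ c := by
      have : Real.exp (-1) ≤ 1/2 := by
        rw [Real.exp_neg, inv_eq_one_div]
        apply one_div_le_one_div_of_le (by norm_num)
        have := Real.add_one_le_exp (1:ℝ); linarith
      calc Real.exp (-(c:ℝ)) = Real.exp (-1) ^ c := by rw [← Real.exp_nat_mul]; congr 1; ring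
        _ ≤ _ := pow_le_pow_left₀ (Real.exp_pos _).le this _
    have h3 : (1 - κ/2) ^ q ≤ Real.exp (-(κ/2) * q) := by
      have h4 := Real.add_one_le_exp (-(κ/2))
      calc (1 - κ/2) ^ q ≤ Real.exp (-(κ/2)) ^ q := pow_le_pow_left₀ (by linarith) (by linarith) _
        _ = _ := by rw [← Real.exp_nat_mul]; congr 1; ring
    have h4 : (N:ℝ) ^ r = Real.exp (r * Real.log N) := by
      rw [Real.exp_nat_mul, Real.exp_log hNp]
    have h5 : Real.exp (-(c:ℝ)) ≤ Real.exp (r * Real.log N + -(κ/2) * q) := by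
      rw [Real.exp_add, ← h4]
      exact h2.trans (h1.trans (mul_le_mul_of_nonneg_left h3 (by positivity)))
    have h6 := Real.exp_le_exp.1 h5
    have h7 : κ * (γ * N - 1) ≤ κ * q := mul_le_mul_of_nonneg_left hq2 hκ.le
    have h8 : (c:ℝ) ≤ #(F.filter fun z => Absb adj X z) := by exact_mod_cast hcc
    have h9 : β * N = κ * γ * N / 8 := by rw [hβd]; ring
    rw [h9]
    nlinarith only [h6, h7, h8, hQ1]
  have hcsl : ∀ b, #(F.biUnion fun z => csl z b) = q * r := by
    intro b
    rw [Finset.card_biUnion (fun z hz z' hz' hne => hDj z hz z' hz' hne b)]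
    rw [Finset.sum_congr rfl (g := fun _ => r) ?_, Finset.sum_const, hF0, smul_eq_mul]
    intro z hz
    unfold csl
    rw [Finset.card_image_of_injective _ (fun a a' e => (hAbs z hz).inj a a' b e), Finset.card_univ, hι]
  obtain ⟨W, l, hW1, hW2, hW3, hW4⟩ := partial_tiling (q := vld adj) ⌈β * N⌉₊
    (fun W hW => exists_tile hG hθ hθ1 (by positivity) β hβ hc2 W (fun b => by
      rw [← hN]
      exact (Nat.le_ceil _).trans (by exact_mod_cast hW b))) (N - q * r)
    (fun b => univ \ F.biUnion fun z => csl z b) (fun b => by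
      rw [Finset.card_sdiff_of_subset (Finset.subset_univ _), hcsl, Finset.card_univ, hN])
  have hl : (l:ℝ) ≤ β * N := by
    rcases hW4 with h | h
    · exact (Nat.lt_ceil.1 h).le
    · rw [h]; push_cast; positivity
  have hab := absorb l F hAbs hDj (fun X => by exact_mod_cast hl.trans (hcnt X))
    (fun b => (univ \ F.biUnion fun z => csl z b) \ W b) hW3 (fun b z hz => by
      rw [Finset.disjoint_left]
      intro y hy hy'
      rw [Finset.mem_sdiff, Finset.mem_sdiff] at hy
      exact hy.1.2 (Finset.mem_biUnion.2 ⟨z, hz, hy'⟩))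
  have hfin := hW1.union hab (fun b => by
    rw [Finset.disjoint_left]
    intro y hy hy'
    rcases Finset.mem_union.1 hy' with h | h
    · exact (Finset.mem_sdiff.1 h).2 hy
    · exact (Finset.mem_sdiff.1 (hW2 b hy)).2 h)
  convert hfin using 2 with b
  ext y
  simp only [Finset.mem_univ, Finset.mem_union, Finset.mem_sdiff, true_and, true_iff]
  tauto
end PartE4
end KF

namespace KF
set_option linter.unusedSectionVars false
set_option linter.unusedSimpArgs false
set_option linter.unusedVariables false
section PartD1
variable {V : Type*}

lemma subset_exp (U : Finset V) (w : V → ℝ) (hw : ∀ x ∈ U, |w x| ≤ 1) (lam : ℝ) :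
    ∑ L ∈ U.powerset, Real.exp (lam * (∑ x ∈ L, w x - (1/2) * ∑ x ∈ U, w x)) ≤ 2 ^ #U * Real.exp (#U * (lam ^ 2 / 8)) := by
  have h1 : ∏ x ∈ U, (Real.exp (lam * w x / 2) + Real.exp (-(lam * w x / 2))) =
      ∑ L ∈ U.powerset, Real.exp (lam * (∑ x ∈ L, w x - (1/2) * ∑ x ∈ U, w x)) := by
    rw [Finset.prod_add]
    refine Finset.sum_congr rfl fun L hL => ?_
    rw [← Real.exp_sum, ← Real.exp_sum, ← Real.exp_add]
    congr 1
    have h2 := Finset.sum_sdiff (f := w) (Finset.mem_powerset.1 hL)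
    rw [Finset.sum_neg_distrib, ← Finset.sum_div, ← Finset.sum_div, ← Finset.mul_sum, ← Finset.mul_sum, ← h2]
    ring
  rw [← h1]
  calc _ ≤ ∏ x ∈ U, (2 * Real.exp (lam ^ 2 / 8)) := by
        refine Finset.prod_le_prod (fun x _ => by positivity) fun x hx => ?_
        have h3 := Real.cosh_le_exp_half_sq (lam * w x / 2)
        rw [Real.cosh_eq] at h3
        have h4 : (lam * w x / 2) ^ 2 / 2 ≤ lam ^ 2 / 8 := by
          have h5 : (w x) ^ 2 ≤ 1 := (sq_le_one_iff_abs_le_one _).2 (hw x hx)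
          have h6 : lam ^ 2 * (w x) ^ 2 ≤ lam ^ 2 * 1 := mul_le_mul_of_nonneg_left h5 (sq_nonneg _)
          nlinarith only [h6]
        have := Real.exp_le_exp.2 h4
        linarith
    _ = _ := by rw [Finset.prod_const, mul_pow, ← Real.exp_nat_mul]

lemma half_bad (U : Finset V) (w : V → ℝ) (hw : ∀ x ∈ U, |w x| ≤ 1) (δ : ℝ) (hδ : 0 ≤ δ) :
    (#(U.powerset.filter fun L => δ * #U < ∑ x ∈ L, w x - (1/2) * ∑ x ∈ U, w x) : ℝ) ≤ 2 ^ #U * Real.exp (-(2 * δ ^ 2 * #U)) := by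
  have h1 := subset_exp U w hw (4 * δ)
  have h2 : (#(U.powerset.filter fun L => δ * #U < ∑ x ∈ L, w x - (1/2) * ∑ x ∈ U, w x) : ℝ) * Real.exp (4 * δ ^ 2 * #U) ≤
      ∑ L ∈ U.powerset, Real.exp (4 * δ * (∑ x ∈ L, w x - (1/2) * ∑ x ∈ U, w x)) := by
    rw [← nsmul_eq_mul, ← Finset.sum_const]
    refine le_trans (Finset.sum_le_sum fun L hL => ?_) (Finset.sum_le_sum_of_subset_of_nonneg (Finset.filter_subset _ _)
      (fun _ _ _ => (Real.exp_pos _).le))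
    apply Real.exp_le_exp.2
    have h3 := (Finset.mem_filter.1 hL).2
    nlinarith only [h3, hδ]
  have h4 := h2.trans h1
  rw [← le_div_iff₀ (Real.exp_pos _)] at h4
  refine h4.trans (le_of_eq ?_)
  rw [mul_div_assoc, ← Real.exp_sub]
  congr 2
  ring

lemma two_pow_le (N : ℕ) : (2:ℝ) ^ N ≤ (N + 1) * N.choose (N / 2) := by
  have h : 2 ^ N ≤ (N + 1) * N.choose (N / 2) := by
    rw [← Nat.sum_range_choose N]
    calc _ ≤ ∑ m ∈ Finset.range (N + 1), N.choose (N / 2) := Finset.sum_le_sum fun m _ => Nat.choose_le_middle m N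
      _ = _ := by simp
  exact_mod_cast h

/-- concentration for random halves -/
lemma conc {I : Type*} (U : Finset V) (N : ℕ) (hN : #U = N) (hN0 : 0 < N) (S : Finset I) (w : I → V → ℝ)
    (hw : ∀ i ∈ S, ∀ x ∈ U, |w i x| ≤ 1) (δ : ℝ) (hδ : 0 ≤ δ)
    (hS : 2 * (#S : ℝ) * (N * (N + 1)) * Real.exp (-(2 * δ ^ 2 * N)) ≤ 1) :
    (1 - 1 / (N:ℝ)) * N.choose (N / 2) ≤ #((U.powersetCard (N / 2)).filter fun L =>
      ∀ i ∈ S, |∑ x ∈ L, w i x - (1/2) * ∑ x ∈ U, w i x| ≤ δ * N) := by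
  have hsub : U.powersetCard (N / 2) ⊆ ((U.powersetCard (N / 2)).filter fun L =>
      ∀ i ∈ S, |∑ x ∈ L, w i x - (1/2) * ∑ x ∈ U, w i x| ≤ δ * N) ∪
      S.biUnion fun i => (U.powerset.filter fun L => δ * #U < ∑ x ∈ L, w i x - (1/2) * ∑ x ∈ U, w i x) ∪
        (U.powerset.filter fun L => δ * #U < ∑ x ∈ L, (-w i x) - (1/2) * ∑ x ∈ U, (-w i x)) := by
    intro L hL
    by_cases h : ∀ i ∈ S, |∑ x ∈ L, w i x - (1/2) * ∑ x ∈ U, w i x| ≤ δ * N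
    · exact Finset.mem_union_left _ (Finset.mem_filter.2 ⟨hL, h⟩)
    · push Not at h
      obtain ⟨i, hi, h⟩ := h
      have hLU : L ∈ U.powerset := Finset.mem_powerset.2 (Finset.mem_powersetCard.1 hL).1
      refine Finset.mem_union_right _ (Finset.mem_biUnion.2 ⟨i, hi, ?_⟩)
      rcases lt_abs.1 h with h | h
      · exact Finset.mem_union_left _ (Finset.mem_filter.2 ⟨hLU, by rw [hN]; exact h⟩)
      · refine Finset.mem_union_right _ (Finset.mem_filter.2 ⟨hLU, ?_⟩)
        rw [hN, Finset.sum_neg_distrib, Finset.sum_neg_distrib]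
        linarith
  have h1 := (Finset.card_le_card hsub).trans ((Finset.card_union_le _ _).trans (Nat.add_le_add_left Finset.card_biUnion_le _))
  rw [Finset.card_powersetCard, hN] at h1
  have h2 : (N.choose (N / 2) : ℝ) ≤ #((U.powersetCard (N / 2)).filter fun L =>
      ∀ i ∈ S, |∑ x ∈ L, w i x - (1/2) * ∑ x ∈ U, w i x| ≤ δ * N) + ∑ i ∈ S, (#((U.powerset.filter fun L => δ * #U < ∑ x ∈ L, w i x - (1/2) * ∑ x ∈ U, w i x) ∪
        (U.powerset.filter fun L => δ * #U < ∑ x ∈ L, (-w i x) - (1/2) * ∑ x ∈ U, (-w i x))) : ℝ) := by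
    rw [hN]
    exact_mod_cast h1
  have h3 : ∑ i ∈ S, (#((U.powerset.filter fun L => δ * #U < ∑ x ∈ L, w i x - (1/2) * ∑ x ∈ U, w i x) ∪
        (U.powerset.filter fun L => δ * #U < ∑ x ∈ L, (-w i x) - (1/2) * ∑ x ∈ U, (-w i x))) : ℝ) ≤
      ∑ i ∈ S, 2 * (2 ^ N * Real.exp (-(2 * δ ^ 2 * N))) := by
    refine Finset.sum_le_sum fun i hi => ?_
    have e1 := half_bad U (w i) (hw i hi) δ hδ
    have e2 := half_bad U (fun x => - w i x) (fun x hx => by rw [abs_neg]; exact hw i hi x hx) δ hδ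
    rw [hN] at e1 e2
    rw [hN]
    refine le_trans (Nat.cast_le.2 (Finset.card_union_le _ _)) ?_
    push_cast
    linarith
  rw [Finset.sum_const, nsmul_eq_mul] at h3
  have h4 : (#S : ℝ) * (2 * (2 ^ N * Real.exp (-(2 * δ ^ 2 * N)))) ≤ 1 / N * N.choose (N / 2) := by
    have hNp : (0:ℝ) < N := by exact_mod_cast hN0
    have h5 := two_pow_le N
    have h6 : (#S : ℝ) * (2 * (2 ^ N * Real.exp (-(2 * δ ^ 2 * N)))) ≤
        (#S : ℝ) * (2 * (((N + 1) * N.choose (N / 2)) * Real.exp (-(2 * δ ^ 2 * N)))) := by gcongr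
    refine h6.trans ?_
    have h7 := mul_le_mul_of_nonneg_right hS (show (0:ℝ) ≤ N.choose (N / 2) / N by positivity)
    refine le_trans (le_of_eq ?_) (h7.trans (le_of_eq ?_))
    · field_simp
    · field_simp
  linarith

lemma cen_mono (n : ℕ) : (n + 1) * 2 * n.choose (n / 2) ≤ (n + 2) * (n + 1).choose ((n + 1) / 2) := by
  rcases Nat.even_or_odd' n with ⟨k, rfl | rfl⟩
  · have h1 : 2 * k / 2 = k := by omega
    have h2 : (2 * k + 1) / 2 = k := by omega
    rw [h1, h2]
    have h3 := Nat.add_one_mul_choose_eq (2 * k) k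
    have h4 : (2 * k + 1).choose (k + 1) = (2 * k + 1).choose k := by
      rw [← Nat.choose_symm_of_eq_add]; omega
    rw [h4] at h3
    nlinarith only [h3]
  · have h1 : (2 * k + 1) / 2 = k := by omega
    have h2 : (2 * k + 1 + 1) / 2 = k + 1 := by omega
    rw [h1, h2]
    have h4 : (2 * k + 1).choose (k + 1) = (2 * k + 1).choose k := by
      rw [← Nat.choose_symm_of_eq_add]; omega
    have h3 : (2 * k + 1 + 1).choose (k + 1) = 2 * (2 * k + 1).choose k := by
      rw [Nat.choose_succ_succ, h4]; ring
    rw [h3]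
    nlinarith only []

lemma cen_le (N j : ℕ) (hj : j ≤ N) : (N - j + 1 : ℕ) * 2 ^ j * (N - j).choose ((N - j) / 2) ≤ (N + 1) * N.choose (N / 2) := by
  induction j with
  | zero => simp
  | succ j ih =>
    obtain ⟨n, hn⟩ : ∃ n, n = N - (j + 1) := ⟨_, rfl⟩
    have h1 : N - j = n + 1 := by omega
    have h2 := ih (by omega)
    rw [h1] at h2
    rw [← hn]
    refine le_trans ?_ h2
    have h3 := Nat.mul_le_mul_left (2 ^ j) (cen_mono n)
    calc _ = 2 ^ j * ((n + 1) * 2 * n.choose (n / 2)) := by rw [pow_succ]; ring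
      _ ≤ _ := h3
      _ = _ := by ring

lemma ratio_le (N j : ℕ) (hN : 0 < N) (hj : j ≤ N) :
    ((N:ℝ) + 1) ≤ (N - j + 1) * Real.exp (j * (Real.log (N + 1) / N)) := by
  have hNp : (0:ℝ) < N := by exact_mod_cast hN
  have hjN : (j:ℝ) ≤ N := by exact_mod_cast hj
  have h := Real.geom_mean_le_arith_mean2_weighted (w₁ := 1 - j / N) (w₂ := j / N) (p₁ := N + 1) (p₂ := 1)
    (by rw [sub_nonneg, div_le_one hNp]; exact hjN) (by positivity) (by positivity) (by norm_num) (by ring)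
  rw [Real.one_rpow, mul_one, mul_one, Real.rpow_def_of_pos (by positivity)] at h
  have h2 : (1 - (j:ℝ) / N) * (N + 1) + j / N = N - j + 1 := by field_simp; ring
  rw [h2] at h
  have h3 := mul_le_mul_of_nonneg_right h (Real.exp_pos (j * (Real.log (N + 1) / N))).le
  refine le_trans (le_of_eq ?_) h3
  rw [← Real.exp_add]
  have h4 : Real.log (N + 1) * (1 - (j:ℝ) / N) + j * (Real.log (N + 1) / N) = Real.log (N + 1) := by ring
  rw [h4, Real.exp_log (by positivity)]

/-- number of halves with prescribed trace -/
lemma trace_count (U M P : Finset V) (N j : ℕ) (hN : #U = N) (hN0 : 0 < N) (hM : M ⊆ U) (hj : #M = j) :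
    (#((U.powersetCard (N / 2)).filter fun L => L ∩ M = P) : ℝ) ≤
      N.choose (N / 2) * ((1/2) ^ j * Real.exp (j * (Real.log (N + 1) / N))) := by
  have hjN : j ≤ N := by rw [← hj, ← hN]; exact Finset.card_le_card hM
  have h1 : #((U.powersetCard (N / 2)).filter fun L => L ∩ M = P) ≤ (N - j).choose ((N - j) / 2) := by
    have h2 : #((U.powersetCard (N / 2)).filter fun L => L ∩ M = P) ≤ #((U \ M).powersetCard (N / 2 - #P)) := by
      apply Finset.card_le_card_of_injOn (fun L => L \ M)
      · intro L hL
        have hL := Finset.mem_filter.1 (Finset.mem_coe.1 hL)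
        have hL1 := Finset.mem_powersetCard.1 hL.1
        rw [Finset.mem_coe, Finset.mem_powersetCard]
        refine ⟨Finset.sdiff_subset_sdiff hL1.1 le_rfl, ?_⟩
        have h3 := Finset.card_sdiff_add_card_inter L M
        rw [hL.2, hL1.2] at h3
        show #(L \ M) = N / 2 - #P
        omega
      · intro L hL L' hL' e
        have hL := (Finset.mem_filter.1 (Finset.mem_coe.1 hL)).2
        have hL' := (Finset.mem_filter.1 (Finset.mem_coe.1 hL')).2
        simp only at e
        rw [← Finset.sdiff_union_inter L M, ← Finset.sdiff_union_inter L' M, e, hL, hL']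
    refine h2.trans ?_
    rw [Finset.card_powersetCard, Finset.card_sdiff_of_subset hM, hN, hj]
    exact Nat.choose_le_middle _ _
  have h2 : ((N - j + 1 : ℝ)) * 2 ^ j * (N - j).choose ((N - j) / 2) ≤ (N + 1) * N.choose (N / 2) := by
    have := cen_le N j hjN
    have h3 : (((N - j + 1 : ℕ) * 2 ^ j * (N - j).choose ((N - j) / 2) : ℕ) : ℝ) ≤ (((N + 1) * N.choose (N / 2) : ℕ) : ℝ) := by
      exact_mod_cast this
    push_cast [Nat.cast_sub hjN] at h3
    exact h3
  have h3 := ratio_le N j hN0 hjN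
  have h5 : (0:ℝ) < N - j + 1 := by
    have : (j:ℝ) ≤ N := by exact_mod_cast hjN
    linarith
  have h4 : ((N - j).choose ((N - j) / 2) : ℝ) ≤ N.choose (N / 2) * ((1/2) ^ j * Real.exp (j * (Real.log (N + 1) / N))) := by
    have h6 := h2.trans (mul_le_mul_of_nonneg_right h3 (Nat.cast_nonneg (N.choose (N / 2))))
    have h7 : (N - j + 1 : ℝ) * (2 ^ j * (N - j).choose ((N - j) / 2)) ≤ (N - j + 1) * (Real.exp (j * (Real.log (N + 1) / N)) * N.choose (N / 2)) := by
      linarith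
    have h8 := le_of_mul_le_mul_left h7 h5
    rw [one_div, inv_pow]
    have h9 : (0:ℝ) < 2 ^ j := by positivity
    calc ((N - j).choose ((N - j) / 2) : ℝ) = ((2:ℝ) ^ j)⁻¹ * (2 ^ j * (N - j).choose ((N - j) / 2)) := by field_simp
      _ ≤ ((2:ℝ) ^ j)⁻¹ * (Real.exp (j * (Real.log (N + 1) / N)) * N.choose (N / 2)) := by gcongr
      _ = _ := by ring
  refine le_trans ?_ h4
  exact_mod_cast h1
end PartD1
end KF

namespace KF
set_option linter.unusedSectionVars false
set_option linter.unusedSimpArgs false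
set_option linter.unusedVariables false
section PartD2
variable {V ι : Type} [Fintype V] [Fintype ι]

/-- fixed data -/
structure Adm (adj : ι → ι → V → V → Prop) (d : ι → ι → ℝ) (θ : ℝ) : Prop where
  symm : ∀ a b u v, adj a b u v → adj b a v u
  refl : ∀ a u v, adj a a u v
  dl : ∀ a b, θ ≤ d a b
  du : ∀ a b, d a b ≤ 1

/-- codegree discrepancy -/
noncomputable def cd (adj : ι → ι → V → V → Prop) (d : ι → ι → ℝ) (T : Finset V) (a b : ι) (u u' : V) : ℝ :=
  |∑ v ∈ T, (ind (adj a b u v) - d a b) * (ind (adj a b u' v) - d a b)|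

/-- good slot families -/
structure Good (adj : ι → ι → V → V → Prop) (d : ι → ι → ℝ) (U : ι → Finset V) (N : ℕ) (θ ε : ℝ) : Prop where
  disj : ∀ a b, a ≠ b → Disjoint (U a) (U b)
  card : ∀ a, #(U a) = N
  deg : ∀ a b, ∀ u ∈ U a, θ * N ≤ ∑ v ∈ U b, ind (adj a b u v)
  cut : ∀ a b, ∑ u ∈ U a, ∑ u' ∈ U a, cd adj d (U b) a b u u' ≤ ε * (N : ℝ) ^ 3

lemma Good.mono {adj : ι → ι → V → V → Prop} {d : ι → ι → ℝ} {U : ι → Finset V} {N : ℕ} {θ ε θ' ε' : ℝ}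
    (h : Good adj d U N θ ε) (h1 : θ' ≤ θ) (h2 : ε ≤ ε') : Good adj d U N θ' ε' where
  disj := h.disj
  card := h.card
  deg := fun a b u hu => (mul_le_mul_of_nonneg_right h1 (Nat.cast_nonneg _)).trans (h.deg a b u hu)
  cut := fun a b => (h.cut a b).trans (mul_le_mul_of_nonneg_right h2 (by positivity))

lemma gg_le {adj : ι → ι → V → V → Prop} {d : ι → ι → ℝ} {θ : ℝ} (hA : Adm adj d θ) (hθ : 0 ≤ θ) (a b : ι) (u u' v : V) :
    |(ind (adj a b u v) - d a b) * (ind (adj a b u' v) - d a b)| ≤ 1 := by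
  have h1 : ∀ w, |ind (adj a b w v) - d a b| ≤ 1 := by
    intro w
    have e1 := ind_nonneg (adj a b w v)
    have e2 := ind_le_one (adj a b w v)
    have e3 := hθ.trans (hA.dl a b)
    have e4 := hA.du a b
    rw [abs_le]; constructor <;> linarith
  rw [abs_mul]
  exact mul_le_one₀ (h1 u) (abs_nonneg _) (h1 u')

lemma cd_nonneg (adj : ι → ι → V → V → Prop) (d : ι → ι → ℝ) (T : Finset V) (a b : ι) (u u' : V) : 0 ≤ cd adj d T a b u u' := abs_nonneg _

lemma cd_le {adj : ι → ι → V → V → Prop} {d : ι → ι → ℝ} {θ : ℝ} (hA : Adm adj d θ) (hθ : 0 ≤ θ) (T : Finset V) (a b : ι) (u u' : V) :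
    cd adj d T a b u u' ≤ #T := by
  unfold cd
  refine (Finset.abs_sum_le_sum_abs _ _).trans ?_
  refine (Finset.sum_le_sum fun v _ => gg_le hA hθ a b u u' v).trans ?_
  simp

/-- test weights on slot `b` -/
noncomputable def tw (adj : ι → ι → V → V → Prop) (d : ι → ι → ℝ) (U : ι → Finset V) (N : ℕ) (b : ι) (i : Fin 4 × ι × V × V) (v : V) : ℝ :=
  if i.1 = 0 then ind (adj i.2.1 b i.2.2.1 v)
  else if i.1 = 1 then (ind (adj i.2.1 b i.2.2.1 v) - d i.2.1 b) * (ind (adj i.2.1 b i.2.2.2 v) - d i.2.1 b)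
  else if i.1 = 2 then cd adj d (U i.2.1) b i.2.1 i.2.2.1 v / N
  else (∑ u' ∈ U b, cd adj d (U i.2.1) b i.2.1 v u') / (N:ℝ) ^ 2

lemma tw_le {adj : ι → ι → V → V → Prop} {d : ι → ι → ℝ} {θ : ℝ} (hA : Adm adj d θ) (hθ : 0 ≤ θ) (U : ι → Finset V) (N : ℕ) (hN : 0 < N)
    (hU : ∀ a, #(U a) = N) (b : ι) (i : Fin 4 × ι × V × V) (v : V) : |tw adj d U N b i v| ≤ 1 := by
  have hNp : (0:ℝ) < N := by exact_mod_cast hN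
  unfold tw
  split_ifs
  · rw [abs_le]
    have e1 := ind_nonneg (adj i.2.1 b i.2.2.1 v)
    have e2 := ind_le_one (adj i.2.1 b i.2.2.1 v)
    constructor <;> linarith
  · exact gg_le hA hθ _ _ _ _ _
  · rw [abs_of_nonneg (div_nonneg (cd_nonneg _ _ _ _ _ _ _) hNp.le), div_le_one hNp, ← hU i.2.1]
    exact cd_le hA hθ _ _ _ _ _
  · rw [abs_of_nonneg (div_nonneg (Finset.sum_nonneg fun _ _ => cd_nonneg _ _ _ _ _ _ _) (by positivity)), div_le_one (by positivity)]
    calc _ ≤ ∑ u' ∈ U b, (N:ℝ) := Finset.sum_le_sum fun u' _ => by rw [← hU i.2.1]; exact cd_le hA hθ _ _ _ _ _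
      _ = _ := by rw [Finset.sum_const, hU]; simp; ring

lemma good_side {adj : ι → ι → V → V → Prop} {d : ι → ι → ℝ} {θ0 θ ε : ℝ} (hA : Adm adj d θ0) (hθ0 : 0 ≤ θ0) {U : ι → Finset V} {N M : ℕ}
    (hG : Good adj d U N θ ε) (hθ : 0 ≤ θ) (hθ1 : θ ≤ 1) (hε : 0 ≤ ε) (hε1 : ε ≤ 1) (δ : ℝ) (hδ0 : 0 < δ) (hδθ : 3 * δ ≤ θ) (hδ : 1 ≤ δ * N)
    (hM : 10 ≤ M) (hM1 : 2 * M ≤ N + 1) (hM2 : N ≤ 2 * M + 1) (S : ι → Finset V) (hS : ∀ b, S b ⊆ U b) (hSc : ∀ b, #(S b) = M)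
    (hc : ∀ b, ∀ i : Fin 4 × ι × V × V, (∃ a, i.2.2.1 ∈ U a) → (∃ a, i.2.2.2 ∈ U a) →
      |∑ x ∈ S b, tw adj d U N b i x - (1/2) * ∑ x ∈ U b, tw adj d U N b i x| ≤ δ * N) :
    Good adj d S M (θ - 3 * δ) (ε + 40 * δ) := by
  have hM1' : 2 * (M:ℝ) ≤ N + 1 := by exact_mod_cast hM1
  have hM2' : (N:ℝ) ≤ 2 * M + 1 := by exact_mod_cast hM2
  have hM' : (10:ℝ) ≤ M := by exact_mod_cast hM
  have hNp : (0:ℝ) < N := by linarith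
  refine ⟨fun a b h => (hG.disj a b h).mono (hS a) (hS b), hSc, ?_, ?_⟩
  · intro a b u hu
    have h1 := hc b (0, a, u, u) ⟨a, hS a hu⟩ ⟨a, hS a hu⟩
    simp only [tw, if_true] at h1
    have h2 := (abs_le.1 h1).1
    have h3 := hG.deg a b u (hS a hu)
    have h4 : (θ - 3 * δ) * (2 * M) ≤ (θ - 3 * δ) * (N + 1) := mul_le_mul_of_nonneg_left hM1' (by linarith)
    nlinarith only [h2, h3, h4, hδ, hθ1, hδ0]
  · intro a b
    have hU : ∀ u ∈ S a, ∃ a, u ∈ U a := fun u hu => ⟨a, hS a hu⟩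
    -- step 1
    have s1 : ∀ u ∈ S a, ∀ u' ∈ S a, cd adj d (S b) a b u u' ≤ (1/2) * cd adj d (U b) a b u u' + δ * N := by
      intro u hu u' hu'
      have h1 := hc b (1, a, u, u') (hU u hu) (hU u' hu')
      simp only [tw, if_true, one_ne_zero, if_false] at h1
      unfold cd
      have h2 := abs_add_le (∑ x ∈ S b, (ind (adj a b u x) - d a b) * (ind (adj a b u' x) - d a b) -
        (1/2) * ∑ x ∈ U b, (ind (adj a b u x) - d a b) * (ind (adj a b u' x) - d a b))
        ((1/2) * ∑ x ∈ U b, (ind (adj a b u x) - d a b) * (ind (adj a b u' x) - d a b))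
      rw [sub_add_cancel, abs_mul, abs_of_pos (show (0:ℝ) < 1/2 by norm_num)] at h2
      linarith
    -- step 2
    have s2 : ∀ u ∈ S a, ∑ u' ∈ S a, cd adj d (U b) a b u u' ≤ (1/2) * ∑ u' ∈ U a, cd adj d (U b) a b u u' + δ * N ^ 2 := by
      intro u hu
      have h1 := hc a (2, b, u, u) (hU u hu) (hU u hu)
      simp only [tw, show (2 : Fin 4) ≠ 0 by decide, show (2 : Fin 4) ≠ 1 by decide, if_true, if_false] at h1
      have h2 := (abs_le.1 h1).2
      rw [← Finset.sum_div, ← Finset.sum_div] at h2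
      have h3 := mul_le_mul_of_nonneg_right h2 hNp.le
      have h4 : (∑ x ∈ S a, cd adj d (U b) a b u x / N) * N = ∑ x ∈ S a, cd adj d (U b) a b u x := by
        rw [← Finset.sum_div]; field_simp
      have e : ((∑ i ∈ S a, cd adj d (U b) a b u i) / N - 1 / 2 * ((∑ i ∈ U a, cd adj d (U b) a b u i) / N)) * N =
        (∑ i ∈ S a, cd adj d (U b) a b u i) - 1/2 * (∑ i ∈ U a, cd adj d (U b) a b u i) := by field_simp
      rw [e] at h3
      nlinarith only [h3]
    have s3 : ∑ u ∈ S a, ∑ u' ∈ U a, cd adj d (U b) a b u u' ≤ (1/2) * ∑ u ∈ U a, ∑ u' ∈ U a, cd adj d (U b) a b u u' + δ * N ^ 3 := by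
      obtain ⟨u, hu⟩ : ∃ u, u ∈ S a := Finset.card_pos.1 (by rw [hSc]; omega)
      have h1 := hc a (3, b, u, u) (hU u hu) (hU u hu)
      simp only [tw, show (3 : Fin 4) ≠ 0 by decide, show (3 : Fin 4) ≠ 1 by decide, show (3 : Fin 4) ≠ 2 by decide, if_false] at h1
      have h2 := (abs_le.1 h1).2
      rw [← Finset.sum_div, ← Finset.sum_div] at h2
      have h3 := mul_le_mul_of_nonneg_right h2 (show (0:ℝ) ≤ N ^ 2 by positivity)
      have e : ((∑ u ∈ S a, ∑ u' ∈ U a, cd adj d (U b) a b u u') / (N:ℝ) ^ 2 - 1 / 2 * ((∑ u ∈ U a, ∑ u' ∈ U a, cd adj d (U b) a b u u') / (N:ℝ) ^ 2)) * (N:ℝ) ^ 2 =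
        (∑ u ∈ S a, ∑ u' ∈ U a, cd adj d (U b) a b u u') - 1/2 * (∑ u ∈ U a, ∑ u' ∈ U a, cd adj d (U b) a b u u') := by field_simp
      rw [e] at h3
      nlinarith only [h3]
    have s4 := hG.cut a b
    have t1 : ∑ u ∈ S a, ∑ u' ∈ S a, cd adj d (S b) a b u u' ≤
        ∑ u ∈ S a, ((1/2) * ((1/2) * ∑ u' ∈ U a, cd adj d (U b) a b u u' + δ * N ^ 2) + M * (δ * N)) := by
      refine Finset.sum_le_sum fun u hu => ?_
      refine (Finset.sum_le_sum fun u' hu' => s1 u hu u' hu').trans ?_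
      rw [Finset.sum_add_distrib, ← Finset.mul_sum, Finset.sum_const, hSc, nsmul_eq_mul]
      have := s2 u hu
      linarith
    have t2 : ∑ u ∈ S a, ((1/2) * ((1/2) * ∑ u' ∈ U a, cd adj d (U b) a b u u' + δ * N ^ 2) + M * (δ * N)) =
        (1/4) * ∑ u ∈ S a, ∑ u' ∈ U a, cd adj d (U b) a b u u' + M * ((1/2) * (δ * N ^ 2) + M * (δ * N)) := by
      rw [Finset.mul_sum]
      have : ∀ u ∈ S a, ((1/2) * ((1/2) * ∑ u' ∈ U a, cd adj d (U b) a b u u' + δ * (N:ℝ) ^ 2) + M * (δ * N)) =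
        (1/4) * (∑ u' ∈ U a, cd adj d (U b) a b u u') + ((1/2) * (δ * (N:ℝ) ^ 2) + M * (δ * N)) := fun u _ => by ring
      rw [Finset.sum_congr rfl this, Finset.sum_add_distrib, Finset.sum_const, hSc, nsmul_eq_mul]
    rw [t2] at t1
    refine t1.trans ?_
    have hx : (N:ℝ) ≤ 2 * M + 1 := hM2'
    have hMN : (M:ℝ) ≤ N := by linarith
    have c1 : (M:ℝ) * ((1/2) * (δ * N ^ 2) + M * (δ * N)) ≤ (3/2) * (δ * (N:ℝ) ^ 3) := by
      have e1 : (M:ℝ) * (δ * N ^ 2) ≤ N * (δ * N ^ 2) := mul_le_mul_of_nonneg_right hMN (by positivity)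
      have e2 : (M:ℝ) * M * (δ * N) ≤ N * N * (δ * N) := mul_le_mul_of_nonneg_right (mul_le_mul hMN hMN (by positivity) hNp.le) (by positivity)
      nlinarith only [e1, e2]
    have c2 : (N:ℝ) ^ 3 ≤ 8 * (M:ℝ) ^ 3 + 15 * (M:ℝ) ^ 2 := by
      calc (N:ℝ) ^ 3 ≤ (2 * M + 1) ^ 3 := by gcongr
        _ ≤ _ := by nlinarith only [hM']
    have c3 : (M:ℝ) ^ 2 ≤ 3 * δ * (M:ℝ) ^ 3 := by
      have : 1 ≤ 3 * δ * M := by nlinarith only [hδ, hM2', hM', hδ0]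
      nlinarith only [this, sq_nonneg (M:ℝ), mul_le_mul_of_nonneg_right this (sq_nonneg (M:ℝ))]
    have c4 : (N:ℝ) ^ 3 ≤ 10 * (M:ℝ) ^ 3 := by nlinarith only [c2, hM', sq_nonneg (M:ℝ), mul_le_mul_of_nonneg_right hM' (sq_nonneg (M:ℝ))]
    have c5 : ε * (N:ℝ) ^ 3 ≤ ε * (8 * (M:ℝ) ^ 3) + 15 * (M:ℝ) ^ 2 := by
      have e1 := mul_le_mul_of_nonneg_left c2 hε
      have e2 : ε * (15 * (M:ℝ) ^ 2) ≤ 1 * (15 * (M:ℝ) ^ 2) := mul_le_mul_of_nonneg_right hε1 (by positivity)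
      nlinarith only [e1, e2]
    have c6 : δ * (N:ℝ) ^ 3 ≤ δ * (10 * (M:ℝ) ^ 3) := mul_le_mul_of_nonneg_left c4 hδ0.le
    have c7 : 0 ≤ δ * (M:ℝ) ^ 3 := by positivity
    nlinarith only [c1, c3, c5, c6, s3, s4, c7]
end PartD2
end KF

namespace KF
set_option linter.unusedSectionVars false
set_option linter.unusedSimpArgs false
set_option linter.unusedVariables false
section PartD3
variable {V ι : Type} [Fintype V] [Fintype ι]

/-- `v` lies in the family -/
def inF (U : ι → Finset V) (v : V) : Prop := ∃ a, v ∈ U a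

lemma same_count (U : ι → Finset V) (N : ℕ) (hN : 0 < N) (hdis : ∀ a b, a ≠ b → Disjoint (U a) (U b))
    (hc : ∀ a, #(U a) = N) (D : Finset V) (f : V → V)
    (hD : ∀ x ∈ D, inF U x ∧ f x ∉ D ∧ inF U (f x)) :
    ((#((Fintype.piFinset fun b => (U b).powersetCard (N / 2)).filter fun L => ∀ x ∈ D, inF L x ↔ inF L (f x)) : ℕ) : ℝ)
      ≤ ((N.choose (N / 2) : ℕ) : ℝ) ^ Fintype.card ι * (1 / 2 * Real.exp (2 * (Real.log (N + 1) / N))) ^ #D := by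
  obtain ⟨c, hcc⟩ : ∃ c, c = Real.log (N + 1) / N := ⟨_, rfl⟩
  have hc0 : 0 ≤ c := by
    rw [hcc]; apply div_nonneg (Real.log_nonneg (by have : (0:ℝ) ≤ N := Nat.cast_nonneg _; linarith)) (Nat.cast_nonneg _)
  obtain ⟨R, hR⟩ : ∃ R, R = D.image f := ⟨_, rfl⟩
  have hRD : Disjoint D R := by
    rw [hR, Finset.disjoint_left]
    intro x hx hx2
    obtain ⟨y, hy, rfl⟩ := mem_image.1 hx2
    exact (hD y hy).2.1 hx
  have hRc : #R ≤ #D := by rw [hR]; exact card_image_le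
  have hRU : ∀ x ∈ R, inF U x := by
    intro x hx
    rw [hR] at hx
    obtain ⟨y, hy, rfl⟩ := mem_image.1 hx
    exact (hD y hy).2.2
  obtain ⟨M, hM⟩ : ∃ M : ι → Finset V, M = fun b => (D ∪ R) ∩ U b := ⟨_, rfl⟩
  obtain ⟨Q, hQ⟩ : ∃ Q : Finset V → ι → Finset V, Q = fun P b => (M b).filter fun x => x ∈ P ∨ (x ∈ D ∧ f x ∈ P) := ⟨_, rfl⟩
  have hsub : ((Fintype.piFinset fun b => (U b).powersetCard (N / 2)).filter fun L => ∀ x ∈ D, inF L x ↔ inF L (f x)) ⊆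
      R.powerset.biUnion fun P => Fintype.piFinset fun b => ((U b).powersetCard (N / 2)).filter fun L => L ∩ M b = Q P b := by
    intro L hL
    rw [mem_filter, Fintype.mem_piFinset] at hL
    obtain ⟨hL1, hL2⟩ := hL
    rw [mem_biUnion]
    refine ⟨R.filter fun x => inF L x, by rw [mem_powerset]; exact filter_subset _ _, ?_⟩
    rw [Fintype.mem_piFinset]
    intro b
    rw [mem_filter]
    refine ⟨hL1 b, ?_⟩
    have key : ∀ x ∈ U b, (x ∈ L b ↔ inF L x) := by
      intro x hx
      constructor
      · intro h; exact ⟨b, h⟩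
      · rintro ⟨a, ha⟩
        by_cases hab : a = b
        · rw [← hab]; exact ha
        · exfalso
          have := (mem_powersetCard.1 (hL1 a)).1 ha
          exact (Finset.disjoint_left.1 (hdis a b hab)) this hx
    rw [hQ, hM]
    ext x
    simp only [mem_inter, mem_filter, mem_union]
    constructor
    · rintro ⟨h1, h2, h3⟩
      refine ⟨⟨h2, h3⟩, ?_⟩
      rcases h2 with h2 | h2
      · right
        refine ⟨h2, ?_, (hL2 x h2).1 ((key x h3).1 h1)⟩
        rw [hR]; exact mem_image_of_mem _ h2
      · left; exact ⟨h2, (key x h3).1 h1⟩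
    · rintro ⟨⟨h2, h3⟩, h4⟩
      refine ⟨?_, h2, h3⟩
      rw [key x h3]
      rcases h4 with h4 | h4
      · exact h4.2
      · exact (hL2 x h4.1).2 h4.2.2
  have hsum : ∑ b, #(M b) = #D + #R := by
    rw [← card_union_of_disjoint hRD]
    rw [← card_biUnion]
    · congr 1
      ext x
      simp only [mem_biUnion, mem_univ, true_and, hM, mem_inter]
      constructor
      · rintro ⟨a, h, _⟩; exact h
      · intro h
        have : inF U x := by
          rcases mem_union.1 h with h | h
          · exact (hD x h).1
          · exact hRU x h
        obtain ⟨a, ha⟩ := this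
        exact ⟨a, h, ha⟩
    · intro a _ b _ hab
      rw [hM]
      exact (hdis a b hab).mono inter_subset_right inter_subset_right
  have hone : ∀ P ∈ R.powerset, ((#(Fintype.piFinset fun b => ((U b).powersetCard (N / 2)).filter fun L => L ∩ M b = Q P b) : ℕ) : ℝ)
      ≤ ((N.choose (N / 2) : ℕ) : ℝ) ^ Fintype.card ι * ((1/2) ^ (#D + #R) * Real.exp ((#D + #R : ℕ) * c)) := by
    intro P _
    rw [Fintype.card_piFinset]
    push_cast
    calc _ ≤ ∏ b : ι, (((N.choose (N/2) : ℕ) : ℝ) * ((1/2) ^ (#(M b)) * Real.exp ((#(M b) : ℕ) * c))) := by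
          apply prod_le_prod
          · intro i _; exact Nat.cast_nonneg _
          · intro b _
            have := trace_count (U b) (M b) (Q P b) N (#(M b)) (hc b) hN (by rw [hM]; exact inter_subset_right) rfl
            rw [hcc]
            exact this
      _ = _ := by
          rw [prod_mul_distrib, prod_mul_distrib, prod_const, card_univ, prod_pow_eq_pow_sum, hsum, ← Real.exp_sum, ← sum_mul]
          rw [← Nat.cast_sum, hsum]
          push_cast
          rfl
  calc _ ≤ ((∑ P ∈ R.powerset, #(Fintype.piFinset fun b => ((U b).powersetCard (N / 2)).filter fun L => L ∩ M b = Q P b) : ℕ) : ℝ) := by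
        exact_mod_cast (card_le_card hsub).trans card_biUnion_le
    _ ≤ ∑ P ∈ R.powerset, ((N.choose (N / 2) : ℕ) : ℝ) ^ Fintype.card ι * ((1/2) ^ (#D + #R) * Real.exp ((#D + #R : ℕ) * c)) := by
        rw [Nat.cast_sum]
        exact sum_le_sum hone
    _ = ((N.choose (N / 2) : ℕ) : ℝ) ^ Fintype.card ι * ((1/2) ^ (#D) * Real.exp ((#D + #R : ℕ) * c)) := by
        rw [sum_const, card_powerset, nsmul_eq_mul, pow_add]
        push_cast
        have : (2:ℝ) ^ #R * (1/2) ^ #R = 1 := by rw [← mul_pow]; norm_num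
        linear_combination (((N.choose (N / 2) : ℕ) : ℝ) ^ Fintype.card ι * ((1/2) ^ (#D) * Real.exp ((#D + #R : ℝ) * c))) * this
    _ ≤ _ := by
        rw [mul_pow, ← Real.exp_nat_mul, ← hcc]
        apply mul_le_mul_of_nonneg_left _ (by positivity)
        apply mul_le_mul_of_nonneg_left _ (by positivity)
        apply Real.exp_le_exp.2
        have : ((#R : ℕ) : ℝ) ≤ #D := by exact_mod_cast hRc
        push_cast
        nlinarith only [this, hc0]

/-- perfect tilings -/
def Perf (adj : ι → ι → V → V → Prop) (U : ι → Finset V) (T : V → ι → V) : Prop :=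
  ∀ a, ∀ v ∈ U a, vld adj (T v) ∧ (∀ b, T v b ∈ U b) ∧ T v a = v ∧ ∀ b, T (T v b) = T v

/-- spread distributions on perfect tilings -/
def SPR (adj : ι → ι → V → V → Prop) (U : ι → Finset V) (κ : ℝ) : Prop :=
  ∃ (Ω : Type) (_ : Fintype Ω) (μ : Ω → ℝ) (T : Ω → V → ι → V), (∀ ω, 0 ≤ μ ω) ∧ ∑ ω, μ ω = 1 ∧
    (∀ ω, Perf adj U (T ω)) ∧ ∀ (D : Finset V) (f : V → V), (∀ x ∈ D, inF U x ∧ f x ∉ D ∧ inF U (f x)) →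
      ∑ ω, μ ω * ind (∀ x ∈ D, T ω x = T ω (f x)) ≤ κ ^ #D

lemma SPR.mono {adj : ι → ι → V → V → Prop} {U : ι → Finset V} {κ κ' : ℝ} (h : SPR adj U κ) (h0 : 0 ≤ κ) (hk : κ ≤ κ') :
    SPR adj U κ' := by
  obtain ⟨Ω, i, μ, T, h1, h2, h3, h4⟩ := h
  exact ⟨Ω, i, μ, T, h1, h2, h3, fun D f hD => (h4 D f hD).trans (pow_le_pow_left₀ h0 hk _)⟩

/-- gluing two tilings -/
noncomputable def glue (L : ι → Finset V) (T0 T1 : V → ι → V) (v : V) : ι → V :=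
  if inF L v then T0 v else T1 v

lemma glue_perf {adj : ι → ι → V → V → Prop} {U L : ι → Finset V} (hdis : ∀ a b, a ≠ b → Disjoint (U a) (U b))
    (hL : ∀ b, L b ⊆ U b) {T0 T1 : V → ι → V} (h0 : Perf adj L T0) (h1 : Perf adj (fun b => U b \ L b) T1) :
    Perf adj U (glue L T0 T1) := by
  have key : ∀ b, ∀ v ∈ U b \ L b, ¬ inF L v := by
    rintro b v hv ⟨a, ha⟩
    rw [mem_sdiff] at hv
    by_cases hab : a = b
    · exact hv.2 (hab ▸ ha)
    · exact Finset.disjoint_left.1 (hdis a b hab) (hL a ha) hv.1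
  intro a v hv
  by_cases hin : v ∈ L a
  · obtain ⟨k1, k2, k3, k4⟩ := h0 a v hin
    have e : glue L T0 T1 v = T0 v := if_pos ⟨a, hin⟩
    rw [e]
    refine ⟨k1, fun b => hL b (k2 b), k3, fun b => ?_⟩
    have : inF L (T0 v b) := ⟨b, k2 b⟩
    refine Eq.trans ?_ (k4 b)
    exact if_pos this
  · have hv' : v ∈ U a \ L a := mem_sdiff.2 ⟨hv, hin⟩
    obtain ⟨k1, k2, k3, k4⟩ := h1 a v hv'
    have e : glue L T0 T1 v = T1 v := if_neg (key a v hv')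
    rw [e]
    refine ⟨k1, fun b => (mem_sdiff.1 (k2 b)).1, k3, fun b => ?_⟩
    have : ¬ inF L (T1 v b) := key b _ (k2 b)
    refine Eq.trans ?_ (k4 b)
    exact if_neg this

/-- gluing keeps tiles on one side -/
lemma glue_same {adj : ι → ι → V → V → Prop} {U L : ι → Finset V} (hdis : ∀ a b, a ≠ b → Disjoint (U a) (U b))
    (hL : ∀ b, L b ⊆ U b) {T0 T1 : V → ι → V} (h0 : Perf adj L T0) (h1 : Perf adj (fun b => U b \ L b) T1)
    {x y : V} (hx : inF U x) (hy : inF U y) (h : glue L T0 T1 x = glue L T0 T1 y) : inF L x → inF L y := by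
  rintro ⟨a, ha⟩
  by_contra hn
  have e1 : glue L T0 T1 x = T0 x := if_pos ⟨a, ha⟩
  have e2 : glue L T0 T1 y = T1 y := if_neg hn
  rw [e1, e2] at h
  obtain ⟨c, hc⟩ := hy
  have hyc : y ∈ U c \ L c := mem_sdiff.2 ⟨hc, fun h => hn ⟨c, h⟩⟩
  have k1 := (h0 a x ha).2.1 a
  have k2 := (h1 c y hyc).2.1 a
  rw [h] at k1
  exact (mem_sdiff.1 k2).2 k1

lemma glue_one {adj : ι → ι → V → V → Prop} {U L : ι → Finset V} (hdis : ∀ a b, a ≠ b → Disjoint (U a) (U b))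
    (hL : ∀ b, L b ⊆ U b) {Ω0 Ω1 : Type} [Fintype Ω0] [Fintype Ω1] (μ0 : Ω0 → ℝ) (μ1 : Ω1 → ℝ) (T0 : Ω0 → V → ι → V) (T1 : Ω1 → V → ι → V)
    (m0 : ∀ ω, 0 ≤ μ0 ω) (m1 : ∀ ω, 0 ≤ μ1 ω) (h0 : ∀ ω, Perf adj L (T0 ω)) (h1 : ∀ ω, Perf adj (fun b => U b \ L b) (T1 ω)) {κ : ℝ} (hκ : 0 ≤ κ)
    (s0 : ∀ (D : Finset V) (f : V → V), (∀ x ∈ D, inF L x ∧ f x ∉ D ∧ inF L (f x)) →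
      ∑ ω, μ0 ω * ind (∀ x ∈ D, T0 ω x = T0 ω (f x)) ≤ κ ^ #D)
    (s1 : ∀ (D : Finset V) (f : V → V), (∀ x ∈ D, inF (fun b => U b \ L b) x ∧ f x ∉ D ∧ inF (fun b => U b \ L b) (f x)) →
      ∑ ω, μ1 ω * ind (∀ x ∈ D, T1 ω x = T1 ω (f x)) ≤ κ ^ #D)
    (D : Finset V) (f : V → V) (hD : ∀ x ∈ D, inF U x ∧ f x ∉ D ∧ inF U (f x)) :
    ∑ ω : Ω0 × Ω1, μ0 ω.1 * μ1 ω.2 * ind (∀ x ∈ D, glue L (T0 ω.1) (T1 ω.2) x = glue L (T0 ω.1) (T1 ω.2) (f x))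
      ≤ ind (∀ x ∈ D, inF L x ↔ inF L (f x)) * κ ^ #D := by
  by_cases hs : ∀ x ∈ D, inF L x ↔ inF L (f x)
  · rw [ind_true hs, one_mul]
    have hout : ∀ x, inF U x → ¬ inF L x → inF (fun b => U b \ L b) x := by
      rintro x ⟨a, ha⟩ h
      exact ⟨a, mem_sdiff.2 ⟨ha, fun h' => h ⟨a, h'⟩⟩⟩
    have b0 := s0 (D.filter fun x => inF L x) f (by
      intro x hx
      rw [mem_filter] at hx
      exact ⟨hx.2, fun h => (hD x hx.1).2.1 (mem_filter.1 h).1, (hs x hx.1).1 hx.2⟩)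
    have b1 := s1 (D.filter fun x => ¬ inF L x) f (by
      intro x hx
      rw [mem_filter] at hx
      exact ⟨hout x (hD x hx.1).1 hx.2, fun h => (hD x hx.1).2.1 (mem_filter.1 h).1, hout _ (hD x hx.1).2.2 (fun h => hx.2 ((hs x hx.1).2 h))⟩)
    have hcard : #(D.filter fun x => inF L x) + #(D.filter fun x => ¬ inF L x) = #D := card_filter_add_card_filter_not _
    calc _ ≤ ∑ ω : Ω0 × Ω1, (μ0 ω.1 * ind (∀ x ∈ D.filter (fun x => inF L x), T0 ω.1 x = T0 ω.1 (f x))) *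
          (μ1 ω.2 * ind (∀ x ∈ D.filter (fun x => ¬ inF L x), T1 ω.2 x = T1 ω.2 (f x))) := by
          apply sum_le_sum
          intro ω _
          have hmm : 0 ≤ μ0 ω.1 * μ1 ω.2 := mul_nonneg (m0 _) (m1 _)
          have : ind (∀ x ∈ D, glue L (T0 ω.1) (T1 ω.2) x = glue L (T0 ω.1) (T1 ω.2) (f x)) ≤
              ind (∀ x ∈ D.filter (fun x => inF L x), T0 ω.1 x = T0 ω.1 (f x)) *
              ind (∀ x ∈ D.filter (fun x => ¬ inF L x), T1 ω.2 x = T1 ω.2 (f x)) := by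
            by_cases hg : ∀ x ∈ D, glue L (T0 ω.1) (T1 ω.2) x = glue L (T0 ω.1) (T1 ω.2) (f x)
            · rw [ind_true hg, ind_true, ind_true]
              · norm_num
              · intro x hx
                rw [mem_filter] at hx
                have := hg x hx.1
                have hf : ¬ inF L (f x) := fun h => hx.2 ((hs x hx.1).2 h)
                simpa only [glue, if_neg hx.2, if_neg hf] using this
              · intro x hx
                rw [mem_filter] at hx
                have := hg x hx.1
                have hf : inF L (f x) := (hs x hx.1).1 hx.2
                simpa only [glue, if_pos hx.2, if_pos hf] using this
            · rw [ind_false hg]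
              exact mul_nonneg (ind_nonneg _) (ind_nonneg _)
          calc _ ≤ _ := mul_le_mul_of_nonneg_left this hmm
            _ = _ := by ring
      _ = (∑ ω, μ0 ω * ind (∀ x ∈ D.filter (fun x => inF L x), T0 ω x = T0 ω (f x))) *
          (∑ ω, μ1 ω * ind (∀ x ∈ D.filter (fun x => ¬ inF L x), T1 ω x = T1 ω (f x))) := by
          rw [Fintype.sum_mul_sum, Fintype.sum_prod_type]
      _ ≤ κ ^ #(D.filter fun x => inF L x) * κ ^ #(D.filter fun x => ¬ inF L x) := by
          apply mul_le_mul b0 b1 _ (by positivity)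
          exact sum_nonneg fun ω _ => mul_nonneg (m1 _) (ind_nonneg _)
      _ = κ ^ #D := by rw [← pow_add, hcard]
  · rw [ind_false hs, zero_mul]
    apply le_of_eq
    apply sum_eq_zero
    intro ω _
    rw [ind_false, mul_zero]
    intro hg
    apply hs
    intro x hx
    exact ⟨glue_same hdis hL (h0 _) (h1 _) (hD x hx).1 (hD x hx).2.2 (hg x hx),
      glue_same hdis hL (h0 _) (h1 _) (hD x hx).2.2 (hD x hx).1 (hg x hx).symm⟩

lemma spr_step {adj : ι → ι → V → V → Prop} (U : ι → Finset V) (N : ℕ) (hN : 2 ≤ N) (hdis : ∀ a b, a ≠ b → Disjoint (U a) (U b))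
    (hc : ∀ a, #(U a) = N) (F : ι → Finset (Finset V)) (hF : ∀ b, F b ⊆ (U b).powersetCard (N / 2))
    (hF2 : ∀ b, (1 - 1 / (N:ℝ)) * (N.choose (N / 2) : ℕ) ≤ #(F b)) (κ : ℝ) (hκ : 0 ≤ κ)
    (h0 : ∀ L ∈ Fintype.piFinset F, SPR adj L κ)
    (h1 : ∀ L ∈ Fintype.piFinset F, SPR adj (fun b => U b \ L b) κ) :
    SPR adj U (κ * (1 / 2 * Real.exp (2 * (Real.log (N + 1) / N))) * ((1 - 1 / (N:ℝ))⁻¹) ^ Fintype.card ι) := by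
  have hN2 : (2:ℝ) ≤ N := by exact_mod_cast hN
  have hx0 : 0 < 1 - 1 / (N:ℝ) := by
    rw [sub_pos, div_lt_one (by linarith)]; linarith
  have hx1 : 1 - 1 / (N:ℝ) ≤ 1 := by
    have : 0 ≤ 1 / (N:ℝ) := by positivity
    linarith
  have hC : (0:ℝ) < (N.choose (N / 2) : ℕ) := by exact_mod_cast Nat.choose_pos (Nat.div_le_self _ _)
  obtain ⟨FF, hFF⟩ : ∃ FF, FF = Fintype.piFinset F := ⟨_, rfl⟩
  rw [← hFF] at h0 h1
  have hcard : ((1 - 1 / (N:ℝ)) * (N.choose (N / 2) : ℕ)) ^ Fintype.card ι ≤ ((#FF : ℕ) : ℝ) := by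
    rw [hFF, Fintype.card_piFinset]
    push_cast
    rw [← card_univ, ← prod_const]
    exact prod_le_prod (fun _ _ => (mul_pos hx0 hC).le) fun b _ => hF2 b
  have hpos : 0 < ((#FF : ℕ) : ℝ) := lt_of_lt_of_le (pow_pos (mul_pos hx0 hC) _) hcard
  have hsub : ∀ L ∈ FF, ∀ b, L b ⊆ U b := by
    intro L hL b
    rw [hFF, Fintype.mem_piFinset] at hL
    exact (mem_powersetCard.1 (hF b (hL b))).1
  have h0' : ∀ L : {L // L ∈ FF}, SPR adj L.1 κ := fun L => h0 L.1 L.2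
  have h1' : ∀ L : {L // L ∈ FF}, SPR adj (fun b => U b \ L.1 b) κ := fun L => h1 L.1 L.2
  choose Ω0 i0 μ0 T0 a0 a1 a2 a3 using h0'
  choose Ω1 i1 μ1 T1 b0 b1 b2 b3 using h1'
  refine ⟨Σ L : {L // L ∈ FF}, Ω0 L × Ω1 L, inferInstance,
    fun z => (1 / ((#FF : ℕ) : ℝ)) * (μ0 z.1 z.2.1 * μ1 z.1 z.2.2),
    fun z => glue z.1.1 (T0 z.1 z.2.1) (T1 z.1 z.2.2), ?_, ?_, ?_, ?_⟩
  · intro z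
    exact mul_nonneg (by positivity) (mul_nonneg (a0 z.1 _) (b0 z.1 _))
  · rw [Fintype.sum_sigma]
    have : ∀ L : {L // L ∈ FF}, ∑ y : Ω0 L × Ω1 L, (1 / ((#FF : ℕ) : ℝ)) * (μ0 L y.1 * μ1 L y.2) = 1 / ((#FF : ℕ) : ℝ) := by
      intro L
      rw [← mul_sum, Fintype.sum_prod_type]
      have : ∑ x : Ω0 L, ∑ y : Ω1 L, μ0 L x * μ1 L y = (∑ x : Ω0 L, μ0 L x) * ∑ y : Ω1 L, μ1 L y := (Fintype.sum_mul_sum _ _).symm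
      rw [this, a1 L, b1 L]; ring
    rw [sum_congr rfl fun L _ => this L, sum_const, card_univ, Fintype.card_coe, nsmul_eq_mul]
    field_simp
  · intro z
    exact glue_perf hdis (hsub _ z.1.2) (a2 z.1 _) (b2 z.1 _)
  · intro D f hD
    have step1 : ∑ z : (Σ L : {L // L ∈ FF}, Ω0 L × Ω1 L), (1 / ((#FF : ℕ) : ℝ)) * (μ0 z.1 z.2.1 * μ1 z.1 z.2.2) *
          ind (∀ x ∈ D, glue z.1.1 (T0 z.1 z.2.1) (T1 z.1 z.2.2) x = glue z.1.1 (T0 z.1 z.2.1) (T1 z.1 z.2.2) (f x))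
        ≤ ∑ L : {L // L ∈ FF}, (1 / ((#FF : ℕ) : ℝ)) * (ind (∀ x ∈ D, inF L.1 x ↔ inF L.1 (f x)) * κ ^ #D) := by
      rw [Fintype.sum_sigma]
      apply sum_le_sum
      intro L _
      have := glue_one hdis (hsub _ L.2) (μ0 L) (μ1 L) (T0 L) (T1 L) (a0 L) (b0 L) (a2 L) (b2 L) hκ
        (a3 L) (b3 L) D f hD
      calc _ = (1 / ((#FF : ℕ) : ℝ)) * ∑ ω : Ω0 L × Ω1 L, μ0 L ω.1 * μ1 L ω.2 * ind (∀ x ∈ D, glue L.1 (T0 L ω.1) (T1 L ω.2) x = glue L.1 (T0 L ω.1) (T1 L ω.2) (f x)) := by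
            rw [mul_sum]
            apply sum_congr rfl
            intro y _
            ring
        _ ≤ _ := mul_le_mul_of_nonneg_left this (by positivity)
    refine step1.trans ?_
    have step2 : ∑ L : {L // L ∈ FF}, (1 / ((#FF : ℕ) : ℝ)) * (ind (∀ x ∈ D, inF L.1 x ↔ inF L.1 (f x)) * κ ^ #D)
        = (1 / ((#FF : ℕ) : ℝ)) * ((#(FF.filter fun L => ∀ x ∈ D, inF L x ↔ inF L (f x)) : ℕ) : ℝ) * κ ^ #D := by
      rw [sum_coe_sort FF (fun L => (1 / ((#FF : ℕ) : ℝ)) * (ind (∀ x ∈ D, inF L x ↔ inF L (f x)) * κ ^ #D)), ← mul_sum, ← sum_mul, sum_ind_card, mul_assoc]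
      congr!
    rw [step2]
    rcases D.eq_empty_or_nonempty with hDe | hDe
    · subst hDe
      simp only [notMem_empty, false_imp_iff, implies_true, filter_true, card_empty, pow_zero, mul_one]
      rw [one_div, inv_mul_cancel₀ hpos.ne']
    · have hk1 : 1 ≤ #D := card_pos.2 hDe
      have cnt := same_count U N (by omega) hdis hc D f hD
      have cnt2 : ((#(FF.filter fun L => ∀ x ∈ D, inF L x ↔ inF L (f x)) : ℕ) : ℝ) ≤
          ((#((Fintype.piFinset fun b => (U b).powersetCard (N / 2)).filter fun L => ∀ x ∈ D, inF L x ↔ inF L (f x)) : ℕ) : ℝ) := by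
        norm_cast
        apply card_le_card
        apply filter_subset_filter
        rw [hFF]
        exact Fintype.piFinset_subset _ _ hF
      have cnt3 := cnt2.trans cnt
      obtain ⟨A, hA⟩ : ∃ A, A = 1 / 2 * Real.exp (2 * (Real.log (N + 1) / N)) := ⟨_, rfl⟩
      rw [← hA] at cnt3 ⊢
      have hA0 : 0 ≤ A := by rw [hA]; positivity
      obtain ⟨X, hX⟩ : ∃ X, X = ((1 - 1 / (N:ℝ))⁻¹) ^ Fintype.card ι := ⟨_, rfl⟩
      have hX1 : 1 ≤ X := by rw [hX]; exact one_le_pow₀ ((one_le_inv₀ hx0).2 hx1)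
      have hXF : ((N.choose (N / 2) : ℕ) : ℝ) ^ Fintype.card ι ≤ X * (#FF : ℕ) := by
        calc _ = X * ((1 - 1 / (N:ℝ)) * (N.choose (N / 2) : ℕ)) ^ Fintype.card ι := by
              rw [hX, ← mul_pow, ← mul_assoc, inv_mul_cancel₀ hx0.ne', one_mul]
          _ ≤ _ := mul_le_mul_of_nonneg_left hcard (by linarith)
      rw [← hX]
      calc _ ≤ (1 / ((#FF : ℕ) : ℝ)) * (((N.choose (N / 2) : ℕ) : ℝ) ^ Fintype.card ι * A ^ #D) * κ ^ #D := by gcongr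
        _ ≤ (1 / ((#FF : ℕ) : ℝ)) * ((X * (#FF : ℕ)) * A ^ #D) * κ ^ #D := by gcongr
        _ = X * (A ^ #D * κ ^ #D) := by field_simp
        _ ≤ X ^ #D * (A ^ #D * κ ^ #D) := by
            apply mul_le_mul_of_nonneg_right _ (by positivity)
            exact le_self_pow₀ hX1 (by omega)
        _ = _ := by rw [mul_pow, mul_pow]; ring

end PartD3
end KF

namespace KF
set_option linter.unusedSectionVars false
set_option linter.unusedSimpArgs false
set_option linter.unusedVariables false
section PartD4

lemma Tb_fun {ι Y : Type} {q : (ι → Y) → Prop} {W : ι → Finset Y} (h : Tb q W) :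
    ∃ t : ι → Y → ι → Y, ∀ a, ∀ y ∈ W a, q (t a y) ∧ (∀ b, t a y b ∈ W b) ∧ t a y a = y ∧ ∀ b, t b (t a y b) = t a y := by
  induction h with
  | nil => exact ⟨fun _ y _ => y, fun a y hy => absurd hy (notMem_empty _)⟩
  | cons x W hx hW hT ih =>
    obtain ⟨t, ht⟩ := ih
    refine ⟨fun a y => if y = x a then x else t a y, ?_⟩
    intro a y hy
    by_cases hya : y = x a
    · simp only [if_pos hya]
      refine ⟨hx, fun b => mem_insert_self _ _, hya.symm, fun b => ?_⟩
      simp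
    · have hyW : y ∈ W a := by
        rcases mem_insert.1 hy with h | h
        · exact absurd h hya
        · exact h
      obtain ⟨k1, k2, k3, k4⟩ := ht a y hyW
      simp only [if_neg hya]
      refine ⟨k1, fun b => mem_insert_of_mem (k2 b), k3, fun b => ?_⟩
      have : ¬ (t a y b = x b) := fun h => hW b (h ▸ k2 b)
      rw [if_neg this]
      exact k4 b

variable {V ι : Type} [Fintype V] [Fintype ι]

lemma sum_equiv_fin {N : ℕ} (S : Finset V) (e : Fin N ≃ S) (g : V → ℝ) : ∑ i, g (e i) = ∑ v ∈ S, g v := by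
  rw [← sum_coe_sort S g]
  exact Equiv.sum_comp e (fun v : S => g v)

lemma good_fin {adj : ι → ι → V → V → Prop} {d : ι → ι → ℝ} {θ0 θ ε : ℝ} (hA : Adm adj d θ0) (h0 : θ ≤ θ0) {U : ι → Finset V} {N : ℕ}
    (hG : Good adj d U N θ ε) (e : ∀ a, Fin N ≃ U a) : GoodY (fun a b i j => adj a b (e a i) (e b j)) d θ ε where
  symm := fun a b u v h => hA.symm _ _ _ _ h
  refl := fun a u v => hA.refl _ _ _
  dl := fun a b => h0.trans (hA.dl a b)
  du := hA.du
  deg := by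
    intro a b u
    rw [Fintype.card_fin]
    have := hG.deg a b (e a u) (e a u).2
    rw [← sum_equiv_fin (U b) (e b)] at this
    exact this
  cut := by
    intro a b
    rw [Fintype.card_fin]
    have := hG.cut a b
    rw [← sum_equiv_fin (U a) (e a)] at this
    refine le_trans (le_of_eq ?_) this
    apply sum_congr rfl
    intro u _
    rw [← sum_equiv_fin (U a) (e a)]
    apply sum_congr rfl
    intro u' _
    unfold cd
    rw [← sum_equiv_fin (U b) (e b)]

lemma perf_base {adj : ι → ι → V → V → Prop} {U : ι → Finset V} (hdis : ∀ a b, a ≠ b → Disjoint (U a) (U b)) {N : ℕ}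
    (e : ∀ a, Fin N ≃ U a) (h : Tb (vld fun a b i j => adj a b (e a i) (e b j)) (fun _ => univ)) : ∃ T, Perf adj U T := by
  obtain ⟨t, ht⟩ := Tb_fun h
  have huniq : ∀ a b v, v ∈ U a → v ∈ U b → a = b := by
    intro a b v h1 h2
    by_contra hab
    exact Finset.disjoint_left.1 (hdis a b hab) h1 h2
  obtain ⟨T, hT⟩ : ∃ T : V → ι → V, ∀ a v, (hv : v ∈ U a) → T v = fun b => (e b (t a ((e a).symm ⟨v, hv⟩) b) : V) := by
    refine ⟨fun v => if h : ∃ a, v ∈ U a then fun b => (e b (t h.choose ((e h.choose).symm ⟨v, h.choose_spec⟩) b) : V) else fun _ => v, ?_⟩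
    intro a v hv
    have hex : ∃ a, v ∈ U a := ⟨a, hv⟩
    have hh := hex.choose_spec
    have ha : hex.choose = a := huniq _ _ v hh hv
    have gen : ∀ c, (hc : v ∈ U c) → c = a → (fun b => (e b (t c ((e c).symm ⟨v, hc⟩) b) : V)) = fun b => (e b (t a ((e a).symm ⟨v, hv⟩) b) : V) := by
      intro c hc hca
      subst hca
      rfl
    simp only [dif_pos hex]
    exact gen _ hh ha
  refine ⟨T, ?_⟩
  intro a v hv
  obtain ⟨k1, k2, k3, k4⟩ := ht a ((e a).symm ⟨v, hv⟩) (mem_univ _)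
  rw [hT a v hv]
  refine ⟨k1, fun b => (e b _).2, ?_, fun b => ?_⟩
  · simp [k3]
  · rw [hT b _ (e b _).2]
    simp [k4]

lemma spr_base {adj : ι → ι → V → V → Prop} {U : ι → Finset V} {T : V → ι → V} (hT : Perf adj U T) : SPR adj U 1 := by
  refine ⟨Unit, inferInstance, fun _ => 1, fun _ => T, fun _ => zero_le_one, by simp, fun _ => hT, ?_⟩
  intro D f _
  simp only [one_pow, one_mul, univ_unique, sum_singleton]
  exact ind_le_one _

lemma ev_pow (A B τ : ℝ) (hτ : 0 < τ) : ∀ᶠ N : ℕ in Filter.atTop, A * Real.log N + B ≤ (N:ℝ) ^ τ := by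
  have E1 := tendsto_natCast_atTop_atTop.eventually (ev_log (|A| + |B|) τ hτ)
  have E2 := (Real.tendsto_log_atTop.comp tendsto_natCast_atTop_atTop).eventually (Filter.eventually_ge_atTop (1:ℝ))
  filter_upwards [E1, E2] with N h1 h2
  simp only [Function.comp] at h2
  refine le_trans ?_ h1
  have a1 := le_abs_self A
  have a2 := le_abs_self B
  have a3 := abs_nonneg A
  have a4 := abs_nonneg B
  have : Real.log N ≤ Real.log N ^ 2 := by nlinarith only [h2]
  calc A * Real.log N + B ≤ |A| * Real.log N + |B| * 1 := by nlinarith only [a1, a2, h2]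
    _ ≤ |A| * Real.log N ^ 2 + |B| * Real.log N ^ 2 := by
        have : 1 ≤ Real.log N ^ 2 := by linarith
        gcongr
    _ = _ := by ring

lemma psi_step (N M : ℕ) (hM : 10 ≤ M) (hM1 : 2 * M ≤ N + 1) : 1.1 * (N:ℝ) ^ (-(1/4:ℝ)) ≤ (M:ℝ) ^ (-(1/4:ℝ)) := by
  have hM' : (10:ℝ) ≤ M := by exact_mod_cast hM
  have hM1' : 2 * (M:ℝ) ≤ N + 1 := by exact_mod_cast hM1
  have h1 : 1.4641 * (M:ℝ) ≤ N := by linarith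
  have h2 : (N:ℝ) ^ (-(1/4:ℝ)) ≤ (1.4641 * (M:ℝ)) ^ (-(1/4:ℝ)) :=
    Real.rpow_le_rpow_of_nonpos (by linarith) h1 (by norm_num)
  have h3 : (1.4641 * (M:ℝ)) ^ (-(1/4:ℝ)) = (1.1:ℝ)⁻¹ * (M:ℝ) ^ (-(1/4:ℝ)) := by
    rw [Real.mul_rpow (by norm_num) (by linarith)]
    congr 1
    rw [show (1.4641:ℝ) = (1.1:ℝ) ^ (4:ℝ) by norm_num, ← Real.rpow_mul (by norm_num)]
    norm_num
  rw [h3] at h2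
  calc _ ≤ 1.1 * ((1.1:ℝ)⁻¹ * (M:ℝ) ^ (-(1/4:ℝ))) := by linarith
    _ = _ := by rw [← mul_assoc]; norm_num

lemma kap_step (r N M : ℕ) (hM : 10 ≤ M) (hM1 : 2 * M ≤ N + 1) (hM2 : N ≤ 2 * M + 1)
    (h3 : ((r:ℝ) + 1) + Real.log (N + 1) ≤ 20 * (N:ℝ) ^ (3/4:ℝ)) (Ki : ℝ) (hK : 0 ≤ Ki) :
    Ki * Real.exp (-(400 * (M:ℝ) ^ (-(1/4:ℝ)))) / M ≤
      Ki * Real.exp (-(400 * (N:ℝ) ^ (-(1/4:ℝ)))) / N * 2 * Real.exp (-(2 * (Real.log (N + 1) / N))) * (1 - 1 / (N:ℝ)) ^ r := by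
  have hM' : (10:ℝ) ≤ M := by exact_mod_cast hM
  have hM1' : 2 * (M:ℝ) ≤ N + 1 := by exact_mod_cast hM1
  have hM2' : (N:ℝ) ≤ 2 * M + 1 := by exact_mod_cast hM2
  have hN : (19:ℝ) ≤ N := by linarith
  have hps := psi_step N M hM hM1
  have hx : Real.exp (-(2 / (N:ℝ))) ≤ 1 - 1 / (N:ℝ) := by
    rw [Real.exp_neg, inv_le_comm₀ (Real.exp_pos _) (by rw [sub_pos, div_lt_one (by linarith)]; linarith)]
    have e1 : (1 - 1 / (N:ℝ))⁻¹ = 1 / ((N:ℝ) - 1) + 1 := by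
      have : (N:ℝ) - 1 ≠ 0 := by linarith
      field_simp
      ring
    rw [e1]
    refine (Real.add_one_le_exp _).trans (Real.exp_le_exp.2 ?_)
    rw [div_le_div_iff₀ (by linarith) (by linarith)]
    linarith
  have hx2 : Real.exp (-(2 * ((r:ℝ) + 1) / (N:ℝ))) ≤ (1 - 1 / (N:ℝ)) ^ (r + 1) := by
    calc _ = (Real.exp (-(2 / (N:ℝ)))) ^ (r + 1) := by
          rw [← Real.exp_nat_mul]; congr 1; push_cast; ring
      _ ≤ _ := pow_le_pow_left₀ (Real.exp_pos _).le hx _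
  have hM3 : (N:ℝ) * (1 - 1 / N) ≤ 2 * M := by
    have : (N:ℝ) * (1 - 1 / N) = N - 1 := by field_simp
    linarith
  have hq : (N:ℝ) ^ (3/4:ℝ) = N * (N:ℝ) ^ (-(1/4:ℝ)) := by
    rw [show (3/4:ℝ) = 1 + -(1/4) by norm_num, Real.rpow_add (by linarith), Real.rpow_one]
  rw [hq] at h3
  have hkey : Real.exp (-(400 * (M:ℝ) ^ (-(1/4:ℝ)))) ≤
      Real.exp (-(400 * (N:ℝ) ^ (-(1/4:ℝ)))) * Real.exp (-(2 * (Real.log (N + 1) / N))) * Real.exp (-(2 * ((r:ℝ) + 1) / (N:ℝ))) := by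
    rw [← Real.exp_add, ← Real.exp_add]
    apply Real.exp_le_exp.2
    have : 2 * (Real.log (N + 1) / N) + 2 * ((r:ℝ) + 1) / (N:ℝ) ≤ 40 * (N:ℝ) ^ (-(1/4:ℝ)) := by
      rw [← mul_div_assoc, ← add_div, div_le_iff₀ (by linarith)]
      linarith
    linarith
  have hNx : 0 ≤ 1 - 1 / (N:ℝ) := (Real.exp_pos _).le.trans hx
  rw [div_le_iff₀ (by linarith)]
  obtain ⟨a, ha⟩ : ∃ a, a = Real.exp (-(400 * (N:ℝ) ^ (-(1/4:ℝ)))) := ⟨_, rfl⟩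
  obtain ⟨b, hb⟩ : ∃ b, b = Real.exp (-(2 * (Real.log (N + 1) / N))) := ⟨_, rfl⟩
  rw [← ha, ← hb] at hkey ⊢
  have ha0 : 0 ≤ a := by rw [ha]; positivity
  have hb0 : 0 ≤ b := by rw [hb]; positivity
  calc _ ≤ Ki * (a * b * (1 - 1 / (N:ℝ)) ^ (r + 1)) := by
        apply mul_le_mul_of_nonneg_left _ hK
        exact hkey.trans (mul_le_mul_of_nonneg_left hx2 (by positivity))
    _ = Ki * a / N * b * (1 - 1 / (N:ℝ)) ^ r * (N * (1 - 1 / N)) := by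
        rw [pow_succ]; field_simp
    _ ≤ Ki * a / N * b * (1 - 1 / (N:ℝ)) ^ r * (2 * M) := by
        apply mul_le_mul_of_nonneg_left hM3
        have := pow_nonneg hNx r
        positivity
    _ = _ := by ring

end PartD4
end KF

namespace KF
set_option linter.unusedSectionVars false
set_option linter.unusedSimpArgs false
set_option linter.unusedVariables false
section PartD5

lemma conc_num (r N : ℕ) (hr : 0 < r) (hN : 1 ≤ N) (k : ℝ) (hk : k ≤ 4 * (r:ℝ) ^ 3 * N ^ 2)
    (h : 4 * Real.log N + Real.log (16 * (r:ℝ) ^ 3) ≤ (N:ℝ) ^ (1/2:ℝ)) :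
    2 * k * (N * (N + 1)) * Real.exp (-(2 * ((N:ℝ) ^ (-(1/4:ℝ))) ^ 2 * N)) ≤ 1 := by
  have hN' : (1:ℝ) ≤ N := by exact_mod_cast hN
  have hr' : (1:ℝ) ≤ r := by exact_mod_cast hr
  have e1 : ((N:ℝ) ^ (-(1/4:ℝ))) ^ 2 * N = (N:ℝ) ^ (1/2:ℝ) := by
    have : (N:ℝ) = (N:ℝ) ^ (1:ℝ) := (Real.rpow_one _).symm
    rw [← Real.rpow_natCast, ← Real.rpow_mul (by linarith)]
    nth_rewrite 2 [this]
    rw [← Real.rpow_add (by linarith)]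
    norm_num
  rw [mul_assoc 2 _ (N:ℝ), e1, Real.exp_neg, ← div_eq_mul_inv, div_le_one (Real.exp_pos _)]
  have hp : 0 ≤ (N:ℝ) ^ (1/2:ℝ) := by positivity
  calc 2 * k * (N * (N + 1)) ≤ 2 * (4 * (r:ℝ) ^ 3 * N ^ 2) * (N * (N + N)) := by gcongr
    _ = (16 * (r:ℝ) ^ 3) * (N:ℝ) ^ 4 := by ring
    _ = Real.exp (4 * Real.log N + Real.log (16 * (r:ℝ) ^ 3)) := by
        rw [Real.exp_add, Real.exp_log (by positivity)]
        rw [show 4 * Real.log N = ((4:ℕ):ℝ) * Real.log N by norm_num, Real.exp_nat_mul, Real.exp_log (by linarith)]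
        ring
    _ ≤ _ := Real.exp_le_exp.2 (by linarith)

lemma conc' {V : Type} [Fintype V] {I : Type} (U : Finset V) (N : ℕ) (hN : #U = N) (hN0 : 0 < N) (S : Finset I) (w : I → V → ℝ)
    (hw : ∀ i ∈ S, ∀ x ∈ U, |w i x| ≤ 1) (δ : ℝ) (hδ : 0 ≤ δ)
    (hS : 2 * (#S : ℝ) * (N * (N + 1)) * Real.exp (-(2 * δ ^ 2 * N)) ≤ 1) :
    ∃ F : Finset (Finset V), F ⊆ U.powersetCard (N / 2) ∧ (1 - 1 / (N:ℝ)) * (N.choose (N / 2) : ℕ) ≤ #F ∧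
      ∀ L ∈ F, ∀ i ∈ S, |∑ x ∈ L, w i x - (1/2) * ∑ x ∈ U, w i x| ≤ δ * N :=
  ⟨_, filter_subset _ _, conc U N hN hN0 S w hw δ hδ hS, fun L hL => (mem_filter.1 hL).2⟩

theorem spr_main (r : ℕ) (hr : 0 < r) (θ : ℝ) (hθ : 0 < θ) (hθ1 : θ ≤ 1) :
    ∃ ε : ℝ, 0 < ε ∧ ∃ K : ℝ, 1 ≤ K ∧ ∃ Q : ℕ, ∀ (V ι : Type) [Fintype V] [Fintype ι], Fintype.card ι = r →
      ∀ (adj : ι → ι → V → V → Prop) (d : ι → ι → ℝ), Adm adj d θ → ∀ (N : ℕ), Q ≤ N → ∀ (U : ι → Finset V),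
        Good adj d U N θ ε → SPR adj U (K / N) := by
  obtain ⟨ε0, hε0, Q0, hT⟩ := exTiling r hr (θ / 2) (by linarith) (by linarith)
  obtain ⟨ε1, hε1⟩ : ∃ ε1, ε1 = min ε0 1 / 2 := ⟨_, rfl⟩
  have hm0 : 0 < min ε0 1 := lt_min hε0 one_pos
  have hεonepos : 0 < ε1 := by rw [hε1]; linarith
  have E1 : ∀ᶠ N : ℕ in Filter.atTop, 403 * (N:ℝ) ^ (-(1/4:ℝ)) ≤ min (θ / 2) ε1 := by
    have := ((tendsto_rpow_neg_atTop (show (0:ℝ) < 1/4 by norm_num)).comp tendsto_natCast_atTop_atTop).const_mul (403:ℝ)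
    rw [mul_zero] at this
    have h2 := this.eventually (Iio_mem_nhds (show (0:ℝ) < min (θ / 2) ε1 from lt_min (by linarith) hεonepos))
    filter_upwards [h2] with N h
    exact le_of_lt h
  have E2 := ev_pow 4 (Real.log (16 * (r:ℝ) ^ 3)) (1/2) (by norm_num)
  have E3 := ev_pow 1 ((r:ℝ) + 2) (3/4) (by norm_num)
  obtain ⟨Q, hQ⟩ := Filter.eventually_atTop.1 (E1.and (E2.and (E3.and (Filter.eventually_ge_atTop (max 20 Q0)))))
  have hQ20 : 20 ≤ Q ∧ Q0 ≤ Q := by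
    have := (hQ Q le_rfl).2.2.2
    exact ⟨(le_max_left _ _).trans this, (le_max_right _ _).trans this⟩
  obtain ⟨Ki, hKi⟩ : ∃ Ki : ℝ, Ki = 2 * Q * Real.exp 1 := ⟨_, rfl⟩
  have hKi0 : 0 ≤ Ki := by rw [hKi]; positivity
  have hKi1 : 1 ≤ Ki := by
    rw [hKi]
    have a : (20:ℝ) ≤ Q := by exact_mod_cast hQ20.1
    have b := Real.add_one_le_exp (1:ℝ)
    nlinarith only [a, b]
  refine ⟨ε1, hεonepos, Ki, hKi1, Q, ?_⟩
  intro V ι _ _ hι adj d hA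
  have main : ∀ N, Q ≤ N → ∀ U, Good adj d U N (θ - 400 * (N:ℝ) ^ (-(1/4:ℝ))) (ε1 + 400 * (N:ℝ) ^ (-(1/4:ℝ))) →
      SPR adj U (Ki * Real.exp (-(400 * (N:ℝ) ^ (-(1/4:ℝ)))) / N) := by
    intro N
    induction N using Nat.strong_induction_on with
    | _ N IH =>
    intro hN U hG
    obtain ⟨c1, c2, c3, c4⟩ := hQ N hN
    obtain ⟨δ, hδ⟩ : ∃ δ, δ = (N:ℝ) ^ (-(1/4:ℝ)) := ⟨_, rfl⟩
    have hN20 : 20 ≤ N := hQ20.1.trans hN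
    have hNr : (20:ℝ) ≤ N := by exact_mod_cast hN20
    have hδ0 : 0 < δ := by rw [hδ]; exact Real.rpow_pos_of_pos (by linarith) _
    have c1a : 403 * δ ≤ θ / 2 := by rw [hδ]; exact c1.trans (min_le_left _ _)
    have c1b : 403 * δ ≤ ε1 := by rw [hδ]; exact c1.trans (min_le_right _ _)
    have c1c : ε1 ≤ 1 / 2 := by rw [hε1]; have := min_le_right ε0 1; linarith
    have c1d : 2 * ε1 ≤ ε0 := by rw [hε1]; have := min_le_left ε0 1; linarith
    have hc3 : ((r:ℝ) + 1) + Real.log (N + 1) ≤ 20 * (N:ℝ) ^ (3/4:ℝ) := by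
      have : Real.log ((N:ℝ) + 1) ≤ Real.log N + 1 := by
        have e : Real.log N + 1 = Real.log (N * Real.exp 1) := by
          rw [Real.log_mul (by linarith) (Real.exp_pos _).ne', Real.log_exp]
        rw [e]
        apply Real.log_le_log (by linarith)
        have b := Real.add_one_le_exp (1:ℝ)
        nlinarith only [hNr, b]
      have hp : 0 ≤ (N:ℝ) ^ (3/4:ℝ) := by positivity
      linarith
    by_cases hb : N < 2 * Q
    · have hG2 : Good adj d U N (θ / 2) ε0 := hG.mono (by rw [← hδ]; linarith) (by rw [← hδ]; linarith)
      have e : ∀ a, Fin N ≃ U a := fun a => ((U a).equivFinOfCardEq (hG.card a)).symm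
      have hY := good_fin hA (by linarith : θ / 2 ≤ θ) hG2 e
      have hTb := hT ι (Fin N) hι (by rw [Fintype.card_fin]; exact hQ20.2.trans hN) _ d hY
      obtain ⟨T, hTp⟩ := perf_base hG.disj e hTb
      refine (spr_base hTp).mono zero_le_one ?_
      rw [le_div_iff₀ (by linarith), one_mul, hKi, mul_assoc, ← Real.exp_add]
      have hbr : (N:ℝ) ≤ 2 * Q := by exact_mod_cast hb.le
      have : 1 ≤ Real.exp (1 + -(400 * (N:ℝ) ^ (-(1/4:ℝ)))) := by
        apply Real.one_le_exp; rw [← hδ]; linarith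
      nlinarith only [hbr, this, hNr]
    · push Not at hb
      obtain ⟨S, hS⟩ : ∃ S : Finset (Fin 4 × ι × V × V), S = univ ×ˢ (univ ×ˢ ((univ.biUnion U) ×ˢ (univ.biUnion U))) := ⟨_, rfl⟩
      have hSc : ((#S : ℕ) : ℝ) ≤ 4 * (r:ℝ) ^ 3 * N ^ 2 := by
        have hb1 : #(univ.biUnion U) ≤ r * N := by
          refine card_biUnion_le.trans ?_
          rw [sum_congr rfl fun a _ => hG.card a, sum_const, card_univ, hι, smul_eq_mul]
        have : #S ≤ 4 * (r * ((r * N) * (r * N))) := by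
          rw [hS, card_product, card_product, card_product, card_univ, card_univ, hι, Fintype.card_fin]
          gcongr
        have h2 : ((#S : ℕ) : ℝ) ≤ ((4 * (r * ((r * N) * (r * N))) : ℕ) : ℝ) := by exact_mod_cast this
        refine h2.trans (le_of_eq ?_)
        push_cast; ring
      have hex : ∀ b, ∃ F : Finset (Finset V), F ⊆ (U b).powersetCard (N / 2) ∧ (1 - 1 / (N:ℝ)) * (N.choose (N / 2) : ℕ) ≤ #F ∧
          ∀ L ∈ F, ∀ i ∈ S, |∑ x ∈ L, tw adj d U N b i x - (1/2) * ∑ x ∈ U b, tw adj d U N b i x| ≤ δ * N := by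
        intro b
        exact conc' (U b) N (hG.card b) (by omega) S (tw adj d U N b) (fun i _ x _ => tw_le hA hθ.le U N (by omega) hG.card b i x) δ hδ0.le
          (by rw [hδ]; exact conc_num r N hr (by omega) _ hSc c2)
      choose F hFs hFc hFd using hex
      have hdN : 1 ≤ δ * N := by
        rw [hδ]
        have : (N:ℝ) ^ (-(1/4:ℝ)) * N = (N:ℝ) ^ (3/4:ℝ) := by
          rw [show (3/4:ℝ) = -(1/4) + 1 by norm_num, Real.rpow_add (by linarith), Real.rpow_one]
        rw [this]
        exact Real.one_le_rpow (by linarith) (by norm_num)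
      have side : ∀ M, Q ≤ M → M < N → 2 * M ≤ N + 1 → N ≤ 2 * M + 1 → ∀ S' : ι → Finset V, (∀ b, S' b ⊆ U b) → (∀ b, #(S' b) = M) →
          (∀ b, ∀ i ∈ S, |∑ x ∈ S' b, tw adj d U N b i x - (1/2) * ∑ x ∈ U b, tw adj d U N b i x| ≤ δ * N) →
          SPR adj S' (Ki * Real.exp (-(400 * (N:ℝ) ^ (-(1/4:ℝ)))) / N * 2 * Real.exp (-(2 * (Real.log (N + 1) / N))) * (1 - 1 / (N:ℝ)) ^ r) := by
        intro M hQM hMN hM1 hM2 S' hS1 hS2 hS3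
        have hM10 : 10 ≤ M := by omega
        have hg := good_side hA hθ.le hG (by rw [← hδ]; linarith) (by rw [← hδ]; linarith) (by rw [← hδ]; linarith) (by rw [← hδ]; linarith)
          δ hδ0 (by rw [← hδ]; linarith) hdN hM10 hM1 hM2 S' hS1 hS2 (by
            intro b i h1 h2
            apply hS3
            rw [hS]
            obtain ⟨a, ha⟩ := h1
            obtain ⟨a', ha'⟩ := h2
            simp only [mem_product, mem_univ, true_and, mem_biUnion]
            exact ⟨⟨a, ha⟩, ⟨a', ha'⟩⟩)
        have hps := psi_step N M hM10 hM1
        have := IH M hMN hQM S' (hg.mono (by rw [← hδ] at hps ⊢; linarith) (by rw [← hδ] at hps ⊢; linarith))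
        exact this.mono (by positivity) (kap_step r N M hM10 hM1 hM2 hc3 Ki hKi0)
      have hx0 : 0 < 1 - 1 / (N:ℝ) := by
        rw [sub_pos, div_lt_one (by linarith)]; linarith
      have res := spr_step (adj := adj) U N (by omega) hG.disj hG.card F hFs hFc
        (Ki * Real.exp (-(400 * (N:ℝ) ^ (-(1/4:ℝ)))) / N * 2 * Real.exp (-(2 * (Real.log (N + 1) / N))) * (1 - 1 / (N:ℝ)) ^ r)
        (by have := pow_nonneg hx0.le r; positivity)
        (by
          intro L hL
          rw [Fintype.mem_piFinset] at hL
          have hL' : ∀ b, _ ∧ _ := fun b => ⟨hFs b (hL b), hFd b _ (hL b)⟩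
          apply side (N / 2) (by omega) (by omega) (by omega) (by omega) L (fun b => (mem_powersetCard.1 (hL' b).1).1)
            (fun b => (mem_powersetCard.1 (hL' b).1).2) (fun b => (hL' b).2))
        (by
          intro L hL
          rw [Fintype.mem_piFinset] at hL
          have hL' : ∀ b, _ ∧ _ := fun b => ⟨hFs b (hL b), hFd b _ (hL b)⟩
          apply side (N - N / 2) (by omega) (by omega) (by omega) (by omega) _ (fun b => sdiff_subset)
          · intro b
            rw [card_sdiff_of_subset (mem_powersetCard.1 (hL' b).1).1, hG.card, (mem_powersetCard.1 (hL' b).1).2]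
          · intro b i hi
            have h1 := (hL' b).2 i hi
            have h2 := sum_sdiff (f := tw adj d U N b i) (mem_powersetCard.1 (hL' b).1).1
            rw [abs_le] at h1 ⊢
            constructor <;> linarith [h1.1, h1.2])
      have hfin : Ki * Real.exp (-(400 * (N:ℝ) ^ (-(1/4:ℝ)))) / N * 2 * Real.exp (-(2 * (Real.log (N + 1) / N))) * (1 - 1 / (N:ℝ)) ^ r
          * (1 / 2 * Real.exp (2 * (Real.log (N + 1) / N))) * ((1 - 1 / (N:ℝ))⁻¹) ^ Fintype.card ι = Ki * Real.exp (-(400 * (N:ℝ) ^ (-(1/4:ℝ)))) / N := by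
        rw [hι, Real.exp_neg (2 * (Real.log (N + 1) / N)), inv_pow]
        have h1 := (Real.exp_pos (2 * (Real.log (N + 1) / N))).ne'
        have h2 := (pow_pos hx0 r).ne'
        generalize Real.exp (2 * (Real.log (N + 1) / N)) = A at h1 ⊢
        generalize (1 - 1 / (N:ℝ)) ^ r = B at h2 ⊢
        generalize Ki * Real.exp (-(400 * (N:ℝ) ^ (-(1/4:ℝ)))) / N = C
        field_simp
      rw [hfin] at res
      exact res
  intro N hN U hG
  have hp : 0 ≤ (N:ℝ) ^ (-(1/4:ℝ)) := by positivity
  refine (main N hN U (hG.mono (by linarith) (by linarith))).mono (by positivity) ?_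
  apply div_le_div_of_nonneg_right _ (Nat.cast_nonneg _)
  exact mul_le_of_le_one_right hKi0 (Real.exp_le_one_iff.2 (by linarith))

end PartD5
end KF

namespace KF
set_option linter.unusedSectionVars false
set_option linter.unusedSimpArgs false
set_option linter.unusedVariables false
section PartF1

lemma split_count (N k : ℕ) [NeZero k] (A : Fin N → Fin k → Prop) (b : Fin k) (ϑ : ℝ)
    (hA : ϑ * (k * N) ≤ ∑ x, ∑ y, ind (A x y)) :
    ((#(univ.filter fun σ : Fin N → Fin k => ∑ x, ind (A x (b - σ x)) < ϑ / 2 * N) : ℕ) : ℝ) ≤ (k:ℝ) ^ N * Real.exp (-(ϑ * N / 10)) := by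
  have hk : (0:ℝ) < k := by exact_mod_cast Nat.pos_of_ne_zero (NeZero.ne k)
  have he : Real.exp (-1) ≤ 0.4 := by
    rw [Real.exp_neg, inv_le_comm₀ (Real.exp_pos _) (by norm_num)]
    have := Real.exp_one_gt_d9
    norm_num at this ⊢; linarith
  have h1 : ((#(univ.filter fun σ : Fin N → Fin k => ∑ x, ind (A x (b - σ x)) < ϑ / 2 * N) : ℕ) : ℝ) ≤
      ∑ σ : Fin N → Fin k, Real.exp (ϑ / 2 * N) * ∏ x, Real.exp (-ind (A x (b - σ x))) := by
    rw [← sum_ind_card]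
    apply sum_le_sum
    intro σ _
    rw [← Real.exp_sum, ← Real.exp_add, sum_neg_distrib]
    by_cases h : ∑ x, ind (A x (b - σ x)) < ϑ / 2 * N
    · rw [ind_true h]; exact Real.one_le_exp (by linarith)
    · rw [ind_false h]; exact (Real.exp_pos _).le
  refine h1.trans ?_
  rw [← mul_sum]
  have h2 : ∑ σ : Fin N → Fin k, ∏ x, Real.exp (-ind (A x (b - σ x))) = ∏ x, ∑ y, Real.exp (-ind (A x (b - y))) := by
    rw [prod_univ_sum, Fintype.piFinset_univ]
  rw [h2]
  have h3 : ∀ x, ∑ y, Real.exp (-ind (A x (b - y))) ≤ k * Real.exp (-(0.6 / k * ∑ y, ind (A x y))) := by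
    intro x
    have e1 : ∑ y, Real.exp (-ind (A x (b - y))) = ∑ y, Real.exp (-ind (A x y)) :=
      Equiv.sum_comp (Equiv.subLeft b) (fun y => Real.exp (-ind (A x y)))
    rw [e1]
    have e2 : ∑ y, Real.exp (-ind (A x y)) ≤ ∑ y : Fin k, (1 - 0.6 * ind (A x y)) := by
      apply sum_le_sum
      intro y _
      by_cases h : A x y
      · rw [ind_true h]; norm_num at he ⊢; linarith
      · rw [ind_false h]; norm_num
    refine e2.trans ?_
    rw [sum_sub_distrib, sum_const, card_univ, Fintype.card_fin, ← mul_sum, nsmul_eq_mul, mul_one]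
    have e3 := Real.add_one_le_exp (-(0.6 / k * ∑ y, ind (A x y)))
    calc (k:ℝ) - 0.6 * ∑ y, ind (A x y) = k * (-(0.6 / k * ∑ y, ind (A x y)) + 1) := by field_simp; ring
      _ ≤ _ := mul_le_mul_of_nonneg_left e3 hk.le
  have h4 : ∏ x, ∑ y, Real.exp (-ind (A x (b - y))) ≤ (k:ℝ) ^ N * Real.exp (-(0.6 * ϑ * N)) := by
    calc _ ≤ ∏ x : Fin N, (k * Real.exp (-(0.6 / k * ∑ y, ind (A x y)))) :=
          prod_le_prod (fun x _ => sum_nonneg fun y _ => (Real.exp_pos _).le) fun x _ => h3 x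
      _ = (k:ℝ) ^ N * Real.exp (-(0.6 / k * ∑ x, ∑ y, ind (A x y))) := by
          rw [prod_mul_distrib, prod_const, card_univ, Fintype.card_fin, ← Real.exp_sum, sum_neg_distrib, ← mul_sum]
      _ ≤ _ := by
          apply mul_le_mul_of_nonneg_left _ (by positivity)
          apply Real.exp_le_exp.2
          have : 0.6 / k * (ϑ * (k * N)) ≤ 0.6 / k * ∑ x, ∑ y, ind (A x y) := mul_le_mul_of_nonneg_left hA (by positivity)
          have e : 0.6 / (k:ℝ) * (ϑ * (k * N)) = 0.6 * ϑ * N := by field_simp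
          linarith
  calc _ ≤ Real.exp (ϑ / 2 * N) * ((k:ℝ) ^ N * Real.exp (-(0.6 * ϑ * N))) := mul_le_mul_of_nonneg_left h4 (Real.exp_pos _).le
    _ = (k:ℝ) ^ N * (Real.exp (ϑ / 2 * N) * Real.exp (-(0.6 * ϑ * N))) := by ring
    _ = _ := by rw [← Real.exp_add]; congr 2; ring

lemma split {V I : Type} [Fintype V] (N k : ℕ) (hk : k ≠ 0) (W : Finset V) (hW : #W = k * N) (J : Finset I) (A : I → Finset V)
    (ϑ : ℝ) (hA : ∀ i ∈ J, ϑ * (k * N) ≤ #(W ∩ A i)) (hJ : (#J : ℝ) * k * Real.exp (-(ϑ * N / 10)) < 1) :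
    ∃ P : Fin k → Finset V, (∀ a b, a ≠ b → Disjoint (P a) (P b)) ∧ (∀ b, P b ⊆ W) ∧ (∀ b, #(P b) = N) ∧
      ∀ i ∈ J, ∀ b, ϑ / 2 * N ≤ #(P b ∩ A i) := by
  have : NeZero k := ⟨hk⟩
  have hk0 : (0:ℝ) < k := by exact_mod_cast Nat.pos_of_ne_zero hk
  obtain e : Fin N × Fin k ≃ W := by
    refine (Fintype.equivOfCardEq ?_)
    rw [Fintype.card_prod, Fintype.card_fin, Fintype.card_fin, Fintype.card_coe, hW, mul_comm]
  have hinj : ∀ z z', ((e z : W) : V) = e z' → z = z' := fun z z' h => e.injective (Subtype.ext h)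
  have hbad : ∀ i ∈ J, ∀ b : Fin k, ((#(univ.filter fun σ : Fin N → Fin k => ∑ x, ind (((e (x, b - σ x) : W) : V) ∈ A i) < ϑ / 2 * N) : ℕ) : ℝ) ≤ (k:ℝ) ^ N * Real.exp (-(ϑ * N / 10)) := by
    intro i hi b
    apply split_count N k (fun x y => ((e (x, y) : W) : V) ∈ A i) b ϑ
    refine (hA i hi).trans (le_of_eq ?_)
    rw [← Fintype.sum_prod_type (fun z : Fin N × Fin k => ind (((e z : W) : V) ∈ A i)),
      Equiv.sum_comp e (fun w : W => ind ((w : V) ∈ A i)), sum_coe_sort W (fun w => ind (w ∈ A i)), sum_ind_card]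
    rw [← filter_mem_eq_inter]
    congr!
  have hex : ∃ σ : Fin N → Fin k, ∀ i ∈ J, ∀ b, ϑ / 2 * N ≤ ∑ x, ind (((e (x, b - σ x) : W) : V) ∈ A i) := by
    by_contra hno
    push Not at hno
    have : (univ : Finset (Fin N → Fin k)) ⊆ (J ×ˢ (univ : Finset (Fin k))).biUnion fun z => univ.filter fun σ : Fin N → Fin k => ∑ x, ind (((e (x, z.2 - σ x) : W) : V) ∈ A z.1) < ϑ / 2 * N := by
      intro σ _
      obtain ⟨i, hi, b, hb⟩ := hno σ
      rw [mem_biUnion]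
      exact ⟨(i, b), mem_product.2 ⟨hi, mem_univ _⟩, mem_filter.2 ⟨mem_univ _, hb⟩⟩
    have h2 := (card_le_card this).trans card_biUnion_le
    have h3 : ((#(univ : Finset (Fin N → Fin k)) : ℕ) : ℝ) ≤ ∑ z ∈ J ×ˢ (univ : Finset (Fin k)), (k:ℝ) ^ N * Real.exp (-(ϑ * N / 10)) := by
      refine le_trans (Nat.cast_le.2 h2) ?_
      rw [Nat.cast_sum]
      apply sum_le_sum
      intro z hz
      exact hbad z.1 (mem_product.1 hz).1 z.2
    rw [sum_const, card_product, card_univ, card_univ, Fintype.card_pi, prod_const, card_univ, Fintype.card_fin, Fintype.card_fin, nsmul_eq_mul] at h3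
    push_cast at h3
    have hkN : (0:ℝ) < (k:ℝ) ^ N := by positivity
    have : (k:ℝ) ^ N * ((#J : ℝ) * k * Real.exp (-(ϑ * N / 10))) < (k:ℝ) ^ N * 1 := mul_lt_mul_of_pos_left hJ hkN
    linarith
  obtain ⟨σ, hσ⟩ := hex
  have hPinj : ∀ b, Function.Injective fun x => ((e (x, b - σ x) : W) : V) := by
    intro b x x' h
    exact (Prod.ext_iff.1 (hinj _ _ h)).1
  refine ⟨fun b => univ.image fun x => ((e (x, b - σ x) : W) : V), ?_, ?_, ?_, ?_⟩
  · intro a b hab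
    rw [Finset.disjoint_left]
    intro v h1 h2
    obtain ⟨x, _, hx⟩ := mem_image.1 h1
    obtain ⟨y, _, hy⟩ := mem_image.1 h2
    have h3 := hinj _ _ (hx.trans hy.symm)
    rw [Prod.ext_iff] at h3
    simp only at h3
    obtain ⟨h4, h5⟩ := h3
    rw [h4] at h5
    exact hab (sub_left_inj.1 h5)
  · intro b v hv
    obtain ⟨x, _, rfl⟩ := mem_image.1 hv
    exact (e _).2
  · intro b
    rw [card_image_of_injective _ (hPinj b), card_univ, Fintype.card_fin]
  · intro i hi b
    refine (hσ i hi b).trans (le_of_eq ?_)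
    rw [sum_ind_card, ← filter_mem_eq_inter, filter_image, card_image_of_injective _ (hPinj b)]
    congr!

end PartF1
end KF

namespace KF
set_option linter.unusedSectionVars false
set_option linter.unusedSimpArgs false
set_option linter.unusedVariables false
section PartF2
variable {V : Type} [Fintype V]

lemma edgesBtw_eq (G : SimpleGraph V) (X Y : Finset V) : ((edgesBtw G (X : Set V) (Y : Set V) : ℕ) : ℝ) = ∑ u ∈ X, ∑ v ∈ Y, ind (G.Adj u v) := by
  unfold edgesBtw
  rw [← sum_product' X Y (fun u v => ind (G.Adj u v)), sum_ind_card (X ×ˢ Y) (fun z : V × V => G.Adj z.1 z.2)]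
  norm_cast
  rw [Nat.card_eq_fintype_card, Fintype.card_subtype]
  congr 1
  ext z
  simp only [mem_filter, mem_univ, true_and, mem_product, mem_coe]
  tauto

lemma dens_eq (G : SimpleGraph V) (X Y : Finset V) : density G (X : Set V) (Y : Set V) = (∑ u ∈ X, ∑ v ∈ Y, ind (G.Adj u v)) / ((#X : ℝ) * #Y) := by
  unfold density
  rw [edgesBtw_eq, Set.ncard_coe_finset, Set.ncard_coe_finset]

lemma ssum_le (G : SimpleGraph V) (X Y : Finset V) : ∑ u ∈ X, ∑ v ∈ Y, ind (G.Adj u v) ≤ (#X : ℝ) * #Y := by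
  calc _ ≤ ∑ u ∈ X, ∑ v ∈ Y, (1:ℝ) := sum_le_sum fun u _ => sum_le_sum fun v _ => ind_le_one _
    _ = _ := by simp

lemma dens_nonneg (G : SimpleGraph V) (X Y : Finset V) : 0 ≤ density G (X : Set V) (Y : Set V) := by
  rw [dens_eq]
  exact div_nonneg (sum_nonneg fun u _ => sum_nonneg fun v _ => ind_nonneg _) (by positivity)

lemma dens_le_one (G : SimpleGraph V) (X Y : Finset V) : density G (X : Set V) (Y : Set V) ≤ 1 := by
  rw [dens_eq]
  exact div_le_one_of_le₀ (ssum_le G X Y) (by positivity)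

lemma dens_mul (G : SimpleGraph V) (X Y : Finset V) : density G (X : Set V) (Y : Set V) * ((#X : ℝ) * #Y) = ∑ u ∈ X, ∑ v ∈ Y, ind (G.Adj u v) := by
  rw [dens_eq]
  by_cases h : (#X : ℝ) * #Y = 0
  · have h1 := ssum_le G X Y
    have h2 : 0 ≤ ∑ u ∈ X, ∑ v ∈ Y, ind (G.Adj u v) := sum_nonneg fun u _ => sum_nonneg fun v _ => ind_nonneg _
    rw [h] at h1 ⊢
    rw [mul_zero]; linarith
  · rw [div_mul_cancel₀ _ h]

lemma reg_disc (G : SimpleGraph V) (A B : Finset V) (ε d : ℝ) (hε : 0 < ε) (hε1 : ε ≤ 1)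
    (h : IsRegularPair G (A : Set V) (B : Set V) ε d) (X Y : Finset V) (hX : X ⊆ A) (hY : Y ⊆ B) :
    |∑ u ∈ X, ∑ v ∈ Y, (ind (G.Adj u v) - density G (A : Set V) (B : Set V))| ≤ 2 * ε * (#A * #B) := by
  obtain ⟨d0, hd0⟩ : ∃ d0, d0 = density G (A : Set V) (B : Set V) := ⟨_, rfl⟩
  have n1 : 0 ≤ d0 := by rw [hd0]; exact dens_nonneg _ _ _
  have n2 : d0 ≤ 1 := by rw [hd0]; exact dens_le_one _ _ _
  rw [← hd0]
  have e0 : ∑ u ∈ X, ∑ v ∈ Y, (ind (G.Adj u v) - d0) = (density G (X : Set V) (Y : Set V) - d0) * ((#X : ℝ) * #Y) := by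
    rw [sub_mul, dens_mul]
    simp only [sum_sub_distrib, sum_const, nsmul_eq_mul]
    ring
  have m1 := dens_nonneg G X Y
  have m2 := dens_le_one G X Y
  have hXA : (#X : ℝ) ≤ #A := by exact_mod_cast card_le_card hX
  have hYB : (#Y : ℝ) ≤ #B := by exact_mod_cast card_le_card hY
  have p1 : (0:ℝ) ≤ #X := Nat.cast_nonneg _
  have p2 : (0:ℝ) ≤ #Y := Nat.cast_nonneg _
  have pp : (0:ℝ) ≤ #X * #Y := mul_nonneg p1 p2
  have q1 : (0:ℝ) ≤ #A := Nat.cast_nonneg _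
  have q2 : (0:ℝ) ≤ #B := Nat.cast_nonneg _
  have hm : |density G (X : Set V) (Y : Set V) - d0| ≤ 1 := by rw [abs_le]; constructor <;> linarith
  rw [e0, abs_mul, abs_of_nonneg pp]
  have hq : 0 ≤ ε * ((#A : ℝ) * #B) := by positivity
  by_cases c1 : ε * (#A : ℝ) ≤ #X
  · by_cases c2 : ε * (#B : ℝ) ≤ #Y
    · have h1 := h (X : Set V) (by exact_mod_cast hX) (Y : Set V) (by exact_mod_cast hY) (by simpa [Set.ncard_coe_finset] using c1) (by simpa [Set.ncard_coe_finset] using c2)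
      have h2 := h (A : Set V) subset_rfl (B : Set V) subset_rfl (by rw [Set.ncard_coe_finset]; nlinarith only [hε1, q1])
        (by rw [Set.ncard_coe_finset]; nlinarith only [hε1, q2])
      rw [← hd0] at h2
      have h3 : |density G (X : Set V) (Y : Set V) - d0| ≤ 2 * ε := by
        rw [abs_lt] at h1 h2
        rw [abs_le]
        constructor <;> linarith [h1.1, h1.2, h2.1, h2.2]
      exact mul_le_mul h3 (mul_le_mul hXA hYB p2 q1) pp (by linarith)
    · push Not at c2
      calc _ ≤ 1 * ((#X : ℝ) * #Y) := mul_le_mul_of_nonneg_right hm pp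
        _ ≤ 1 * ((#A : ℝ) * (ε * #B)) := by gcongr
        _ ≤ _ := by linarith
  · push Not at c1
    calc _ ≤ 1 * ((#X : ℝ) * #Y) := mul_le_mul_of_nonneg_right hm pp
      _ ≤ 1 * ((ε * (#A : ℝ)) * #B) := by gcongr
      _ ≤ _ := by linarith

lemma cut_row (P : V → V → Prop) (d η : ℝ) (hd : 0 ≤ d) (hd1 : d ≤ 1) (A B : Finset V)
    (h : ∀ X ⊆ A, ∀ Y ⊆ B, |∑ u ∈ X, ∑ v ∈ Y, (ind (P u v) - d)| ≤ η) (u : V) :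
    |∑ u' ∈ A, ∑ v ∈ B, (ind (P u v) - d) * (ind (P u' v) - d)| ≤ η := by
  have e : ∑ u' ∈ A, ∑ v ∈ B, (ind (P u v) - d) * (ind (P u' v) - d) =
      (1 - d) * (∑ u' ∈ A, ∑ v ∈ B.filter (fun v => P u v), (ind (P u' v) - d)) - d * (∑ u' ∈ A, ∑ v ∈ B.filter (fun v => ¬ P u v), (ind (P u' v) - d)) := by
    rw [mul_sum, mul_sum, ← sum_sub_distrib]
    apply sum_congr rfl
    intro u' _
    rw [← sum_filter_add_sum_filter_not B (fun v => P u v), sub_eq_add_neg, mul_sum, mul_sum, ← sum_neg_distrib]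
    congr 1
    · apply sum_congr rfl
      intro v hv
      rw [ind_true (mem_filter.1 hv).2]
    · apply sum_congr rfl
      intro v hv
      rw [ind_false (mem_filter.1 hv).2]; ring
  rw [e]
  have h1 := h A subset_rfl (B.filter fun v => P u v) (filter_subset _ _)
  have h2 := h A subset_rfl (B.filter fun v => ¬ P u v) (filter_subset _ _)
  rw [abs_le] at h1 h2 ⊢
  constructor <;> nlinarith only [h1.1, h1.2, h2.1, h2.2, hd, hd1]

lemma cut_le (P : V → V → Prop) (d η : ℝ) (hd : 0 ≤ d) (hd1 : d ≤ 1) (A B : Finset V)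
    (h : ∀ X ⊆ A, ∀ Y ⊆ B, |∑ u ∈ X, ∑ v ∈ Y, (ind (P u v) - d)| ≤ η) :
    ∑ u ∈ A, ∑ u' ∈ A, |∑ v ∈ B, (ind (P u v) - d) * (ind (P u' v) - d)| ≤ #A * (2 * η) := by
  have : ∀ u ∈ A, ∑ u' ∈ A, |∑ v ∈ B, (ind (P u v) - d) * (ind (P u' v) - d)| ≤ 2 * η := by
    intro u _
    rw [← sum_filter_add_sum_filter_not A (fun u' => 0 ≤ ∑ v ∈ B, (ind (P u v) - d) * (ind (P u' v) - d))]
    have e1 : ∑ u' ∈ A.filter (fun u' => 0 ≤ ∑ v ∈ B, (ind (P u v) - d) * (ind (P u' v) - d)), |∑ v ∈ B, (ind (P u v) - d) * (ind (P u' v) - d)|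
        = ∑ u' ∈ A.filter (fun u' => 0 ≤ ∑ v ∈ B, (ind (P u v) - d) * (ind (P u' v) - d)), ∑ v ∈ B, (ind (P u v) - d) * (ind (P u' v) - d) := by
      apply sum_congr rfl
      intro u' hu'
      exact abs_of_nonneg (mem_filter.1 hu').2
    have e2 : ∑ u' ∈ A.filter (fun u' => ¬ 0 ≤ ∑ v ∈ B, (ind (P u v) - d) * (ind (P u' v) - d)), |∑ v ∈ B, (ind (P u v) - d) * (ind (P u' v) - d)|
        = - ∑ u' ∈ A.filter (fun u' => ¬ 0 ≤ ∑ v ∈ B, (ind (P u v) - d) * (ind (P u' v) - d)), ∑ v ∈ B, (ind (P u v) - d) * (ind (P u' v) - d) := by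
      rw [← sum_neg_distrib]
      apply sum_congr rfl
      intro u' hu'
      exact abs_of_neg (not_le.1 (mem_filter.1 hu').2)
    rw [e1, e2]
    have h1 := cut_row P d η hd hd1 (A.filter (fun u' => 0 ≤ ∑ v ∈ B, (ind (P u v) - d) * (ind (P u' v) - d))) B
      (fun X hX Y hY => h X (hX.trans (filter_subset _ _)) Y hY) u
    have h2 := cut_row P d η hd hd1 (A.filter (fun u' => ¬ 0 ≤ ∑ v ∈ B, (ind (P u v) - d) * (ind (P u' v) - d))) B
      (fun X hX Y hY => h X (hX.trans (filter_subset _ _)) Y hY) u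
    rw [abs_le] at h1 h2
    linarith [h1.2, h2.1]
  calc _ ≤ ∑ u ∈ A, 2 * η := sum_le_sum this
    _ = _ := by rw [sum_const, nsmul_eq_mul]

end PartF2
end KF

namespace KF
set_option linter.unusedSectionVars false
set_option linter.unusedSimpArgs false
set_option linter.unusedVariables false
section PartF3

/-- adjacency between slots: same colour or edge -/
def sadj {I V : Type} (sz : I → ℕ) (G : SimpleGraph V) (a b : Σ i, Fin (sz i)) (u v : V) : Prop := a.1 = b.1 ∨ G.Adj u v

theorem top_good {I V : Type} [Fintype I] [Fintype V] (sz : I → ℕ) (s : ℕ) (hsz0 : ∀ i, sz i ≠ 0) (hszs : ∀ i, sz i ≤ s)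
    (G : SimpleGraph V) (WF : I → Finset V) (hdis : ∀ i j, i ≠ j → Disjoint (WF i) (WF j)) (N : ℕ) (hN : 0 < N)
    (hcard : ∀ i, #(WF i) = sz i * N) (ϑ ε ε1 : ℝ) (hϑ : 0 < ϑ) (hϑ1 : ϑ ≤ 1) (hε : 0 < ε) (hε1 : ε ≤ 1) (hεs : 4 * ε * (s:ℝ) ^ 2 ≤ ε1)
    (hsr : ∀ i j, i ≠ j → ∃ d, IsSuperRegularPair G (WF i : Set V) (WF j : Set V) ε d ϑ)
    (hbig : (Fintype.card V : ℝ) * s * Real.exp (-(ϑ * N / 10)) < 1) :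
    ∃ (U : (Σ i, Fin (sz i)) → Finset V) (d : (Σ i, Fin (sz i)) → (Σ i, Fin (sz i)) → ℝ),
      Adm (sadj sz G) d (ϑ / 2) ∧ Good (sadj sz G) d U N (ϑ / 2) ε1 ∧ ∀ a, U a ⊆ WF a.1 := by
  have hN' : (0:ℝ) < N := by exact_mod_cast hN
  have hmin : ∀ i j, i ≠ j → ∀ v ∈ WF i, ϑ * (#(WF j) : ℝ) ≤ ((#(WF j ∩ univ.filter fun w => G.Adj v w) : ℕ) : ℝ) := by
    intro i j hij v hv
    obtain ⟨d, h1, h2, h3⟩ := hsr i j hij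
    have := h2 v (by exact_mod_cast hv)
    rw [Set.ncard_coe_finset] at this
    refine this.trans (le_of_eq ?_)
    congr 1
    rw [← Set.ncard_coe_finset]
    congr 1
    ext w
    simp
  have hsp : ∀ j, ∃ P : Fin (sz j) → Finset V, (∀ a b, a ≠ b → Disjoint (P a) (P b)) ∧ (∀ b, P b ⊆ WF j) ∧ (∀ b, #(P b) = N) ∧
      ∀ v ∈ univ.filter (fun v => ∃ i, i ≠ j ∧ v ∈ WF i), ∀ b, ϑ / 2 * N ≤ #(P b ∩ univ.filter fun w => G.Adj v w) := by
    intro j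
    apply split N (sz j) (hsz0 j) (WF j) (hcard j) (univ.filter (fun v => ∃ i, i ≠ j ∧ v ∈ WF i)) (fun v => univ.filter fun w => G.Adj v w) ϑ
    · intro v hv
      obtain ⟨i, hij, hvi⟩ := (mem_filter.1 hv).2
      have := hmin i j hij v hvi
      rw [hcard] at this
      push_cast at this
      exact this
    · refine lt_of_le_of_lt ?_ hbig
      have h1 : ((#(univ.filter (fun v => ∃ i, i ≠ j ∧ v ∈ WF i)) : ℕ) : ℝ) ≤ Fintype.card V := by
        exact_mod_cast card_le_univ _
      have h2 : ((sz j : ℕ) : ℝ) ≤ s := by exact_mod_cast hszs j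
      gcongr
  choose P p1 p2 p3 p4 using hsp
  have hdens : ∀ i j, i ≠ j → ϑ ≤ density G (WF i : Set V) (WF j : Set V) := by
    intro i j hij
    rw [dens_eq]
    have c1 : (0:ℝ) < #(WF i) := by rw [hcard]; have := Nat.pos_of_ne_zero (hsz0 i); exact_mod_cast Nat.mul_pos this hN
    have c2 : (0:ℝ) < #(WF j) := by rw [hcard]; have := Nat.pos_of_ne_zero (hsz0 j); exact_mod_cast Nat.mul_pos this hN
    rw [le_div_iff₀ (by positivity)]
    calc _ = ∑ u ∈ WF i, ϑ * (#(WF j) : ℝ) := by rw [sum_const, nsmul_eq_mul]; ring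
      _ ≤ _ := by
        apply sum_le_sum
        intro u hu
        refine (hmin i j hij u hu).trans (le_of_eq ?_)
        rw [sum_ind_card]
        congr 2
        ext w; simp
  refine ⟨fun a => P a.1 a.2, fun a b => if a.1 = b.1 then 1 else density G (WF a.1 : Set V) (WF b.1 : Set V), ?_, ?_, ?_⟩
  · refine ⟨?_, ?_, ?_, ?_⟩
    · rintro a b u v (h | h)
      · exact Or.inl h.symm
      · exact Or.inr h.symm
    · intro a u v; exact Or.inl rfl
    · intro a b
      by_cases h : a.1 = b.1
      · simp only [if_pos h]; linarith
      · simp only [if_neg h]; linarith [hdens _ _ h]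
    · intro a b
      by_cases h : a.1 = b.1
      · simp only [if_pos h]; exact le_rfl
      · simp only [if_neg h]; exact dens_le_one _ _ _
  · refine ⟨?_, ?_, ?_, ?_⟩
    · rintro ⟨i, x⟩ ⟨j, y⟩ hab
      by_cases hij : i = j
      · subst hij
        have : x ≠ y := fun h => hab (by rw [h])
        exact p1 i x y this
      · exact (hdis i j hij).mono (p2 i x) (p2 j y)
    · intro a; exact p3 _ _
    · intro a b u hu
      by_cases h : a.1 = b.1
      · have : ∀ v ∈ P b.1 b.2, ind (sadj sz G a b u v) = 1 := fun v _ => ind_true (Or.inl h)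
        rw [sum_congr rfl this, sum_const, p3, nsmul_eq_mul, mul_one]
        nlinarith only [hϑ1, hN']
      · have := p4 b.1 u (mem_filter.2 ⟨mem_univ _, a.1, h, p2 _ _ hu⟩) b.2
        refine this.trans ?_
        have e : ∀ v ∈ P b.1 b.2, ind (G.Adj u v) ≤ ind (sadj sz G a b u v) := fun v _ => ind_mono (fun h => Or.inr h)
        refine le_trans (le_of_eq ?_) (sum_le_sum e)
        rw [sum_ind_card]
        congr 2
        ext w; simp
    · intro a b
      have hs0 : (0:ℝ) ≤ ε1 * (N:ℝ) ^ 3 := by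
        apply mul_nonneg (le_trans (by positivity) hεs) (by positivity)
      by_cases h : a.1 = b.1
      · refine le_trans (le_of_eq ?_) hs0
        apply sum_eq_zero
        intro u _
        apply sum_eq_zero
        intro u' _
        unfold cd
        rw [abs_eq_zero]
        apply sum_eq_zero
        intro v _
        have : ind (sadj sz G a b u v) = 1 := ind_true (Or.inl h)
        simp only [this, if_pos h]; ring
      · obtain ⟨d, h1, h2, h3⟩ := hsr a.1 b.1 h
        have hr := reg_disc G (WF a.1) (WF b.1) ε d hε hε1 h1
        obtain ⟨d0, hd0⟩ : ∃ d0, d0 = density G (WF a.1 : Set V) (WF b.1 : Set V) := ⟨_, rfl⟩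
        rw [← hd0] at hr
        have hcut := cut_le (fun u v => G.Adj u v) d0 (2 * ε * (#(WF a.1) * #(WF b.1))) (by rw [hd0]; exact dens_nonneg _ _ _)
          (by rw [hd0]; exact dens_le_one _ _ _) (P a.1 a.2) (P b.1 b.2) (fun X hX Y hY => hr X Y (hX.trans (p2 _ _)) (hY.trans (p2 _ _)))
        have e : ∀ u v, ind (sadj sz G a b u v) = ind (G.Adj u v) := by
          intro u v
          have : sadj sz G a b u v ↔ G.Adj u v := ⟨fun hh => hh.resolve_left h, fun hh => Or.inr hh⟩
          rw [this]
        unfold cd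
        simp only [e, if_neg h, ← hd0]
        refine hcut.trans ?_
        rw [p3, hcard, hcard]
        push_cast
        have s1 : ((sz a.1 : ℕ) : ℝ) ≤ s := by exact_mod_cast hszs _
        have s2 : ((sz b.1 : ℕ) : ℝ) ≤ s := by exact_mod_cast hszs _
        calc (N:ℝ) * (2 * (2 * ε * ((sz a.1 : ℝ) * N * ((sz b.1 : ℝ) * N)))) ≤ (N:ℝ) * (2 * (2 * ε * ((s : ℝ) * N * ((s : ℝ) * N)))) := by gcongr
          _ = 4 * ε * (s:ℝ) ^ 2 * (N:ℝ) ^ 3 := by ring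
          _ ≤ _ := mul_le_mul_of_nonneg_right hεs (by positivity)
  · intro a; exact p2 _ _

end PartF3
end KF

namespace KF
set_option linter.unusedSectionVars false
set_option linter.unusedSimpArgs false
set_option linter.unusedVariables false
section PartG1

/-- the graph of a set of pairs -/
def gr {V : Type} (W : Finset (EE V)) : SimpleGraph V := SimpleGraph.fromEdgeSet {e | ∃ h : ¬ e.IsDiag, (⟨e, h⟩ : EE V) ∈ W}

lemma gr_edgeSet {V : Type} (W : Finset (EE V)) : (gr W).edgeSet = {e | ∃ h : ¬ e.IsDiag, (⟨e, h⟩ : EE V) ∈ W} := by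
  unfold gr
  rw [SimpleGraph.edgeSet_fromEdgeSet]
  ext e
  simp only [Set.mem_sdiff, Set.mem_ofPred_eq, Sym2.mem_diagSet]
  constructor
  · rintro ⟨h, _⟩; exact h
  · rintro ⟨h, h2⟩; exact ⟨⟨h, h2⟩, h⟩

lemma gr_bij {V : Type} : Function.Bijective (gr (V := V) : Finset (EE V) → SimpleGraph V) ∨ ¬ Finite V := by
  by_cases hV : Finite V
  swap
  · exact Or.inr hV
  left
  have := Fintype.ofFinite V
  constructor
  · intro W W' h
    have h2 := congrArg SimpleGraph.edgeSet h
    rw [gr_edgeSet, gr_edgeSet] at h2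
    ext ⟨e, he⟩
    have h3 := Set.ext_iff.1 h2 e
    simp only [Set.mem_ofPred_eq] at h3
    constructor
    · intro h4
      obtain ⟨_, h5⟩ := h3.1 ⟨he, h4⟩
      exact h5
    · intro h4
      obtain ⟨_, h5⟩ := h3.2 ⟨he, h4⟩
      exact h5
  · intro H
    refine ⟨univ.filter fun e => e.1 ∈ H.edgeSet, ?_⟩
    apply SimpleGraph.edgeSet_injective
    rw [gr_edgeSet]
    ext e
    simp only [Set.mem_ofPred_eq, mem_filter, mem_univ, true_and]
    constructor
    · rintro ⟨_, h⟩; exact h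
    · intro h; exact ⟨H.not_isDiag_of_mem_edgeSet h, h⟩

lemma gr_count {n : ℕ} (W : Finset (EE (Fin n))) : edgeCount (gr W) = #W := by
  unfold edgeCount
  rw [gr_edgeSet]
  have e : {e : Sym2 (Fin n) | ∃ h : ¬ e.IsDiag, (⟨e, h⟩ : EE (Fin n)) ∈ W} ≃ W := by
    refine ⟨fun z => ⟨⟨z.1, z.2.1⟩, z.2.2⟩, fun w => ⟨w.1.1, w.1.2, w.2⟩, ?_, ?_⟩
    · intro z; rfl
    · intro w; rfl
  rw [Nat.card_congr e, Nat.card_eq_fintype_card, Fintype.card_coe]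

lemma natCard_EE (n : ℕ) : Nat.card (EE (Fin n)) = n.choose 2 := by
  have h := Sym2.card_subtype_not_diag (α := Fin n)
  rw [Fintype.card_fin] at h
  rw [← h]
  exact Nat.card_eq_fintype_card

lemma Pr_eq (n : ℕ) (p : ℝ) (P : SimpleGraph (Fin n) → Prop) (i1 : Fintype (EE (Fin n))) (i2 : DecidableEq (EE (Fin n))) :
    Pr n p P = @Ex (EE (Fin n)) i1 i2 (fun _ => p) (fun W => ind (P (gr W))) := by
  unfold Pr Ex
  symm
  have hb : Function.Bijective (gr (V := Fin n)) := by
    rcases gr_bij (V := Fin n) with h | h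
    · exact h
    · exact absurd (inferInstance : Finite (Fin n)) h
  have hc : @Fintype.card (EE (Fin n)) i1 = n.choose 2 :=
    (@Nat.card_eq_fintype_card (EE (Fin n)) i1).symm.trans (natCard_EE n)
  apply Fintype.sum_bijective gr hb
  intro W
  rw [gr_count]
  unfold pw ind
  rw [prod_const, prod_const, card_compl, hc]
  by_cases h : P (gr W)
  · simp only [h, if_true, mul_one]
  · simp only [h, if_false, mul_zero]

lemma card_filt_congr {α : Type} (S : Finset α) (p q : α → Prop) (dp : DecidablePred p) (dq : DecidablePred q) (h : ∀ x, p x ↔ q x) :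
    #(@Finset.filter α p dp S) = #(@Finset.filter α q dq S) := by
  congr 1
  ext x
  simp [h]

variable {V : Type} [Fintype V] {I : Type} [Fintype I]

lemma spr_cover {U : (I) → Finset V} {N : ℕ} (hdis : ∀ a b, a ≠ b → Disjoint (U a) (U b)) (hc : ∀ a, #(U a) = N)
    (hV : Fintype.card V = Fintype.card I * N) (v : V) : inF U v := by
  have : univ.biUnion U = univ := by
    apply eq_univ_of_card
    rw [card_biUnion fun a _ b _ h => hdis a b h, sum_congr rfl fun a _ => hc a, sum_const, card_univ, smul_eq_mul, hV]
  have h := this ▸ mem_univ v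
  obtain ⟨a, _, ha⟩ := mem_biUnion.1 (this.symm ▸ mem_univ v : v ∈ univ.biUnion U)
  exact ⟨a, ha⟩

lemma fib_le {sz : I → ℕ} {U : (Σ i, Fin (sz i)) → Finset V} {adj : (Σ i, Fin (sz i)) → (Σ i, Fin (sz i)) → V → V → Prop}
    {T : V → (Σ i, Fin (sz i)) → V} (hT : Perf adj U T) (hcov : ∀ v, inF U v) (col : V → I) (hcol : ∀ a, ∀ v ∈ U a, col v = a.1)
    (τ : (Σ i, Fin (sz i)) → V) (i : I) (S : Finset V) (hS : ∀ x ∈ S, T x = τ ∧ col x = i) : #S ≤ sz i := by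
  have : S ⊆ (univ : Finset (Fin (sz i))).image fun j => τ ⟨i, j⟩ := by
    intro x hx
    obtain ⟨h1, h2⟩ := hS x hx
    obtain ⟨⟨k, j⟩, ha⟩ := hcov x
    have h3 := hcol _ x ha
    rw [h2] at h3
    simp only at h3
    subst h3
    rw [mem_image]
    refine ⟨j, mem_univ _, ?_⟩
    rw [← h1]
    exact (hT _ x ha).2.2.1
  calc _ ≤ _ := card_le_card this
    _ ≤ _ := card_image_le
    _ = _ := by rw [card_univ, Fintype.card_fin]

lemma factor {n : ℕ} {sz : I → ℕ} {G : SimpleGraph (Fin n)} {U : (Σ i, Fin (sz i)) → Finset (Fin n)}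
    (hdis : ∀ a b, a ≠ b → Disjoint (U a) (U b))
    {T : Fin n → (Σ i, Fin (sz i)) → Fin n} (hT : Perf (sadj sz G) U T) (hcov : ∀ v, inF U v) (col : Fin n → I) (hcol : ∀ a, ∀ v ∈ U a, col v = a.1)
    (r : ℕ) (hr : 0 < r) (hcard : Fintype.card (Σ i, Fin (sz i)) = r) (H : SimpleGraph (Fin n))
    (hH : ∀ x y, x ≠ y → T x = T y → col x = col y → H.Adj x y) : HasCliqueFactor (G ⊔ H) r := by
  have hinj : ∀ v, Function.Injective (T v) := by
    intro v a b hab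
    obtain ⟨c, hc⟩ := hcov v
    have h := (hT c v hc).2.1
    by_contra hne
    exact Finset.disjoint_left.1 (hdis a b hne) (h a) (hab ▸ h b)
  have hself : ∀ v, v ∈ univ.image (T v) := by
    intro v
    obtain ⟨c, hc⟩ := hcov v
    exact mem_image.2 ⟨c, mem_univ _, (hT c v hc).2.2.1⟩
  have hTT : ∀ v b, T (T v b) = T v := by
    intro v b
    obtain ⟨c, hc⟩ := hcov v
    exact (hT c v hc).2.2.2 b
  refine ⟨Finpartition.ofExistsUnique (univ.image fun v => univ.image (T v)) (fun _ _ => subset_univ _) ?_ ?_, ?_⟩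
  · intro v _
    refine ⟨univ.image (T v), ⟨mem_image_of_mem _ (mem_univ _), hself v⟩, ?_⟩
    rintro c ⟨h1, h2⟩
    obtain ⟨w, _, rfl⟩ := mem_image.1 h1
    obtain ⟨b, _, hb⟩ := mem_image.1 h2
    have := hTT w b
    rw [hb] at this
    rw [this]
  · intro h
    obtain ⟨w, _, hw⟩ := mem_image.1 h
    have := hself w
    rw [hw] at this
    exact absurd this (notMem_empty _)
  · intro c hc
    have hc' : c ∈ univ.image fun v => univ.image (T v) := hc
    obtain ⟨v, _, rfl⟩ := mem_image.1 hc'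
    rw [SimpleGraph.isNClique_iff]
    constructor
    · intro x hx y hy hxy
      obtain ⟨a, _, rfl⟩ := mem_image.1 (mem_coe.1 hx)
      obtain ⟨b, _, rfl⟩ := mem_image.1 (mem_coe.1 hy)
      obtain ⟨c, hc⟩ := hcov v
      obtain ⟨k1, k2, k3, k4⟩ := hT c v hc
      rw [SimpleGraph.sup_adj]
      rcases k1 a b with h | h
      · right
        apply hH _ _ hxy
        · rw [hTT, hTT]
        · rw [hcol a _ (k2 a), hcol b _ (k2 b), h]
      · left; exact h
    · rw [card_image_of_injective _ (hinj v), card_univ, hcard]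

end PartG1
end KF

namespace KF
set_option linter.unusedSectionVars false
set_option linter.unusedSimpArgs false
set_option linter.unusedVariables false
section PartG2

/-- number of slots per class -/
def szf (m s t : ℕ) (i : Fin (m + 1)) : ℕ := if (i : ℕ) < m then s else t

lemma szf_card (m s t : ℕ) : Fintype.card (Σ i, Fin (szf m s t i)) = m * s + t := by
  rw [Fintype.card_sigma]
  simp only [Fintype.card_fin]
  rw [Fin.sum_univ_castSucc]
  have h1 : ∀ i : Fin m, szf m s t i.castSucc = s := fun i => by
    unfold szf; rw [if_pos]; exact i.2
  have h2 : szf m s t (Fin.last m) = t := by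
    unfold szf; rw [if_neg]; simp
  rw [sum_congr rfl fun i _ => h1 i, h2, sum_const, card_univ, Fintype.card_fin, smul_eq_mul]

lemma sr_mono {V : Type} {G : SimpleGraph V} {S T : Set V} {ε d ϑ ϑ' : ℝ} (h : IsSuperRegularPair G S T ε d ϑ) (h' : ϑ' ≤ ϑ) :
    IsSuperRegularPair G S T ε d ϑ' :=
  ⟨h.1, fun v hv => (mul_le_mul_of_nonneg_right h' (Nat.cast_nonneg _)).trans (h.2.1 v hv),
    fun v hv => (mul_le_mul_of_nonneg_right h' (Nat.cast_nonneg _)).trans (h.2.2 v hv)⟩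

lemma big_n (A : ℝ) (hA : 0 < A) (θ : ℝ) (hθ : 0 < θ) : ∃ Q : ℕ, ∀ N : ℕ, Q ≤ N → A * N * Real.exp (-(θ * N / 10)) < 1 := by
  obtain ⟨Q, hQ⟩ := ev_lin 1 (Real.log A + 1) (θ / 10) (by positivity)
  refine ⟨max Q 1, fun N hN => ?_⟩
  have hN0 : 0 < (N : ℝ) := by exact_mod_cast (le_max_right _ _).trans hN
  have h := hQ N ((le_max_left _ _).trans hN)
  have e : A * N = Real.exp (Real.log A + Real.log N) := by
    rw [Real.exp_add, Real.exp_log hA, Real.exp_log hN0]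
  rw [e, ← Real.exp_add, ← Real.exp_zero]
  apply Real.exp_lt_exp.2
  linarith

lemma spr_VS {n : ℕ} {I : Type} [Fintype I] {sz : I → ℕ} {U : (Σ i, Fin (sz i)) → Finset (Fin n)} (hcov : ∀ v, inF U v)
    {Ω : Type} [Fintype Ω] (μ : Ω → ℝ) (hμ : ∀ ω, 0 ≤ μ ω) (T : Ω → Fin n → (Σ i, Fin (sz i)) → Fin n) (κ : ℝ)
    (h : ∀ (D : Finset (Fin n)) (f : Fin n → Fin n), (∀ x ∈ D, inF U x ∧ f x ∉ D ∧ inF U (f x)) →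
      ∑ ω, μ ω * ind (∀ x ∈ D, T ω x = T ω (f x)) ≤ κ ^ #D) (col : Fin n → I) :
    VS μ (fun ω v => (T ω v, col v)) κ := by
  intro f hf
  have h1 := h (univ.filter fun x => f x ≠ x) f (by
    intro x hx
    refine ⟨hcov x, ?_, hcov _⟩
    simp [hf x])
  refine le_trans (sum_le_sum fun ω _ => ?_) (le_of_le_of_eq h1 (by congr!))
  apply mul_le_mul_of_nonneg_left _ (hμ ω)
  apply ind_mono
  intro hh x _
  exact (congrArg Prod.fst (hh x)).symm

lemma mem_filt_gen {α : Type} [Fintype α] (p : α → Prop) (dp : DecidablePred p) (x : α) (h : x ∈ @Finset.filter α p dp univ) : p x :=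
  (mem_filter.1 h).2

lemma final_prob {n : ℕ} {Λ Ω : Type} [Fintype Λ] [Fintype Ω] (blk : Ω → Fin n → Λ) (p δ : ℝ) (hp0 : 0 ≤ p) (hp1 : p ≤ 1)
    (i1 : Fintype (EE (Fin n))) (i2 : DecidableEq (EE (Fin n)))
    (h : @Ex _ i1 i2 (fun _ : EE (Fin n) => p) (fun W => ind (¬ ∃ ω, ∀ e, inb (blk ω) e → e ∈ W)) ≤ δ)
    (P : SimpleGraph (Fin n) → Prop)
    (hP : ∀ H : SimpleGraph (Fin n), (∃ ω, ∀ x y, x ≠ y → blk ω x = blk ω y → H.Adj x y) → P H) :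
    1 - δ ≤ Pr n p P := by
  rw [Pr_eq n p P i1 i2]
  have h1 : (1:ℝ) ≤ @Ex _ i1 i2 (fun _ : EE (Fin n) => p) (fun W => ind (P (gr W)) + ind (¬ ∃ ω, ∀ e, inb (blk ω) e → e ∈ W)) := by
    rw [← @Ex_const _ i1 i2 (fun _ : EE (Fin n) => p) 1]
    apply @Ex_mono _ i1 i2 _ (fun _ => hp0) (fun _ => hp1)
    intro W
    by_cases hc : ∃ ω, ∀ e, inb (blk ω) e → e ∈ W
    · have : P (gr W) := by
        apply hP
        obtain ⟨ω, hω⟩ := hc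
        refine ⟨ω, fun x y hxy hb => ?_⟩
        unfold gr
        rw [SimpleGraph.fromEdgeSet_adj]
        refine ⟨⟨by simpa using hxy, hω _ ?_⟩, hxy⟩
        intro u hu v hv
        simp only [Sym2.mem_iff] at hu hv
        rcases hu with rfl | rfl <;> rcases hv with rfl | rfl <;> simp [hb]
      rw [ind_true this]
      have := ind_nonneg (¬ ∃ ω, ∀ e, inb (blk ω) e → e ∈ W)
      linarith
    · rw [ind_true hc]
      have := ind_nonneg (P (gr W))
      linarith
  rw [Ex_add] at h1
  linarith

theorem main7 (m s t : ℕ) (hm : 1 ≤ m) (hs : 2 ≤ s) (ht : 1 ≤ t) (hts : t ≤ s)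
    (ϑ : ℝ) (hϑ : 0 < ϑ) :
    ∃ ε₀ : ℝ, 0 < ε₀ ∧ ∀ ε : ℝ, 0 < ε → ε ≤ ε₀ →
      ∃ C : ℝ, 0 < C ∧
        ∀ δ : ℝ, 0 < δ → ∃ n₀ : ℕ, ∀ n : ℕ, n₀ ≤ n → (m * s + t) ∣ n →
          ∀ G : SimpleGraph (Fin n), ∀ W : Fin (m + 1) → Set (Fin n),
            (Set.univ = ⋃ i, W i) →
            (Pairwise (Function.onFun Disjoint W)) →
            (∀ i : Fin (m + 1), (i : ℕ) < m → (W i).ncard * (m * s + t) = s * n) →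
            ((W (Fin.last m)).ncard * (m * s + t) = t * n) →
            (∀ i, ∀ x ∈ W i, ∀ y ∈ W i, ¬ G.Adj x y) →
            (∀ i j, i ≠ j → ∃ d : ℝ, ϑ ≤ d ∧ IsSuperRegularPair G (W i) (W j) ε d ϑ) →
            1 - δ ≤ Pr n (C * (n : ℝ) ^ (-(2 : ℝ) / (s : ℝ)) *
                (Real.log n) ^ ((2 : ℝ) / ((s : ℝ) * ((s : ℝ) - 1))))
              (fun H => HasCliqueFactor (G ⊔ H) (m * s + t)) := by
  obtain ⟨r, hr⟩ : ∃ r, r = m * s + t := ⟨_, rfl⟩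
  have hr0 : 0 < r := by omega
  have hr1 : (1:ℝ) ≤ r := by exact_mod_cast hr0
  have hs0 : (0:ℝ) < s := by exact_mod_cast (by omega : 0 < s)
  obtain ⟨θ, hθ⟩ : ∃ θ, θ = min ϑ 1 := ⟨_, rfl⟩
  have hθ0 : 0 < θ := by rw [hθ]; exact lt_min hϑ one_pos
  have hθ1 : θ ≤ 1 := by rw [hθ]; exact min_le_right _ _
  have hθϑ : θ ≤ ϑ := by rw [hθ]; exact min_le_left _ _
  obtain ⟨ε1, hε1, K, hK, Q1, hQ1⟩ := spr_main r hr0 (θ / 2) (by positivity) (by linarith)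
  obtain ⟨Q2, hQ2⟩ := big_n (r * s) (by positivity) θ hθ0
  refine ⟨min 1 (ε1 / (4 * (s:ℝ) ^ 2)), lt_min one_pos (by positivity), ?_⟩
  intro ε hε hεle
  have hεone : ε ≤ 1 := hεle.trans (min_le_left _ _)
  have hεs : 4 * ε * (s:ℝ) ^ 2 ≤ ε1 := by
    have := hεle.trans (min_le_right _ _)
    rw [le_div_iff₀ (by positivity)] at this
    linarith
  obtain ⟨C, hC, hCF⟩ := CF s hs (K * r) (by nlinarith only [hK, hr1])
  refine ⟨C, hC, fun δ hδ => ?_⟩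
  obtain ⟨n0, hn0⟩ := hCF δ hδ
  refine ⟨max n0 (r * (Q1 + Q2 + 1)), ?_⟩
  intro n hn hdvd G W hcovW hdisW hcs hct _ hreg
  rw [← hr] at hdvd hcs hct ⊢
  obtain ⟨N, rfl⟩ := hdvd
  have hNQ : Q1 + Q2 + 1 ≤ N := Nat.le_of_mul_le_mul_left ((le_max_right _ _).trans hn) hr0
  have hN0 : 0 < N := by omega
  have hN0' : (0:ℝ) < N := by exact_mod_cast hN0
  obtain ⟨WF, hWF⟩ : ∃ WF : Fin (m + 1) → Finset (Fin (r * N)), ∀ i, (↑(WF i) : Set (Fin (r * N))) = W i :=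
    ⟨fun i => (W i).toFinset, fun i => Set.coe_toFinset _⟩
  have hdisF : ∀ i j, i ≠ j → Disjoint (WF i) (WF j) := by
    intro i j hij
    have := hdisW hij
    unfold Function.onFun at this
    rw [← hWF, ← hWF, Finset.disjoint_coe] at this
    exact this
  have hcard : ∀ i, #(WF i) = szf m s t i * N := by
    intro i
    rw [← Set.ncard_coe_finset, hWF]
    unfold szf
    split_ifs with h
    · have := hcs i h
      apply Nat.eq_of_mul_eq_mul_right hr0
      rw [this]; ring
    · have hi : i = Fin.last m := by
        apply Fin.ext; rw [Fin.val_last]; have := i.2; omega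
      subst hi
      apply Nat.eq_of_mul_eq_mul_right hr0
      rw [hct]; ring
  obtain ⟨U, d, hA, hGd, hUW⟩ := top_good (szf m s t) s (by intro i; unfold szf; split_ifs <;> omega)
    (by intro i; unfold szf; split_ifs <;> omega) G WF hdisF N hN0 hcard θ ε ε1 hθ0 hθ1 hε hεone hεs
    (by
      intro i j hij
      obtain ⟨d, _, hd⟩ := hreg i j hij
      refine ⟨d, ?_⟩
      rw [hWF, hWF]
      exact sr_mono hd hθϑ)
    (by
      have := hQ2 N (by omega)
      rw [Fintype.card_fin]
      push_cast
      calc _ = _ := by ring_nf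
        _ < 1 := this)
  have hcardI : Fintype.card (Σ i, Fin (szf m s t i)) = r := by rw [szf_card, hr]
  obtain ⟨Ω, _, μ, T, hμ, hμ1, hT, hsp⟩ := hQ1 (Fin (r * N)) _ hcardI (sadj (szf m s t) G) d hA N (by omega) U hGd
  have hcov : ∀ v, inF U v := fun v =>
    spr_cover hGd.disj hGd.card (by rw [hcardI, Fintype.card_fin]) v
  have hex : ∀ v, ∃ i, v ∈ W i := by
    intro v
    have : v ∈ ⋃ i, W i := hcovW ▸ Set.mem_univ v
    exact Set.mem_iUnion.1 this
  choose col hcol' using hex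
  have hcol : ∀ a, ∀ v ∈ U a, col v = a.1 := by
    intro a v hv
    by_contra hne
    have h1 := hUW a hv
    have h2 := hcol' v
    rw [← hWF] at h2
    exact Finset.disjoint_left.1 (hdisF _ _ hne) h2 h1
  obtain ⟨hp0, hp1, hE⟩ := hn0 (r * N) ((le_max_left _ _).trans hn) (Fin (r * N))
    (((Σ i, Fin (szf m s t i)) → Fin (r * N)) × Fin (m + 1)) Ω (Fintype.card_fin _) μ hμ hμ1
    (fun ω v => (T ω v, col v))
    (by
      rintro ω ⟨τ, i⟩
      refine (fib_le (hT ω) hcov col hcol τ i _ ?_).trans (by unfold szf; split_ifs <;> omega : szf m s t i ≤ s)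
      intro x hx
      have := mem_filt_gen _ _ _ hx
      exact ⟨congrArg Prod.fst this, congrArg Prod.snd this⟩)
    (by
      have e : K * r / ((r * N : ℕ) : ℝ) = K / N := by
        push_cast
        field_simp
      rw [e]
      exact spr_VS hcov μ hμ T _ hsp col)
  apply final_prob _ _ δ hp0 hp1 _ _ hE
  rintro H ⟨ω, hω⟩
  exact factor hGd.disj (hT ω) hcov col hcol r hr0 hcardI H
    (fun x y hxy h1 h2 => hω x y hxy (Prod.ext h1 h2))

end PartG2
end KF

/-- Lemma 4.5: `K_r`-factors in randomly perturbed balanced super-regular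
`(m+1)`-partite graphs, where `r = ms + t` with `t ∈ [s]`. -/
theorem statement7 (m s t : ℕ) (hm : 1 ≤ m) (hs : 2 ≤ s) (ht : 1 ≤ t) (hts : t ≤ s)
    (ϑ : ℝ) (hϑ : 0 < ϑ) :
    ∃ ε₀ : ℝ, 0 < ε₀ ∧ ∀ ε : ℝ, 0 < ε → ε ≤ ε₀ →
      ∃ C : ℝ, 0 < C ∧
        ∀ δ : ℝ, 0 < δ → ∃ n₀ : ℕ, ∀ n : ℕ, n₀ ≤ n → (m * s + t) ∣ n →
          ∀ G : SimpleGraph (Fin n), ∀ W : Fin (m + 1) → Set (Fin n),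
            (Set.univ = ⋃ i, W i) →
            (Pairwise (Function.onFun Disjoint W)) →
            (∀ i : Fin (m + 1), (i : ℕ) < m → (W i).ncard * (m * s + t) = s * n) →
            ((W (Fin.last m)).ncard * (m * s + t) = t * n) →
            (∀ i, ∀ x ∈ W i, ∀ y ∈ W i, ¬ G.Adj x y) →
            (∀ i j, i ≠ j → ∃ d : ℝ, ϑ ≤ d ∧ IsSuperRegularPair G (W i) (W j) ε d ϑ) →
            1 - δ ≤ Pr n (C * (n : ℝ) ^ (-(2 : ℝ) / (s : ℝ)) *
                (Real.log n) ^ ((2 : ℝ) / ((s : ℝ) * ((s : ℝ) - 1))))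
              (fun H => HasCliqueFactor (G ⊔ H) (m * s + t)) := by
  exact KF.main7 m s t hm hs ht hts ϑ hϑ
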